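/- Let t ≥ 1 be an integer and let σ be an assignment of a parity (odd or even) to each edge of K_t. Then every finite simple graph G that does not admit an immersion of K_t in which, for each edge e of K_t, the branch trail corresponding to e has length of parity σ(e), has chromatic number at most 700000·t + 32000000. -/

import Mathlib

open SimpleGraph

/-- An immersion of `H` in `G`: an injection `φ` of the vertices of `H` into `G`
(the branch vertices), together with, for each edge `uv` of `H`, a trail in `G`
from `φ u` to `φ v` (the branch trails), such that the branch trails are
pairwise edge-disjoint.  The trail assigned to the reversed adjacency is the
reversed trail, so there is one branch trail per edge of `H`. -/
structure Immersion {V : Type*} {W : Type*} (G : SimpleGraph V) (H : SimpleGraph W) where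
  φ : W ↪ V
  trail : ∀ ⦃u v : W⦄, H.Adj u v → G.Walk (φ u) (φ v)
  isTrail : ∀ ⦃u v : W⦄ (h : H.Adj u v), (trail h).IsTrail
  symm : ∀ ⦃u v : W⦄ (h : H.Adj u v), trail h.symm = (trail h).reverse
  disjoint : ∀ ⦃u v a b : W⦄ (h₁ : H.Adj u v) (h₂ : H.Adj a b),
      s(u, v) ≠ s(a, b) → List.Disjoint (trail h₁).edges (trail h₂).edges

/-- `G` admits an immersion of `H`. -/
def HasImmersion {V W : Type*} (G : SimpleGraph V) (H : SimpleGraph W) : Prop :=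
  Nonempty (Immersion G H)

/-- `G` admits a totally odd immersion of `H`: every branch trail has odd length. -/
def HasTotallyOddImmersion {V W : Type*} (G : SimpleGraph V) (H : SimpleGraph W) : Prop :=
  ∃ I : Immersion G H, ∀ ⦃u v : W⦄ (h : H.Adj u v), Odd (I.trail h).length

/-- `G` admits a totally even immersion of `H`: every branch trail has even length. -/
def HasTotallyEvenImmersion {V W : Type*} (G : SimpleGraph V) (H : SimpleGraph W) : Prop :=
  ∃ I : Immersion G H, ∀ ⦃u v : W⦄ (h : H.Adj u v), Even (I.trail h).length

/-- `G` admits an immersion of K_t with parity pattern σ: for each edge e of K_t, the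
corresponding branch trail has length congruent to σ(e) modulo 2. -/
def HasParityPatternImmersion {V : Type*} (G : SimpleGraph V) (t : ℕ)
    (σ : Sym2 (Fin t) → ZMod 2) : Prop :=
  ∃ I : Immersion G (⊤ : SimpleGraph (Fin t)),
    ∀ ⦃u v : Fin t⦄ (h : (⊤ : SimpleGraph (Fin t)).Adj u v),
      ((I.trail h).length : ZMod 2) = σ s(u, v)


namespace PPI
set_option linter.unusedSectionVars false
section
open Finset
open scoped Classical

variable {V : Type*} [Fintype V]

noncomputable def nb (H : SimpleGraph V) (u : V) : Finset V := univ.filter (fun v => H.Adj u v)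

@[simp] lemma mem_nb {H : SimpleGraph V} {u v : V} : v ∈ nb H u ↔ H.Adj u v := by
  simp [nb]

def PC (G : SimpleGraph V) (K : ℕ) (W : Finset V) : Prop :=
  ∃ c : V → Fin K, ∀ u ∈ W, ∀ v ∈ W, G.Adj u v → c u ≠ c v

def Critical (G : SimpleGraph V) (K : ℕ) : Prop :=
  ¬ PC G K univ ∧ ∀ W : Finset V, W ≠ univ → PC G K W

lemma palette_extend (G : SimpleGraph V) (K : ℕ) (Y : Finset V) (c0 : V → Fin K)
    (h0 : ∀ u, u ∉ Y → ∀ v, v ∉ Y → G.Adj u v → c0 u ≠ c0 v)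
    (P : V → Finset (Fin K)) (bad : V → Finset V)
    (hcard : ∀ x ∈ Y, #(bad x) < #(P x))
    (h1 : ∀ x ∈ Y, ∀ y, G.Adj x y → y ∉ bad x → y ∉ Y → c0 y ∉ P x)
    (h2 : ∀ x ∈ Y, ∀ y, G.Adj x y → y ∉ bad x → y ∈ Y → Disjoint (P y) (P x)) :
    PC G K univ := by
  suffices H : ∀ W : Finset V, W ⊆ Y → ∃ c : V → Fin K,
      (∀ u, u ∉ Y → c u = c0 u) ∧ (∀ u ∈ W, c u ∈ P u) ∧
      (∀ u, (u ∉ Y ∨ u ∈ W) → ∀ v, (v ∉ Y ∨ v ∈ W) → G.Adj u v → c u ≠ c v) by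
    obtain ⟨c, -, -, h⟩ := H Y (le_refl _)
    exact ⟨c, fun u _ v _ => h u (by tauto) v (by tauto)⟩
  intro W
  induction W using Finset.induction_on with
  | empty =>
    intro _
    refine ⟨c0, fun _ _ => rfl, by simp, ?_⟩
    intro u hu v hv
    exact h0 u (by simpa using hu) v (by simpa using hv)
  | insert x W hx ih =>
    intro hW
    have hxY : x ∈ Y := hW (mem_insert_self _ _)
    obtain ⟨c, hc0, hcP, hc⟩ := ih (fun y hy => hW (mem_insert_of_mem hy))
    have : ∃ k ∈ P x, k ∉ (bad x).image c := by
      by_contra hcon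
      push Not at hcon
      have := card_le_card (show P x ⊆ (bad x).image c from hcon)
      have h3 := card_image_le (s := bad x) (f := c)
      have := hcard x hxY
      omega
    obtain ⟨k, hkP, hk⟩ := this
    have key : ∀ y, (y ∉ Y ∨ y ∈ W) → G.Adj x y → c y ≠ k := by
      rintro y hy hxy rfl
      by_cases hb : y ∈ bad x
      · exact hk (mem_image_of_mem _ hb)
      by_cases hyY : y ∈ Y
      · have hyW : y ∈ W := by tauto
        exact Finset.disjoint_left.1 (h2 x hxY y hxy hb hyY) (hcP y hyW) hkP
      · have := h1 x hxY y hxy hb hyY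
        rw [← hc0 y hyY] at this
        exact this hkP
    refine ⟨Function.update c x k, ?_, ?_, ?_⟩
    · intro u hu
      rw [Function.update_of_ne (by rintro rfl; exact hu hxY)]
      exact hc0 u hu
    · intro u hu
      by_cases hux : u = x
      · subst hux; simpa using hkP
      · rw [Function.update_of_ne hux]
        exact hcP u (by simpa [hux] using hu)
    · intro u hu v hv huv
      by_cases hux : u = x
      · subst hux
        have hvu : v ≠ u := huv.ne'
        rw [Function.update_self, Function.update_of_ne hvu]
        refine (key v ?_ huv).symm
        simpa [hvu] using hv
      · rw [Function.update_of_ne hux]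
        by_cases hvx : v = x
        · subst hvx
          rw [Function.update_self]
          refine key u ?_ huv.symm
          simpa [hux] using hu
        · rw [Function.update_of_ne hvx]
          exact hc u (by simpa [hux] using hu) v (by simpa [hvx] using hv) huv

lemma Critical.degree {G : SimpleGraph V} {K : ℕ} (h : Critical G K) (x : V) :
    K ≤ #(nb G x) := by
  by_contra hlt
  obtain ⟨c0, hc0⟩ := h.2 ({x}ᶜ) (by
    intro h'
    have := mem_univ x
    rw [← h'] at this
    simp at this)
  apply h.1
  refine palette_extend G K {x} c0 ?_ (fun _ => univ) (fun y => nb G y) ?_ ?_ ?_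
  · intro u hu v hv
    exact hc0 u (by simpa using hu) v (by simpa using hv)
  · intro y hy
    simp at hy
    subst hy
    simpa using hlt
  · intro y _ z hyz hz
    simp [hyz] at hz
  · intro y _ z hyz hz
    simp [hyz] at hz

lemma Critical.cut {G : SimpleGraph V} {K : ℕ} (hK : 2 ≤ K) (h : Critical G K) (Q : Finset V)
    (hQ : Q.Nonempty) (hQ' : Q ≠ univ) (e0 : Sym2 V) :
    ∃ x ∈ Q, ∃ y, y ∉ Q ∧ G.Adj x y ∧ s(x, y) ≠ e0 := by
  by_contra hcon
  push Not at hcon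
  obtain ⟨c1, hc1⟩ := h.2 Q hQ'
  obtain ⟨c2, hc2⟩ := h.2 Qᶜ (by
    intro h'
    obtain ⟨x, hx⟩ := hQ
    have := mem_univ x
    rw [← h'] at this
    simp at this
    exact this hx)
  have : Nontrivial (Fin K) := by
    obtain ⟨k, rfl⟩ : ∃ k, K = k + 2 := ⟨K - 2, by omega⟩
    infer_instance
  have : ∃ π : Equiv.Perm (Fin K), ∀ x ∈ Q, ∀ y, y ∉ Q → G.Adj x y → c1 x ≠ π (c2 y) := by
    by_cases hex : ∃ x ∈ Q, ∃ y, y ∉ Q ∧ G.Adj x y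
    · obtain ⟨x, hx, y, hy, hxy⟩ := hex
      obtain ⟨k, hk⟩ := exists_ne (c1 x)
      refine ⟨Equiv.swap (c2 y) k, ?_⟩
      intro x' hx' y' hy' hxy'
      have e1 := hcon x hx y hy hxy
      have e2 := hcon x' hx' y' hy' hxy'
      rw [← e1] at e2
      rw [Sym2.eq_iff] at e2
      rcases e2 with ⟨rfl, rfl⟩ | ⟨rfl, rfl⟩
      · rw [Equiv.swap_apply_left]; exact hk.symm
      · exact absurd hx' hy
    · push Not at hex
      exact ⟨1, fun x hx y hy hxy => absurd hxy (hex x hx y hy)⟩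
  obtain ⟨π, hπ⟩ := this
  apply h.1
  refine ⟨fun v => if v ∈ Q then c1 v else π (c2 v), ?_⟩
  intro u _ v _ huv
  by_cases hu : u ∈ Q <;> by_cases hv : v ∈ Q <;> simp only [hu, hv, if_true, if_false]
  · exact hc1 u hu v hv huv
  · exact hπ u hu v hv huv
  · exact (hπ v hv u hu huv.symm).symm
  · intro h'
    exact hc2 u (by simpa using hu) v (by simpa using hv) huv (π.injective h')

lemma Critical.extension {G : SimpleGraph V} {K D : ℕ} (h : Critical G K) (A B Z : Finset V)
    (hAB : Disjoint A B) (hK : #Z + 2 * (D + 1) ≤ K)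
    (hA : ∀ x ∈ A, x ∉ Z → #((nb G x).filter (fun y => y ∉ B ∧ y ∉ Z)) ≤ D)
    (hB : ∀ x ∈ B, x ∉ Z → #((nb G x).filter (fun y => y ∉ A ∧ y ∉ Z)) ≤ D)
    (hne : ∃ x ∈ A ∪ B, x ∉ Z) : False := by
  obtain ⟨x0, hx0, hx0Z⟩ := hne
  obtain ⟨c0, hc0⟩ := h.2 (((A ∪ B) \ Z)ᶜ) (by
    intro h'
    have := mem_univ x0
    rw [← h'] at this
    simp only [mem_compl, mem_sdiff] at this
    exact this ⟨hx0, hx0Z⟩)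
  have hZc : #(Z.image c0) ≤ #Z := card_image_le
  have hcc : #((Z.image c0)ᶜ) = K - #(Z.image c0) := by rw [card_compl]; simp
  obtain ⟨PA, hPA, hPAc⟩ := exists_subset_card_eq (s := (Z.image c0)ᶜ) (n := D + 1) (by omega)
  have hcc2 : #((Z.image c0)ᶜ \ PA) = #((Z.image c0)ᶜ) - #PA := card_sdiff_of_subset hPA
  obtain ⟨PB, hPB, hPBc⟩ := exists_subset_card_eq (s := (Z.image c0)ᶜ \ PA) (n := D + 1) (by omega)
  have hdis : Disjoint PA PB := by
    rw [Finset.disjoint_left]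
    intro k hk hk'
    exact (mem_sdiff.1 (hPB hk')).2 hk
  have hPAZ : ∀ z ∈ Z, c0 z ∉ PA := fun z hz hk => by
    have := hPA hk
    rw [mem_compl] at this
    exact this (mem_image_of_mem _ hz)
  have hPBZ : ∀ z ∈ Z, c0 z ∉ PB := fun z hz hk => by
    have := (mem_sdiff.1 (hPB hk)).1
    rw [mem_compl] at this
    exact this (mem_image_of_mem _ hz)
  have hAB' : ∀ x ∈ B, x ∉ A := fun x hx hx' => Finset.disjoint_left.1 hAB hx' hx
  apply h.1
  refine palette_extend G K ((A ∪ B) \ Z) c0 ?_ (fun x => if x ∈ A then PA else PB)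
    (fun x => (nb G x).filter (fun y => (if x ∈ A then y ∉ B else y ∉ A) ∧ y ∉ Z)) ?_ ?_ ?_
  · intro u hu v hv
    exact hc0 u (by rwa [mem_compl]) v (by rwa [mem_compl])
  · intro x hx
    simp only [mem_sdiff, mem_union] at hx
    by_cases hxA : x ∈ A
    · simp only [hxA, if_true]
      have := hA x hxA hx.2
      omega
    · simp only [hxA, if_false]
      have := hB x (by tauto) hx.2
      omega
  · intro x hx y hxy hy hyY
    simp only [mem_sdiff, mem_union] at hx hyY
    simp only [mem_filter, mem_nb, hxy, true_and] at hy
    have hyZ : y ∈ Z := by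
      by_cases hxA : x ∈ A <;> simp only [hxA, if_true, if_false] at hy <;> tauto
    by_cases hxA : x ∈ A <;> simp only [hxA, if_true, if_false]
    · exact hPAZ y hyZ
    · exact hPBZ y hyZ
  · intro x hx y hxy hy hyY
    simp only [mem_sdiff, mem_union] at hx hyY
    simp only [mem_filter, mem_nb, hxy, true_and] at hy
    by_cases hxA : x ∈ A <;> simp only [hxA, if_true, if_false] at hy ⊢
    · have hyB : y ∈ B := by tauto
      simp only [hAB' y hyB, if_false]
      exact hdis.symm
    · have hyA : y ∈ A := by tauto
      simp only [hyA, if_true]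
      exact hdis

lemma exists_critical (G : SimpleGraph V) (K : ℕ) (hK : 0 < K) (h : ¬ PC G K univ) :
    ∃ W : Finset V, Critical (G.comap (Subtype.val : {x // x ∈ W} → V)) K := by
  obtain ⟨W, hW, hmin⟩ := WellFounded.has_min (r := fun (a b : Finset V) => #a < #b)
    (InvImage.wf _ Nat.lt_wfRel.wf) {W | ¬ PC G K W} ⟨univ, h⟩
  refine ⟨W, ?_, ?_⟩
  · rintro ⟨c, hc⟩
    apply hW
    by_cases hne : W.Nonempty
    · obtain ⟨w, hw⟩ := hne
      refine ⟨fun v => if hv : v ∈ W then c ⟨v, hv⟩ else c ⟨w, hw⟩, ?_⟩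
      intro u hu v hv huv
      simp only [hu, hv, dif_pos]
      exact hc _ (mem_univ _) _ (mem_univ _) huv
    · rw [not_nonempty_iff_eq_empty] at hne
      subst hne
      exact ⟨fun _ => ⟨0, hK⟩, by simp⟩
  · intro W' hW'
    by_contra hcon
    have : PC G K (W'.map ⟨Subtype.val, Subtype.val_injective⟩) := by
      by_contra h'
      have h2 := hmin _ h'
      rw [card_map] at h2
      have : #W' < #(univ : Finset {x // x ∈ W}) :=
        card_lt_card (ssubset_univ_iff.2 hW')
      simp at this
      omega
    obtain ⟨c, hc⟩ := this
    refine hcon ⟨fun v => c v, ?_⟩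
    intro u hu v hv huv
    exact hc _ (by simpa using hu) _ (by simpa using hv) huv

end
end PPI

namespace PPI
set_option linter.unusedSectionVars false
section
open Finset
open scoped Classical

variable {V : Type*} [Fintype V]

def CutOK (C : SimpleGraph V) : Prop :=
  ∀ Q : Finset V, Q.Nonempty → Q ≠ univ → ∀ e0 : Sym2 V,
    ∃ x ∈ Q, ∃ y, y ∉ Q ∧ C.Adj x y ∧ s(x, y) ≠ e0

lemma CutOK.mono {C C' : SimpleGraph V} (h : CutOK C) (hle : C ≤ C') : CutOK C' := by
  intro Q hQ hQ' e0
  obtain ⟨x, hx, y, hy, hxy, he⟩ := h Q hQ hQ' e0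
  exact ⟨x, hx, y, hy, hle hxy, he⟩

lemma exists_cross {H : SimpleGraph V} {a b : V} (h : H.Reachable a b) (Q : Finset V)
    (ha : a ∈ Q) (hb : b ∉ Q) : ∃ x ∈ Q, ∃ y, y ∉ Q ∧ H.Adj x y := by
  obtain ⟨p⟩ := h
  obtain ⟨d, -, h1, h2⟩ := p.exists_boundary_dart (Q : Set V) (by simpa using ha) (by simpa using hb)
  exact ⟨d.fst, by simpa using h1, d.snd, by simpa using h2, d.adj⟩

lemma card_nb (H : SimpleGraph V) (u : V) : #(nb H u) = H.degree u := by
  rw [← card_neighborFinset_eq_degree]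
  congr 1
  ext v
  simp

lemma sum_nb (H : SimpleGraph V) : ∑ u, #(nb H u) = 2 * #H.edgeFinset := by
  simp_rw [card_nb]
  exact H.sum_degrees_eq_twice_card_edges

lemma sum_nb_acyclic [Nonempty V] (H : SimpleGraph V) (h : H.IsAcyclic) :
    ∑ u, #(nb H u) ≤ 2 * Fintype.card V := by
  obtain ⟨T, hHT, hT, hTt⟩ := (connected_top (V := V)).exists_isTree_le_of_le_of_isAcyclic
    (le_top : H ≤ ⊤) h
  have h1 := hTt.card_edgeFinset
  have h2 : #H.edgeFinset ≤ #T.edgeFinset := card_le_card (edgeFinset_mono hHT)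
  rw [sum_nb]
  omega

lemma CutOK.connected [Nonempty V] {G : SimpleGraph V} (h : CutOK G) : G.Connected := by
  rw [connected_iff]
  refine ⟨?_, inferInstance⟩
  intro a b
  by_contra hab
  obtain ⟨x, hx, y, hy, hxy, -⟩ := h (univ.filter (fun v => G.Reachable a v))
    ⟨a, by simp⟩ (by
      intro h'
      have := mem_univ b
      rw [← h'] at this
      simp at this
      exact hab this) s(a, a)
  simp at hx hy
  exact hy (hx.trans hxy.reachable)

lemma exists_certificate [Nonempty V] (G : SimpleGraph V) (h : CutOK G) :
    ∃ C ≤ G, CutOK C ∧ ∑ u, #(nb C u) ≤ 4 * Fintype.card V := by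
  obtain ⟨T1, hT1, hT1t⟩ := h.connected.exists_isTree_le
  obtain ⟨T2, hT2, hT2a, hr⟩ := exists_isAcyclic_reachable_eq_le (G := G \ T1)
  refine ⟨T1 ⊔ T2, sup_le hT1 (hT2.trans sdiff_le), ?_, ?_⟩
  · intro Q hQ hQ' e0
    obtain ⟨a, ha⟩ := hQ
    obtain ⟨b, hb⟩ : ∃ b, b ∉ Q := by
      by_contra hcon
      push Not at hcon
      exact hQ' (eq_univ_iff_forall.2 hcon)
    obtain ⟨x, hx, y, hy, hxy⟩ := exists_cross (hT1t.1.preconnected a b) Q ha hb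
    by_cases hex : ∃ u ∈ Q, ∃ v, v ∉ Q ∧ (G \ T1).Adj u v
    · obtain ⟨u, hu, v, hv, huv⟩ := hex
      have : T2.Reachable u v := by rw [hr]; exact huv.reachable
      obtain ⟨u', hu', v', hv', huv'⟩ := exists_cross this Q hu hv
      by_cases he : s(x, y) = e0
      · refine ⟨u', hu', v', hv', Or.inr huv', ?_⟩
        rw [← he]
        intro h'
        have h3 : (G \ T1).Adj u' v' := hT2 huv'
        have h4 : s(u', v') ∈ T1.edgeSet := by rw [h']; exact hxy
        exact h3.2 h4
      · exact ⟨x, hx, y, hy, Or.inl hxy, he⟩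
    · push Not at hex
      obtain ⟨u, hu, v, hv, huv, he⟩ := h Q ⟨a, ha⟩ hQ' e0
      refine ⟨u, hu, v, hv, Or.inl ?_, he⟩
      have := hex u hu v hv
      simp only [sdiff_adj] at this
      tauto
  · have h1 := sum_nb_acyclic T1 hT1t.2
    have h2 := sum_nb_acyclic T2 hT2a
    have : ∀ u, #(nb (T1 ⊔ T2) u) ≤ #(nb T1 u) + #(nb T2 u) := by
      intro u
      refine le_trans (card_le_card ?_) (card_union_le _ _)
      intro v hv
      simpa using hv
    have h3 := sum_le_sum (fun u (_ : u ∈ (univ : Finset V)) => this u)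
    rw [sum_add_distrib] at h3
    omega

lemma exists_side (G : SimpleGraph V) : ∃ side : V → Bool,
    ∑ u, #(nb G u) ≤ 2 * ∑ u, #((nb G u).filter (fun v => side u ≠ side v)) := by
  by_contra hcon
  push Not at hcon
  have key : ∀ u v : V, G.Adj u v →
      #(univ.filter (fun s : V → Bool => s u ≠ s v)) = #(univ.filter (fun s : V → Bool => s u = s v)) := by
    intro u v huv
    refine card_bij' (fun s _ => Function.update s u (!(s u))) (fun s _ => Function.update s u (!(s u)))
      ?_ ?_ ?_ ?_
    · intro s hs
      simp only [mem_filter, mem_univ, true_and] at hs ⊢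
      rw [Function.update_self, Function.update_of_ne huv.ne']
      revert hs; cases s u <;> cases s v <;> simp
    · intro s hs
      simp only [mem_filter, mem_univ, true_and] at hs ⊢
      rw [Function.update_self, Function.update_of_ne huv.ne']
      revert hs; cases s u <;> cases s v <;> simp
    · intro s _; simp
    · intro s _; simp
  have h1 : ∀ s : V → Bool, ∑ u, #((nb G u).filter (fun v => s u ≠ s v)) <
      ∑ u, #((nb G u).filter (fun v => s u = s v)) := by
    intro s
    have h2 := hcon s
    have h3 : ∑ u, #(nb G u) = ∑ u, #((nb G u).filter (fun v => s u = s v)) +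
        ∑ u, #((nb G u).filter (fun v => s u ≠ s v)) := by
      rw [← sum_add_distrib]
      refine sum_congr rfl fun u _ => ?_
      exact (card_filter_add_card_filter_not _).symm
    omega
  have h2 := sum_lt_sum_of_nonempty (s := (univ : Finset (V → Bool))) univ_nonempty (fun s _ => h1 s)
  refine absurd h2 (not_lt.2 (le_of_eq ?_))
  rw [sum_comm, sum_comm (s := (univ : Finset (V → Bool)))]
  refine sum_congr rfl fun u _ => ?_
  simp_rw [card_filter]
  rw [sum_comm, sum_comm (s := (univ : Finset (V → Bool)))]
  refine sum_congr rfl fun v hv => ?_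
  rw [← card_filter, ← card_filter]
  exact (key u v (by simpa using hv)).symm

lemma exists_core [Nonempty V] (G : SimpleGraph V) (d : ℕ) (hd : 0 < d)
    (h : 2 * d * Fintype.card V ≤ ∑ u, #(nb G u)) :
    ∃ U : Finset V, U.Nonempty ∧ ∀ u ∈ U, d ≤ #((nb G u).filter (fun v => v ∈ U)) := by
  obtain ⟨U, ⟨hUne, hU⟩, hmin⟩ := WellFounded.has_min (r := fun (a b : Finset V) => #a < #b)
    (InvImage.wf _ Nat.lt_wfRel.wf)
    {U : Finset V | U.Nonempty ∧ 2 * d * #U ≤ ∑ u ∈ U, #((nb G u).filter (fun v => v ∈ U))}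
    ⟨univ, univ_nonempty, by simpa using h⟩
  refine ⟨U, hUne, ?_⟩
  intro x hx
  by_contra hlt
  push Not at hlt
  have hcard : #(U.erase x) + 1 = #U := card_erase_add_one hx
  have hsum : ∑ u ∈ U, #((nb G u).filter (fun v => v ∈ U)) =
      ∑ u ∈ U.erase x, #((nb G u).filter (fun v => v ∈ U.erase x)) +
        2 * #((nb G x).filter (fun v => v ∈ U)) := by
    rw [← add_sum_erase _ _ hx]
    have : ∀ u ∈ U.erase x, #((nb G u).filter (fun v => v ∈ U)) =
        #((nb G u).filter (fun v => v ∈ U.erase x)) + (if G.Adj x u then 1 else 0) := by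
      intro u hu
      split_ifs with hadj
      · rw [← card_insert_of_notMem (s := (nb G u).filter (fun v => v ∈ U.erase x)) (a := x) (by simp)]
        congr 1
        ext v
        simp only [mem_filter, mem_nb, mem_insert, mem_erase]
        constructor
        · tauto
        · rintro (rfl | h)
          · exact ⟨hadj.symm, hx⟩
          · tauto
      · rw [add_zero]
        congr 1
        ext v
        simp only [mem_filter, mem_nb, mem_erase]
        constructor
        · rintro ⟨h1, h2⟩
          refine ⟨h1, ?_, h2⟩
          rintro rfl
          exact hadj h1.symm
        · tauto
    rw [sum_congr rfl this, sum_add_distrib, ← card_filter]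
    have : (U.erase x).filter (fun u => G.Adj x u) = (nb G x).filter (fun v => v ∈ U) := by
      ext v
      simp only [mem_filter, mem_nb, mem_erase]
      constructor
      · tauto
      · rintro ⟨h1, h2⟩
        exact ⟨⟨h1.ne', h2⟩, h1⟩
    rw [this]
    omega
  have hle : 2 * d * #(U.erase x) ≤ ∑ u ∈ U.erase x, #((nb G u).filter (fun v => v ∈ U.erase x)) := by
    have : 2 * d * #U = 2 * d * #(U.erase x) + 2 * d := by rw [← hcard]; ring
    omega
  by_cases hne : (U.erase x).Nonempty
  · exact hmin _ ⟨hne, hle⟩ (by omega)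
  · rw [not_nonempty_iff_eq_empty] at hne
    have : #((nb G x).filter (fun v => v ∈ U)) = 0 := by
      rw [card_eq_zero, filter_eq_empty_iff]
      intro v hv hvU
      have : v ∈ U.erase x := by
        rw [mem_erase]
        refine ⟨?_, hvU⟩
        rw [mem_nb] at hv
        exact hv.ne'
      rw [hne] at this
      simp at this
    rw [hne] at hsum hcard
    simp at hsum hcard
    rw [← hcard] at hU
    rw [hsum, this] at hU
    omega

lemma exists_base (G : SimpleGraph V) (K d : ℕ) (hd : 0 < d) (hK : 4 * d + 4 ≤ K)
    (h : Critical G K) :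
    ∃ (G0 C : SimpleGraph V) (side : V → Bool) (U : Finset V), G0 ≤ G ∧ C ≤ G ∧
      (∀ u v, G0.Adj u v → ¬ C.Adj u v) ∧ CutOK C ∧ (∀ u v, G0.Adj u v → side u ≠ side v) ∧
      (∀ u v, G0.Adj u v → u ∈ U) ∧ U.Nonempty ∧ (∀ u ∈ U, d ≤ #(nb G0 u)) := by
  have hne : Nonempty V := by
    by_contra hcon
    rw [not_nonempty_iff] at hcon
    exact h.1 ⟨fun v => hcon.elim v, fun v => hcon.elim v⟩
  obtain ⟨C, hC, hCut, hsum⟩ := exists_certificate G (fun Q hQ hQ' e0 => h.cut (by omega) Q hQ hQ' e0)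
  obtain ⟨side, hside⟩ := exists_side (G \ C)
  let X : SimpleGraph V :=
    { Adj := fun u v => (G \ C).Adj u v ∧ side u ≠ side v
      symm := ⟨fun u v h => ⟨h.1.symm, h.2.symm⟩⟩
      loopless := ⟨fun u h => h.2 rfl⟩ }
  have hX : ∀ u, #(nb X u) = #((nb (G \ C) u).filter (fun v => side u ≠ side v)) := by
    intro u
    congr 1
    ext v
    simp [X]
  have h1 : ∀ u, K ≤ #(nb (G \ C) u) + #(nb C u) := by
    intro u
    refine (h.degree u).trans (le_trans (card_le_card ?_) (card_union_le _ _))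
    intro v hv
    simp only [mem_union, mem_nb, sdiff_adj] at hv ⊢
    tauto
  have h2 := sum_le_sum (fun u (_ : u ∈ (univ : Finset V)) => h1 u)
  rw [sum_add_distrib, sum_const, card_univ, smul_eq_mul] at h2
  have h3 : 2 * d * Fintype.card V ≤ ∑ u, #(nb X u) := by
    simp_rw [hX]
    have : Fintype.card V * (4 * d + 4) ≤ Fintype.card V * K := Nat.mul_le_mul_left _ hK
    nlinarith
  obtain ⟨U, hU, hUd⟩ := exists_core X d hd h3
  let G0 : SimpleGraph V :=
    { Adj := fun u v => X.Adj u v ∧ u ∈ U ∧ v ∈ U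
      symm := ⟨fun u v h => ⟨h.1.symm, h.2.2, h.2.1⟩⟩
      loopless := ⟨fun u h => X.loopless.irrefl u h.1⟩ }
  refine ⟨G0, C, side, U, ?_, hC, ?_, hCut, ?_, ?_, hU, ?_⟩
  · intro u v huv
    exact huv.1.1.1
  · intro u v huv
    exact huv.1.1.2
  · intro u v huv
    exact huv.1.2
  · intro u v huv
    exact huv.2.1
  · intro u hu
    refine (hUd u hu).trans (card_le_card ?_)
    intro v hv
    simp only [mem_filter, mem_nb] at hv ⊢
    exact ⟨hv.1, hu, hv.2⟩

end
end PPI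

namespace PPI
set_option linter.unusedSectionVars false
section
open Finset
open scoped Classical

variable {V : Type*} [Fintype V]

inductive Der (G0 : SimpleGraph V) (d : ℕ) : SimpleGraph V → Finset V → Prop
  | base : Der G0 d G0 univ
  | del {H H' : SimpleGraph V} {U : Finset V} : Der G0 d H U → H' ≤ H → Der G0 d H' U
  | mark {H : SimpleGraph V} {U : Finset V} (x : V) : Der G0 d H U → #(nb H x) ≤ d →
      Der G0 d H (U.erase x)
  | split {H H' : SimpleGraph V} {U : Finset V} (x a b : V) : Der G0 d H U → x ∉ U →
      H.Adj x a → H.Adj x b → a ≠ b →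
      (∀ u v, H'.Adj u v → (H.Adj u v ∧ s(u, v) ≠ s(x, a) ∧ s(u, v) ≠ s(x, b)) ∨
        s(u, v) = s(a, b)) → Der G0 d H' U

noncomputable def TT (H : SimpleGraph V) (τ : Sym2 V → Finset (Sym2 V)) : Finset (Sym2 V) :=
  (univ.filter (fun e => e ∈ H.edgeSet)).biUnion τ

structure Valid (G0 : SimpleGraph V) (d : ℕ) (H : SimpleGraph V) (U : Finset V)
    (τ : Sym2 V → Finset (Sym2 V)) : Prop where
  walk : ∀ u v, H.Adj u v → ∃ p : G0.Walk u v, p.IsTrail ∧ ∀ e ∈ p.edges, e ∈ τ s(u, v)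
  disj : ∀ e ∈ H.edgeSet, ∀ e' ∈ H.edgeSet, e ≠ e' → Disjoint (τ e) (τ e')
  clean : ∀ u ∈ U, ∀ e ∈ H.edgeSet, #((τ e).filter (fun f => u ∈ f)) ≤ if u ∈ e then 1 else 0
  dirty : ∀ z, z ∉ U → #((TT H τ).filter (fun f => z ∈ f)) ≤ d
  sub : ∀ e ∈ H.edgeSet, ∀ f ∈ τ e, f ∈ G0.edgeSet

lemma card_edges_at (H : SimpleGraph V) (x : V) :
    #(univ.filter (fun e => e ∈ H.edgeSet ∧ x ∈ e)) = #(nb H x) := by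
  symm
  refine card_bij (fun v _ => s(x, v)) ?_ ?_ ?_
  · intro v hv
    simpa using hv
  · intro v _ w _ h
    exact Sym2.congr_right.1 h
  · intro e he
    simp only [mem_filter, mem_univ, true_and] at he
    obtain ⟨he, hx⟩ := he
    induction e with | _ a b
    simp only [Sym2.mem_iff] at hx
    rcases hx with rfl | rfl
    · exact ⟨b, by simpa using he, rfl⟩
    · exact ⟨a, by simpa using he.symm, Sym2.eq_swap⟩

lemma Der.valid {G0 : SimpleGraph V} {d : ℕ} {H : SimpleGraph V} {U : Finset V}
    (h : Der G0 d H U) : ∃ τ, Valid G0 d H U τ := by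
  induction h with
  | base =>
    refine ⟨fun e => {e}, ⟨?_, ?_, ?_, ?_, ?_⟩⟩
    · intro u v huv
      refine ⟨Walk.cons huv Walk.nil, by simp, by simp⟩
    · intro e _ e' _ h
      simpa using h
    · intro u _ e _
      by_cases hu : u ∈ e
      · simp [hu, filter_singleton]
      · simp [hu, filter_singleton]
    · simp
    · intro e he f hf
      simp at hf
      rwa [hf]
  | @del H H' U _ hle ih =>
    obtain ⟨τ, hτ⟩ := ih
    have hs : H'.edgeSet ⊆ H.edgeSet := edgeSet_mono hle
    refine ⟨τ, ⟨?_, ?_, ?_, ?_, ?_⟩⟩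
    · exact fun u v huv => hτ.walk u v (hle huv)
    · exact fun e he e' he' => hτ.disj e (hs he) e' (hs he')
    · exact fun u hu e he => hτ.clean u hu e (hs he)
    · intro z hz
      refine le_trans (card_le_card ?_) (hτ.dirty z hz)
      apply filter_subset_filter
      apply biUnion_subset_biUnion_of_subset_left
      intro e he
      simp only [mem_filter, mem_univ, true_and] at he ⊢
      exact hs he
    · exact fun e he => hτ.sub e (hs he)
  | @mark H U x _ hdeg ih =>
    obtain ⟨τ, hτ⟩ := ih
    refine ⟨τ, ⟨hτ.walk, hτ.disj, ?_, ?_, hτ.sub⟩⟩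
    · exact fun u hu e he => hτ.clean u (mem_of_mem_erase hu) e he
    · intro z hz
      by_cases hzU : z ∈ U
      · have hzx : z = x := by
          by_contra hne
          exact hz (mem_erase.2 ⟨hne, hzU⟩)
        subst hzx
        rw [TT, filter_biUnion]
        refine le_trans card_biUnion_le ?_
        have : ∑ e ∈ univ.filter (fun e => e ∈ H.edgeSet), #((τ e).filter (fun f => z ∈ f)) ≤
            ∑ e ∈ univ.filter (fun e => e ∈ H.edgeSet), if z ∈ e then 1 else 0 := by
          refine sum_le_sum fun e he => hτ.clean z hzU e (by simpa using he)
        refine this.trans ?_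
        rw [← card_filter, filter_filter, card_edges_at]
        exact hdeg
      · exact hτ.dirty z hzU
  | @split H H' U x a b _ hxU hxa hxb hab hH' ih =>
    obtain ⟨τ, hτ⟩ := ih
    have hset : ∀ e ∈ H'.edgeSet, e ≠ s(a, b) → e ∈ H.edgeSet ∧ e ≠ s(x, a) ∧ e ≠ s(x, b) := by
      intro e he hne
      induction e with | _ u v
      have := hH' u v he
      simp only [mem_edgeSet]
      tauto
    have hne : s(x, a) ≠ s(x, b) := fun h => hab (Sym2.congr_right.1 h)
    have hd1 : Disjoint (τ s(x, a)) (τ s(x, b)) := hτ.disj _ hxa _ hxb hne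
    let τ' : Sym2 V → Finset (Sym2 V) := Function.update τ s(a, b) (τ s(x, a) ∪ τ s(x, b))
    have hτ1 : τ' s(a, b) = τ s(x, a) ∪ τ s(x, b) := Function.update_self ..
    have hτ2 : ∀ e, e ≠ s(a, b) → τ' e = τ e := fun e he => Function.update_of_ne he ..
    have hwalk : ∃ p : G0.Walk a b, p.IsTrail ∧ ∀ e ∈ p.edges, e ∈ τ' s(a, b) := by
      obtain ⟨p, hp, hpe⟩ := hτ.walk x a hxa
      obtain ⟨q, hq, hqe⟩ := hτ.walk x b hxb
      refine ⟨p.reverse.append q, ?_, ?_⟩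
      · rw [Walk.isTrail_def, Walk.edges_append, List.nodup_append]
        refine ⟨?_, hq.edges_nodup, ?_⟩
        · rw [Walk.edges_reverse, List.nodup_reverse]; exact hp.edges_nodup
        · rintro e he f hf rfl
          rw [Walk.edges_reverse, List.mem_reverse] at he
          exact Finset.disjoint_left.1 hd1 (hpe e he) (hqe e hf)
      · intro e he
        rw [Walk.edges_append, List.mem_append, Walk.edges_reverse, List.mem_reverse] at he
        rw [hτ1, mem_union]
        rcases he with he | he
        · exact Or.inl (hpe e he)
        · exact Or.inr (hqe e he)
    refine ⟨τ', ⟨?_, ?_, ?_, ?_, ?_⟩⟩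
    · intro u v huv
      by_cases he : s(u, v) = s(a, b)
      · rw [Sym2.eq_iff] at he
        rcases he with ⟨rfl, rfl⟩ | ⟨rfl, rfl⟩
        · exact hwalk
        · obtain ⟨p, hp, hpe⟩ := hwalk
          refine ⟨p.reverse, hp.reverse, ?_⟩
          intro e he
          rw [Walk.edges_reverse, List.mem_reverse] at he
          rw [Sym2.eq_swap]
          exact hpe e he
      · obtain ⟨h1, -⟩ := hset _ huv he
        rw [hτ2 _ he]
        exact hτ.walk u v h1
    · have key : ∀ e ∈ H'.edgeSet, e ≠ s(a, b) → Disjoint (τ' s(a, b)) (τ' e) := by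
        intro e he hne
        obtain ⟨h1, h2, h3⟩ := hset e he hne
        rw [hτ1, hτ2 e hne, disjoint_union_left]
        exact ⟨hτ.disj _ hxa _ h1 h2.symm, hτ.disj _ hxb _ h1 h3.symm⟩
      intro e he e' he' hee
      by_cases h1 : e = s(a, b)
      · subst h1
        exact key e' he' hee.symm
      · by_cases h2 : e' = s(a, b)
        · subst h2
          exact (key e he h1).symm
        · rw [hτ2 e h1, hτ2 e' h2]
          exact hτ.disj e (hset e he h1).1 e' (hset e' he' h2).1 hee
    · intro u hu e he
      by_cases h1 : e = s(a, b)
      · subst h1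
        rw [hτ1, filter_union]
        refine (card_union_le _ _).trans ?_
        have h2 := hτ.clean u hu s(x, a) hxa
        have h3 := hτ.clean u hu s(x, b) hxb
        have hux : u ≠ x := by rintro rfl; exact hxU hu
        simp only [Sym2.mem_iff, hux, false_or] at h2 h3 ⊢
        by_cases hua : u = a
        · have hub : u ≠ b := by rintro rfl; exact hab hua.symm
          simp only [hua, hab, if_true, if_false, true_or] at h2 h3 ⊢
          omega
        · simp only [hua, if_false, false_or] at h2 h3 ⊢
          omega
      · rw [hτ2 e h1]
        exact hτ.clean u hu e (hset e he h1).1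
    · intro z hz
      refine le_trans (card_le_card ?_) (hτ.dirty z hz)
      apply filter_subset_filter
      intro f hf
      simp only [TT, mem_biUnion, mem_filter, mem_univ, true_and] at hf ⊢
      obtain ⟨e, he, hfe⟩ := hf
      by_cases h1 : e = s(a, b)
      · subst h1
        rw [hτ1, mem_union] at hfe
        rcases hfe with hfe | hfe
        · exact ⟨_, hxa, hfe⟩
        · exact ⟨_, hxb, hfe⟩
      · rw [hτ2 e h1] at hfe
        exact ⟨e, (hset e he h1).1, hfe⟩
    · intro e he f hf
      by_cases h1 : e = s(a, b)
      · subst h1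
        rw [hτ1, mem_union] at hf
        rcases hf with hf | hf
        · exact hτ.sub _ hxa f hf
        · exact hτ.sub _ hxb f hf
      · rw [hτ2 e h1] at hf
        exact hτ.sub e (hset e he h1).1 f hf

def msG (H : SimpleGraph V) (x : V) (R : Finset V) (f : V → V) : SimpleGraph V :=
  SimpleGraph.fromRel (fun u v => (H.Adj u v ∧ ¬ (u = x ∧ v ∈ R) ∧ ¬ (v = x ∧ u ∈ R)) ∨
    (u ∈ R ∧ v = f u))

lemma msG_adj {H : SimpleGraph V} {x : V} {R : Finset V} {f : V → V}
    (hf : ∀ w ∈ R, f w ∈ R ∧ f (f w) = w ∧ f w ≠ w) {u v : V} :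
    (msG H x R f).Adj u v ↔ (H.Adj u v ∧ ¬ (u = x ∧ v ∈ R) ∧ ¬ (v = x ∧ u ∈ R)) ∨
      (u ∈ R ∧ v = f u) := by
  simp only [msG, fromRel_adj]
  constructor
  · rintro ⟨hne, h | ⟨h1, h2, h3⟩ | ⟨h1, rfl⟩⟩
    · exact h
    · exact Or.inl ⟨h1.symm, h3, h2⟩
    · exact Or.inr ⟨(hf v h1).1, (hf v h1).2.1.symm⟩
  · intro h
    refine ⟨?_, Or.inl h⟩
    rcases h with h | ⟨h, rfl⟩
    · exact h.1.ne
    · exact (hf u h).2.2.symm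

lemma Der.multisplit {G0 : SimpleGraph V} {d : ℕ} {H : SimpleGraph V} {U : Finset V}
    (h : Der G0 d H U) (x : V) (hx : x ∉ U) (f : V → V) (n : ℕ) :
    ∀ R : Finset V, #R = n → R ⊆ nb H x → (∀ w ∈ R, f w ∈ R ∧ f (f w) = w ∧ f w ≠ w) →
    Der G0 d (msG H x R f) U := by
  induction n using Nat.strong_induction_on with
  | _ n ih =>
    intro R hRn hR hf
    by_cases hne : R.Nonempty
    · obtain ⟨w, hw⟩ := hne
      have hw' := hf w hw
      set R' := (R.erase w).erase (f w) with hR'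
      have hlt : #R' < n := by
        rw [← hRn]
        exact lt_of_le_of_lt (card_le_card (erase_subset _ _)) (card_erase_lt_of_mem hw)
      have hf' : ∀ u ∈ R', f u ∈ R' ∧ f (f u) = u ∧ f u ≠ u := by
        intro u hu
        simp only [hR', mem_erase] at hu ⊢
        obtain ⟨h1, h2, h3⟩ := hf u hu.2.2
        refine ⟨⟨?_, ?_, h1⟩, h2, h3⟩
        · intro h4
          apply hu.2.1
          rw [← h2, h4, hw'.2.1]
        · intro h4
          apply hu.1
          rw [← h4, h2]
      have hxR : x ∉ R := fun h' => by
        have := hR h'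
        simp at this
      have hD := ih _ hlt R' rfl (fun u hu => hR (by simp [hR'] at hu; tauto)) hf'
      have hxw : H.Adj x w := by simpa using hR hw
      have hxw' : H.Adj x (f w) := by simpa using hR hw'.1
      have hnx : w ≠ x := hxw.ne'
      have hnx' : f w ≠ x := hxw'.ne'
      refine Der.split x w (f w) hD hx ?_ ?_ hw'.2.2.symm ?_
      · rw [msG_adj hf']
        left
        refine ⟨hxw, by simp [hR'], ?_⟩
        rintro ⟨h1, -⟩
        exact hnx h1
      · rw [msG_adj hf']
        left
        refine ⟨hxw', by simp [hR'], ?_⟩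
        rintro ⟨h1, -⟩
        exact hnx' h1
      · intro u v huv
        rw [msG_adj hf] at huv
        have hsub : R' ⊆ R := fun u hu => by simp [hR'] at hu; tauto
        rcases huv with ⟨h1, h2, h3⟩ | ⟨h1, rfl⟩
        · left
          rw [msG_adj hf']
          refine ⟨Or.inl ⟨h1, fun h4 => h2 ⟨h4.1, hsub h4.2⟩, fun h4 => h3 ⟨h4.1, hsub h4.2⟩⟩, ?_, ?_⟩
          · intro h4
            rw [Sym2.eq_iff] at h4
            rcases h4 with ⟨rfl, rfl⟩ | ⟨rfl, rfl⟩ <;> tauto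
          · intro h4
            rw [Sym2.eq_iff] at h4
            rcases h4 with ⟨rfl, rfl⟩ | ⟨rfl, rfl⟩ <;> tauto
        · by_cases h4 : u ∈ R'
          · left
            rw [msG_adj hf']
            refine ⟨Or.inr ⟨h4, rfl⟩, ?_, ?_⟩
            · intro h5
              rw [Sym2.eq_iff] at h5
              have := (hf u h1).1
              rcases h5 with ⟨h5, h6⟩ | ⟨h5, h6⟩
              · exact hxR (h5 ▸ h1)
              · exact hxR (h6 ▸ this)
            · intro h5
              rw [Sym2.eq_iff] at h5
              have := (hf u h1).1
              rcases h5 with ⟨h5, h6⟩ | ⟨h5, h6⟩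
              · exact hxR (h5 ▸ h1)
              · exact hxR (h6 ▸ this)
          · right
            have : u = w ∨ u = f w := by
              by_contra hcon
              push Not at hcon
              exact h4 (by simp [hR']; tauto)
            rcases this with rfl | rfl
            · rfl
            · rw [hw'.2.1, Sym2.eq_swap]
    · rw [not_nonempty_iff_eq_empty] at hne
      subst hne
      refine Der.del h ?_
      intro u v huv
      rw [msG_adj (by simp)] at huv
      simpa using huv

end
end PPI

namespace PPI
set_option linter.unusedSectionVars false
section
open Finset
open scoped Classical

variable {V : Type*} [Fintype V]

def Dense (q d : ℕ) (H : SimpleGraph V) : Prop :=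
  ∃ S M : Finset V, Disjoint S M ∧ #S = q ∧ #M ≤ d ∧
    ∀ s ∈ S, ∀ s' ∈ S, s ≠ s' → q ≤ #(M.filter (fun m => H.Adj s m ∧ H.Adj s' m))

noncomputable def nn (H : SimpleGraph V) (A : Finset V) (w : V) : Finset V :=
  A.filter (fun a => a ≠ w ∧ ¬ H.Adj w a)

lemma mem_nn {H : SimpleGraph V} {A : Finset V} {w a : V} :
    a ∈ nn H A w ↔ a ∈ A ∧ a ≠ w ∧ ¬ H.Adj w a := by simp [nn]

lemma dense_of_miss {q d : ℕ} {H : SimpleGraph V} (S0 M : Finset V) (m0 : ℕ)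
    (hS : q ≤ #S0) (hM : #M ≤ d) (hmiss : ∀ s ∈ S0, #(nn H M s) ≤ m0)
    (hbig : 2 * m0 + 2 * q ≤ #M) : Dense q d H := by
  obtain ⟨S, hSS, hSc⟩ := exists_subset_card_eq hS
  refine ⟨S, M \ S, disjoint_sdiff, hSc, (card_le_card sdiff_subset).trans hM, ?_⟩
  intro s hs s' hs' _
  have h1 := hmiss s (hSS hs)
  have h2 := hmiss s' (hSS hs')
  have h3 : M ⊆ (M \ S).filter (fun m => H.Adj s m ∧ H.Adj s' m) ∪ (nn H M s ∪ (nn H M s' ∪ S)) := by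
    intro m hm
    simp only [mem_union, mem_filter, mem_sdiff, mem_nn]
    by_cases hmS : m ∈ S
    · tauto
    · have e1 : m ≠ s := by rintro rfl; exact hmS hs
      have e2 : m ≠ s' := by rintro rfl; exact hmS hs'
      tauto
  have h4 := (card_le_card h3).trans (card_union_le _ _)
  have h5 := card_union_le (nn H M s) (nn H M s' ∪ S)
  have h6 := card_union_le (nn H M s') S
  omega

lemma hall_deficiency (T A : Finset V) (r : V → V → Prop) :
    ∃ Y ⊆ T, ∃ f : V → V, Set.InjOn f (T \ Y : Finset V) ∧
      (∀ w ∈ T, w ∉ Y → f w ∈ A ∧ r w (f w) ∧ ∀ y ∈ Y, ¬ r y (f w)) ∧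
      #(A.filter (fun a => ∃ y ∈ Y, r y a)) ≤ #Y := by
  let N : Finset V → Finset V := fun Y => A.filter (fun a => ∃ y ∈ Y, r y a)
  have hNle : ∀ Y, #(N Y) ≤ #A := fun Y => card_le_card (filter_subset _ _)
  obtain ⟨Y, hYT, hYmax⟩ := exists_max_image T.powerset (fun Y => #Y + #A - #(N Y)) ⟨∅, by simp⟩
  rw [mem_powerset] at hYT
  have hmax : ∀ Y' ⊆ T, #Y' + #(N Y) ≤ #Y + #(N Y') := by
    intro Y' hY'
    have := hYmax Y' (mem_powerset.2 hY')
    have h1 := hNle Y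
    have h2 := hNle Y'
    omega
  have hall := (Finset.all_card_le_biUnion_card_iff_exists_injective
    (fun w : {w // w ∈ T \ Y} => A.filter (fun a => r w a ∧ ∀ y ∈ Y, ¬ r y a))).1 (by
      intro s
      have h1 := hmax (Y ∪ s.map ⟨Subtype.val, Subtype.val_injective⟩) (by
        apply union_subset hYT
        intro w hw
        simp only [mem_map, Function.Embedding.coeFn_mk] at hw
        obtain ⟨w', _, rfl⟩ := hw
        exact (mem_sdiff.1 w'.2).1)
      rw [card_union_of_disjoint, card_map] at h1
      · have h2 : N (Y ∪ s.map ⟨Subtype.val, Subtype.val_injective⟩) ⊆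
            N Y ∪ s.biUnion (fun w : {w // w ∈ T \ Y} => A.filter (fun a => r w a ∧ ∀ y ∈ Y, ¬ r y a)) := by
          intro a ha
          simp only [N, mem_filter, mem_union, mem_map, Function.Embedding.coeFn_mk, mem_biUnion] at ha ⊢
          obtain ⟨haA, y, hy, hr⟩ := ha
          by_cases hex : ∃ y ∈ Y, r y a
          · exact Or.inl ⟨haA, hex⟩
          · push Not at hex
            rcases hy with hy | ⟨w, hw, rfl⟩
            · exact absurd hr (hex y hy)
            · exact Or.inr ⟨w, hw, haA, hr, hex⟩
        have h3 := (card_le_card h2).trans (card_union_le _ _)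
        omega
      · rw [Finset.disjoint_left]
        intro w hw hw'
        simp only [mem_map, Function.Embedding.coeFn_mk] at hw'
        obtain ⟨w', _, rfl⟩ := hw'
        exact (mem_sdiff.1 w'.2).2 hw)
  obtain ⟨g, hginj, hg⟩ := hall
  refine ⟨Y, hYT, fun w => if h : w ∈ T \ Y then g ⟨w, h⟩ else w, ?_, ?_, ?_⟩
  · intro a ha b hb hab
    simp only [mem_coe] at ha hb
    simp only [ha, hb, dif_pos] at hab
    have := hginj hab
    simpa using this
  · intro w hw hwY
    have hw' : w ∈ T \ Y := mem_sdiff.2 ⟨hw, hwY⟩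
    simp only [hw', dif_pos]
    have := hg ⟨w, hw'⟩
    simpa using this
  · have := hmax ∅ (by simp)
    simp [N] at this
    simpa [N] using this

def NM (H : SimpleGraph V) (P : Finset V) (f : V → V) : Prop :=
  ∀ w ∈ P, f w ∈ P ∧ f (f w) = w ∧ f w ≠ w ∧ ¬ H.Adj w (f w)

lemma NM.add_pair {H : SimpleGraph V} {P : Finset V} {f : V → V} (h : NM H P f) {u w : V}
    (hu : u ∉ P) (hw : w ∉ P) (hne : w ≠ u) (hadj : ¬ H.Adj u w) :
    ∃ g, NM H (insert u (insert w P)) g := by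
  refine ⟨fun x => if x = u then w else if x = w then u else f x, ?_⟩
  intro x hx
  have hadj' : ¬ H.Adj w u := fun h => hadj h.symm
  by_cases h1 : x = u
  · subst h1; simp [hne, hadj]
  by_cases h2 : x = w
  · subst h2; simp [hne, hadj', hne.symm]
  have hxP : x ∈ P := by simpa [h1, h2] using hx
  obtain ⟨e1, e2, e3, e4⟩ := h x hxP
  have h3 : f x ≠ u := by rintro h; exact hu (h ▸ e1)
  have h4 : f x ≠ w := by rintro h; exact hw (h ▸ e1)
  simp [h1, h2, h3, h4, e1, e2, e3, e4]

lemma NM.augment {H : SimpleGraph V} {P : Finset V} {f : V → V} (h : NM H P f) {u u' a b : V}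
    (hu : u ∉ P) (hu' : u' ∉ P) (hne : u ≠ u') (ha : a ∈ P) (hb : b ∈ P)
    (hua : ¬ H.Adj u a) (hub : ¬ H.Adj u' b) (hab : f a ≠ f b) (hab' : f b ≠ a)
    (hadj : ¬ H.Adj (f a) (f b)) :
    ∃ g, NM H (insert u (insert u' P)) g := by
  obtain ⟨a1, a2, a3, a4⟩ := h a ha
  obtain ⟨b1, b2, b3, b4⟩ := h b hb
  have n1 : a ≠ b := fun h => hab (by rw [h])
  have n2 : f a ≠ b := fun h => hab' (by rw [← h, a2])
  have m1 : u ≠ a := by rintro rfl; exact hu ha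
  have m2 : u ≠ b := by rintro rfl; exact hu hb
  have m3 : u ≠ f a := by rintro h; exact hu (h ▸ a1)
  have m4 : u ≠ f b := by rintro h; exact hu (h ▸ b1)
  have m1' : u' ≠ a := by rintro rfl; exact hu' ha
  have m2' : u' ≠ b := by rintro rfl; exact hu' hb
  have m3' : u' ≠ f a := by rintro h; exact hu' (h ▸ a1)
  have m4' : u' ≠ f b := by rintro h; exact hu' (h ▸ b1)
  refine ⟨fun x => if x = u then a else if x = a then u else if x = f a then f b else
    if x = f b then f a else if x = b then u' else if x = u' then b else f x, ?_⟩
  have hua' : ¬ H.Adj a u := fun h => hua h.symm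
  have hub' : ¬ H.Adj b u' := fun h => hub h.symm
  have hadj' : ¬ H.Adj (f b) (f a) := fun h => hadj h.symm
  intro x hx
  by_cases h1 : x = u
  · subst h1; simp [ha, m1.symm, hua]
  by_cases h2 : x = a
  · subst h2; simp [m1, m1.symm, hua']
  by_cases h3 : x = f a
  · subst h3; simp [m3.symm, a3, b1, m4.symm, hab', hab.symm, hadj]
  by_cases h4 : x = f b
  · subst h4; simp [m4.symm, hab', hab.symm, a1, m3.symm, a3, hadj', hab]
  by_cases h5 : x = b
  · subst h5; simp [m2.symm, n1.symm, n2.symm, b3.symm, m1', m2', m3', m4', hne.symm, hub']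
  by_cases h6 : x = u'
  · subst h6; simp [hne.symm, m1', m3', m4', m2', hb, m2.symm, n1.symm, n2.symm, b3.symm, m2'.symm, hub]
  have hxP : x ∈ P := by simpa [h1, h6] using hx
  obtain ⟨e1, e2, e3, e4⟩ := h x hxP
  have k1 : f x ≠ u := by rintro h; exact hu (h ▸ e1)
  have k2 : f x ≠ u' := by rintro h; exact hu' (h ▸ e1)
  have k3 : f x ≠ a := by rintro h; rw [h] at e2; exact h3 e2.symm
  have k4 : f x ≠ b := by rintro h; rw [h] at e2; exact h4 e2.symm
  have k5 : f x ≠ f a := by rintro h; rw [h, a2] at e2; exact h2 e2.symm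
  have k6 : f x ≠ f b := by rintro h; rw [h, b2] at e2; exact h5 e2.symm
  simp [h1, h2, h3, h4, h5, h6, k1, k2, k3, k4, k5, k6, e1, e2, e3, e4]

lemma exists_nonedge_matching {q d : ℕ} (hq : 2 ≤ q) (hd : 3 * q ≤ d) (H : SimpleGraph V)
    (hnd : ¬ Dense q d H) (R : Finset V) (hR : Even #R) (hnn : ∀ w ∈ R, 3 * q ≤ #(nn H R w)) :
    ∃ f, NM H R f := by
  let F : Finset (Finset V) := R.powerset.filter (fun P => Even #P ∧ ∃ f, NM H P f)
  obtain ⟨P, hPF, hPmax⟩ := exists_max_image F card ⟨∅, by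
    simp only [F, mem_filter, mem_powerset]
    exact ⟨by simp, by simp, id, by simp [NM]⟩⟩
  simp only [F, mem_filter, mem_powerset] at hPF hPmax
  obtain ⟨hPR, hPe, f, hf⟩ := hPF
  by_cases hPR' : P = R
  · exact ⟨f, hPR' ▸ hf⟩
  exfalso
  have hlt : #P < #R := card_lt_card (Finset.ssubset_iff_subset_ne.2 ⟨hPR, hPR'⟩)
  have hc : #(R \ P) = #R - #P := card_sdiff_of_subset hPR
  have h2 : 1 < #(R \ P) := by
    obtain ⟨r, hr⟩ := hR
    obtain ⟨p, hp⟩ := hPe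
    omega
  obtain ⟨u, hu, u', hu', hne⟩ := one_lt_card.1 h2
  rw [mem_sdiff] at hu hu'
  have hcontr : ∀ w w' : V, w ∈ R → w ∉ P → w' ∈ R → w' ∉ P → w ≠ w' →
      (∃ g, NM H (insert w (insert w' P)) g) → False := by
    intro w w' hw hwP hw' hwP' hww hg
    have hcard : #(insert w (insert w' P)) = #P + 2 := by
      rw [card_insert_of_notMem, card_insert_of_notMem hwP']
      simp [hww, hwP]
    have := hPmax (insert w (insert w' P)) ⟨by
      intro z hz
      simp only [mem_insert] at hz
      rcases hz with rfl | rfl | hz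
      · exact hw
      · exact hw'
      · exact hPR hz, by rw [hcard]; exact hPe.add (by decide), hg⟩
    omega
  have hin : ∀ w, w ∈ R → w ∉ P → nn H R w ⊆ P := by
    intro w hw hwP z hz
    rw [mem_nn] at hz
    by_contra hzP
    exact hcontr w z hw hwP hz.1 hzP hz.2.1.symm (hf.add_pair hwP hzP hz.2.1 hz.2.2)
  have hinj : Set.InjOn f (P : Set V) := by
    intro a ha b hb hab
    rw [← (hf a ha).2.1, ← (hf b hb).2.1, hab]
  apply hnd
  obtain ⟨M0, hM0, hM0c⟩ := exists_subset_card_eq (hnn u' hu'.1)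
  have hM0P : M0 ⊆ P := hM0.trans (hin u' hu'.1 hu'.2)
  have hMc : #(M0.image f) = #M0 := card_image_of_injOn (hinj.mono (by exact_mod_cast hM0P))
  refine dense_of_miss ((nn H R u).image f) (M0.image f) 1 ?_ (by omega) ?_ (by omega)
  · rw [card_image_of_injOn (hinj.mono (by exact_mod_cast (hin u hu.1 hu.2)))]
    have := hnn u hu.1
    omega
  · intro s hs
    rw [mem_image] at hs
    obtain ⟨a, ha, rfl⟩ := hs
    have : nn H (M0.image f) (f a) ⊆ {a} := by
      intro z hz
      rw [mem_nn, mem_image] at hz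
      obtain ⟨⟨b, hb, rfl⟩, hz1, hz2⟩ := hz
      rw [mem_singleton]
      by_contra hcon
      exact hcontr u u' hu.1 hu.2 hu'.1 hu'.2 hne (hf.augment hu.2 hu'.2 hne (hin u hu.1 hu.2 ha)
        (hM0P hb) (mem_nn.1 ha).2.2 (mem_nn.1 (hM0 hb)).2.2 hz1.symm hcon hz2)
    simpa using card_le_card this

end
end PPI

namespace PPI
set_option linter.unusedSectionVars false
section
open Finset
open scoped Classical

variable {V : Type*} [Fintype V]

def msD (H : SimpleGraph V) (x : V) (D R : Finset V) (f : V → V) : SimpleGraph V :=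
  SimpleGraph.fromRel (fun u v => (H.Adj u v ∧ ¬ (u = x ∧ v ∈ D) ∧ ¬ (v = x ∧ u ∈ D)) ∨
    (u ∈ R ∧ v = f u))

lemma msD_adj {H : SimpleGraph V} {x : V} {D R : Finset V} {f : V → V}
    (hf : NM H R f) {u v : V} :
    (msD H x D R f).Adj u v ↔ (H.Adj u v ∧ ¬ (u = x ∧ v ∈ D) ∧ ¬ (v = x ∧ u ∈ D)) ∨
      (u ∈ R ∧ v = f u) := by
  simp only [msD, fromRel_adj]
  constructor
  · rintro ⟨hne, h | ⟨h1, h2, h3⟩ | ⟨h1, rfl⟩⟩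
    · exact h
    · exact Or.inl ⟨h1.symm, h3, h2⟩
    · exact Or.inr ⟨(hf v h1).1, (hf v h1).2.1.symm⟩
  · intro h
    refine ⟨?_, Or.inl h⟩
    rcases h with h | ⟨h, rfl⟩
    · exact h.1.ne
    · exact (hf u h).2.2.1.symm

lemma Der.msD {G0 : SimpleGraph V} {d : ℕ} {H : SimpleGraph V} {U : Finset V}
    (h : Der G0 d H U) {x : V} (hx : x ∉ U) {f : V → V} {D R : Finset V}
    (hRx : R ⊆ nb H x) (hRD : R ⊆ D) (hf : NM H R f) : Der G0 d (PPI.msD H x D R f) U := by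
  have hf' : ∀ w ∈ R, f w ∈ R ∧ f (f w) = w ∧ f w ≠ w := fun w hw =>
    ⟨(hf w hw).1, (hf w hw).2.1, (hf w hw).2.2.1⟩
  refine Der.del (h.multisplit x hx f _ R rfl hRx hf') ?_
  intro u v huv
  rw [msD_adj hf] at huv
  rw [msG_adj hf']
  rcases huv with ⟨h1, h2, h3⟩ | h1
  · exact Or.inl ⟨h1, fun h4 => h2 ⟨h4.1, hRD h4.2⟩, fun h4 => h3 ⟨h4.1, hRD h4.2⟩⟩
  · exact Or.inr h1

lemma msD_deg_R {H : SimpleGraph V} {x : V} {D R : Finset V} {f : V → V}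
    (hRx : R ⊆ nb H x) (hf : NM H R f) {u : V} (hu : u ∈ R) :
    #(nb H u) ≤ #(nb (msD H x D R f) u) := by
  have hxu : H.Adj x u := by simpa using hRx hu
  have h1 : (nb H u).erase x ⊆ (nb (msD H x D R f) u).erase (f u) := by
    intro w hw
    simp only [mem_erase, mem_nb, msD_adj hf] at hw ⊢
    refine ⟨?_, Or.inl ⟨hw.2, ?_, ?_⟩⟩
    · rintro rfl; exact (hf u hu).2.2.2 hw.2
    · rintro ⟨rfl, -⟩; exact hxu.ne rfl
    · rintro ⟨rfl, -⟩; exact hw.1 rfl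
  have h2 := card_le_card h1
  rw [card_erase_of_mem (by simpa using hxu.symm), card_erase_of_mem (by
    rw [mem_nb, msD_adj hf]; exact Or.inr ⟨hu, rfl⟩)] at h2
  have : 0 < #(nb (msD H x D R f) u) := card_pos.2 ⟨f u, by
    rw [mem_nb, msD_adj hf]; exact Or.inr ⟨hu, rfl⟩⟩
  omega

lemma msD_deg_D {H : SimpleGraph V} {x : V} {D R : Finset V} {f : V → V}
    (hf : NM H R f) {u : V} (hu : u ≠ x) :
    #(nb H u) ≤ #(nb (msD H x D R f) u) + 1 := by
  have h1 : nb H u ⊆ insert x (nb (msD H x D R f) u) := by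
    intro w hw
    simp only [mem_insert, mem_nb, msD_adj hf] at hw ⊢
    by_cases hwx : w = x
    · exact Or.inl hwx
    · exact Or.inr (Or.inl ⟨hw, fun h => hu h.1, fun h => hwx h.1⟩)
  exact (card_le_card h1).trans (card_insert_le _ _)

lemma msD_deg_out {H : SimpleGraph V} {x : V} {D R : Finset V} {f : V → V}
    (hf : NM H R f) {u : V} (hu : u ≠ x) (huD : u ∉ D) :
    #(nb H u) ≤ #(nb (msD H x D R f) u) := by
  apply card_le_card
  intro w hw
  simp only [mem_nb, msD_adj hf] at hw ⊢
  exact Or.inl ⟨hw, fun h => hu h.1, fun h => huD h.2⟩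

lemma Der.marks {G0 : SimpleGraph V} {d : ℕ} {H : SimpleGraph V} {U : Finset V}
    (h : Der G0 d H U) (Y : Finset V) (hY : ∀ y ∈ Y, #(nb H y) ≤ d) : Der G0 d H (U \ Y) := by
  induction Y using Finset.induction_on with
  | empty => simpa using h
  | insert y Y _ ih =>
    have h1 := ih (fun z hz => hY z (mem_insert_of_mem hz))
    have h2 := Der.mark y h1 (hY y (mem_insert_self _ _))
    have : U \ insert y Y = (U \ Y).erase y := by
      ext z; simp only [mem_sdiff, mem_insert, mem_erase]; tauto
    rwa [this]

structure St1 (G0 : SimpleGraph V) (q : ℕ) (U : Finset V) (v : V)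
    (H : SimpleGraph V) (Cl Bp Bu A : Finset V) (ρ : V → ℕ) : Prop where
  der : Der G0 (60 * q) H Cl
  supp : ∀ u w, H.Adj u w → u ∈ U
  disj : ∀ x ∈ Bp, x ∉ Bu
  hBp : Bp ⊆ U
  hBu : Bu ⊆ U
  hv : v ∈ Bp ∨ v ∈ Bu
  dirty : ∀ x, x ∈ Bp ∨ x ∈ Bu → x ∉ Cl
  clean : ∀ u ∈ U, u ∉ Bp → u ∉ Bu → u ∈ Cl
  deg : ∀ u ∈ U, u ∉ Bp → u ∉ Bu → 60 * q ≤ #(nb H u)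
  hA : A ⊆ U
  hAp : ∀ a ∈ A, a ∉ Bp
  hAu : ∀ a ∈ A, a ∉ Bu
  cA : #A ≤ 60 * q
  cA' : 59 * q ≤ #A + (#Bp + #Bu)
  cB : #Bp + #Bu < q
  adjBu : ∀ x ∈ Bu, ∀ a ∈ A, H.Adj x a
  adjBp : ∀ x ∈ Bp, #(nn H A x) ≤ q
  nnA : ∀ a ∈ A, 14 * q ≤ #(nn H A a) + 2 * #Bp + #Bu
  nnB : ∀ x ∈ Bp, ∀ w, H.Adj x w → w ∉ Bp → w ∉ Bu → 10 * q ≤ #(nn H A w) + 2 * #Bp + #Bu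
  par : ∀ x, x ∈ Bp ∨ x ∈ Bu → x ≠ v → ∃ p ∈ Bp, ρ p < ρ x ∧ H.Adj x p

set_option maxHeartbeats 2000000 in
lemma St1.step {G0 : SimpleGraph V} {q : ℕ} {U : Finset V} {v : V}
    {H : SimpleGraph V} {Cl Bp Bu A : Finset V} {ρ : V → ℕ} (hq : 2 ≤ q)
    (nod : ∀ H Cl, Der G0 (60 * q) H Cl → ¬ Dense q (60 * q) H)
    (h : St1 G0 q U v H Cl Bp Bu A ρ) {x : V} (hx : x ∈ Bu) :
    ∃ H' Cl' Bu' A' ρ', St1 G0 q U v H' Cl' (insert x Bp) Bu' A' ρ' := by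
  have hcB := h.cB
  have hcA' := h.cA'
  let T := (nb H x).filter (fun w => w ∉ Bp ∧ w ∉ Bu ∧ #(nn H A w) < 10 * q)
  have memT : ∀ w, w ∈ T ↔ H.Adj x w ∧ w ∉ Bp ∧ w ∉ Bu ∧ #(nn H A w) < 10 * q := by
    intro w; simp [T]
  clear_value T
  have hTA : ∀ w ∈ T, w ∉ A := by
    intro w hw hwA
    have h1 := h.nnA w hwA
    have h2 := ((memT w).1 hw).2.2.2
    omega
  have hTc : #T < q := by
    by_contra hcon
    push Not at hcon
    apply nod H Cl h.der
    refine dense_of_miss T A (10 * q) hcon h.cA ?_ (by omega)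
    intro s hs
    exact le_of_lt ((memT s).1 hs).2.2.2
  have hTU : ∀ w ∈ T, w ∈ U := fun w hw => h.supp w x ((memT w).1 hw).1.symm
  let Tt := T.filter (fun w => #(nb H w) = 60 * q)
  have memTt : ∀ w, w ∈ Tt ↔ w ∈ T ∧ #(nb H w) = 60 * q := fun w => by simp [Tt]
  have hTtT : Tt ⊆ T := filter_subset _ _
  clear_value Tt
  obtain ⟨Y, hYT, f, hfinj, hf, hYc⟩ := hall_deficiency Tt A (fun w a => ¬ H.Adj w a)
  have hYc' : #(A.filter (fun a => ∃ y ∈ Y, ¬ H.Adj y a)) ≤ #Y := by convert hYc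
  have hxU : x ∈ U := h.hBu hx
  have hxp : x ∉ Bp := fun h' => h.disj x h' hx
  have hxT : x ∉ T := fun h' => ((memT x).1 h').2.2.1 hx
  have hxA : x ∉ A := fun h' => h.hAu x h' hx
  let P := Tt \ Y
  have memP : ∀ w, w ∈ P ↔ w ∈ Tt ∧ w ∉ Y := fun w => by simp [P]
  have hPA : ∀ w ∈ P, w ∉ A := fun w hw => hTA w (hTtT ((memP w).1 hw).1)
  have hfP : ∀ w ∈ P, f w ∈ A ∧ ¬ H.Adj w (f w) ∧ ∀ y ∈ Y, H.Adj y (f w) := by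
    intro w hw
    have := hf w ((memP w).1 hw).1 ((memP w).1 hw).2
    simpa only [not_not] using this
  have hfinj' : ∀ w ∈ P, ∀ w' ∈ P, f w = f w' → w = w' := fun w hw w' hw' he =>
    hfinj (by simpa [P] using hw) (by simpa [P] using hw') he
  clear_value P
  let g : V → V := fun u => if u ∈ P then f u else if hu : ∃ w ∈ P, f w = u then hu.choose else u
  have g1 : ∀ w ∈ P, g w = f w := fun w hw => by simp [g, hw]
  have g2 : ∀ w ∈ P, g (f w) = w := by
    intro w hw
    have h1 : f w ∉ P := fun h' => hPA _ h' (hfP w hw).1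
    have h2 : ∃ w' ∈ P, f w' = f w := ⟨w, hw, rfl⟩
    simp only [g, h1, if_false, h2, dif_pos]
    exact hfinj' _ h2.choose_spec.1 w hw h2.choose_spec.2
  clear_value g
  let R := P ∪ P.image f
  have memR : ∀ u, u ∈ R ↔ u ∈ P ∨ ∃ w ∈ P, f w = u := fun u => by simp [R]
  clear_value R
  have hNM : NM H R g := by
    intro u hu
    rw [memR] at hu
    rcases hu with hu | ⟨w, hw, rfl⟩
    · rw [g1 u hu, g2 u hu, memR]
      refine ⟨Or.inr ⟨u, hu, rfl⟩, rfl, ?_, (hfP u hu).2.1⟩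
      intro h'
      exact hPA u hu (h' ▸ (hfP u hu).1)
    · rw [g2 w hw, g1 w hw, memR]
      refine ⟨Or.inl hw, rfl, ?_, fun h' => (hfP w hw).2.1 h'.symm⟩
      intro h'
      exact hPA w hw (h'.symm ▸ (hfP w hw).1)
  let D := (T \ Y) ∪ R
  have memD : ∀ u, u ∈ D ↔ (u ∈ T ∧ u ∉ Y) ∨ ∃ w ∈ P, f w = u := by
    intro u
    simp only [D, mem_union, mem_sdiff, memR, memP]
    constructor
    · rintro (h1 | h1 | h1)
      · exact Or.inl h1
      · exact Or.inl ⟨hTtT h1.1, h1.2⟩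
      · exact Or.inr h1
    · tauto
  have hRx : R ⊆ nb H x := by
    intro u hu
    rw [memR] at hu
    rw [mem_nb]
    rcases hu with hu | ⟨w, hw, rfl⟩
    · exact ((memT u).1 (hTtT ((memP u).1 hu).1)).1
    · exact h.adjBu x hx _ (hfP w hw).1
  have hRD : R ⊆ D := subset_union_right
  clear_value D
  have hYdeg : ∀ y ∈ Y, #(nb H y) ≤ 60 * q := by
    intro y hy
    have := hYT hy
    rw [memTt] at this
    omega
  have hYTT : ∀ y ∈ Y, y ∈ T := fun y hy => hTtT (hYT hy)
  have hxY : x ∉ Y := fun h' => hxT (hYTT x h')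
  have hder : Der G0 (60 * q) (msD H x D R g) (Cl \ Y) :=
    (h.der.marks Y hYdeg).msD (fun h' => h.dirty x (Or.inr hx) (mem_sdiff.1 h').1) hRx hRD hNM
  let A' := A.filter (fun a => ∀ y ∈ Y, H.Adj y a)
  have memA' : ∀ a, a ∈ A' ↔ a ∈ A ∧ ∀ y ∈ Y, H.Adj y a := fun a => by simp [A']
  have hA'A : A' ⊆ A := filter_subset _ _
  clear_value A'
  have hAA' : #A ≤ #A' + #Y := by
    have : A ⊆ A' ∪ A.filter (fun a => ∃ y ∈ Y, ¬ H.Adj y a) := by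
      intro a ha
      simp only [mem_union, memA', mem_filter]
      by_cases hh : ∀ y ∈ Y, H.Adj y a
      · exact Or.inl ⟨ha, hh⟩
      · push Not at hh; exact Or.inr ⟨ha, hh⟩
    have := (card_le_card this).trans (card_union_le _ _)
    omega
  have hnn1 : ∀ w, #(nn H A w) ≤ #(nn H A' w) + #Y := by
    intro w
    have h1 : nn H A w ⊆ nn H A' w ∪ A.filter (fun a => ∃ y ∈ Y, ¬ H.Adj y a) := by
      intro a ha
      simp only [mem_union, mem_nn, memA', mem_filter] at ha ⊢
      by_cases hh : ∀ y ∈ Y, H.Adj y a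
      · tauto
      · push Not at hh; tauto
    have := (card_le_card h1).trans (card_union_le _ _)
    omega
  set H' := msD H x D R g with hH'
  have adj' : ∀ {a b : V}, H'.Adj a b ↔ (H.Adj a b ∧ ¬ (a = x ∧ b ∈ D) ∧ ¬ (b = x ∧ a ∈ D)) ∨
      (a ∈ R ∧ b = g a) := msD_adj hNM
  have hnn2 : ∀ w, w ∉ P → #(nn H A' w) ≤ #(nn H' A' w) := by
    intro w hw
    apply card_le_card
    intro a ha
    rw [mem_nn] at ha ⊢
    refine ⟨ha.1, ha.2.1, ?_⟩
    rw [adj']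
    rintro (h1 | ⟨h1, rfl⟩)
    · exact ha.2.2 h1.1
    · rw [memR] at h1
      rcases h1 with h1 | ⟨w', hw', rfl⟩
      · exact hw h1
      · rw [g2 w' hw'] at ha
        exact hPA w' hw' (hA'A ha.1)
  have hnn3 : ∀ w, #(nn H A' w) ≤ #(nn H' A' w) + 1 := by
    intro w
    have h1 : nn H A' w ⊆ insert (g w) (nn H' A' w) := by
      intro a ha
      rw [mem_insert, mem_nn]
      rw [mem_nn] at ha
      by_cases hag : a = g w
      · exact Or.inl hag
      · refine Or.inr ⟨ha.1, ha.2.1, ?_⟩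
        rw [adj']
        tauto
    exact (card_le_card h1).trans (card_insert_le _ _)
  have hA'P : ∀ a ∈ A', a ∉ P := fun a ha h' => hPA a h' (hA'A ha)
  let Bu' := (Bu.erase x) ∪ Y
  have memBu' : ∀ u, u ∈ Bu' ↔ (u ≠ x ∧ u ∈ Bu) ∨ u ∈ Y := fun u => by simp [Bu']
  have cBu' : #Bu' = #Bu - 1 + #Y := by
    rw [card_union_of_disjoint, card_erase_of_mem hx]
    rw [Finset.disjoint_left]
    intro y hy hy'
    exact ((memT y).1 (hYTT y hy')).2.2.1 (mem_of_mem_erase hy)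
  clear_value Bu'
  have hBu1 : 0 < #Bu := card_pos.2 ⟨x, hx⟩
  have cBp' : #(insert x Bp) = #Bp + 1 := card_insert_of_notMem hxp
  have hYq : #Y < q := lt_of_le_of_lt (card_le_card (hYT.trans hTtT)) hTc
  have hDB : ∀ u ∈ D, u ∉ Bp ∧ u ∉ Bu := by
    intro u hu
    rw [memD] at hu
    rcases hu with hu | ⟨w, hw, rfl⟩
    · have := (memT u).1 hu.1; tauto
    · exact ⟨h.hAp _ (hfP w hw).1, h.hAu _ (hfP w hw).1⟩
  have hDY : ∀ u ∈ D, u ∉ Y := by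
    intro u hu
    rw [memD] at hu
    rcases hu with hu | ⟨w, hw, rfl⟩
    · exact hu.2
    · exact fun h' => hTA _ (hYTT _ h') (hfP w hw).1
  have hkeepB : ∀ a b : V, (a ∈ Bp ∨ a ∈ Bu) → (b ∈ Bp ∨ b ∈ Bu ∨ b ∈ Y) → H.Adj a b → H'.Adj a b := by
    intro a b ha hb hab
    rw [adj']
    refine Or.inl ⟨hab, ?_, ?_⟩
    · rintro ⟨-, h2⟩
      have := hDB b h2
      have := hDY b h2
      tauto
    · rintro ⟨-, h2⟩
      have := hDB a h2
      tauto
  have hadjBu' : ∀ u ∈ Bu', ∀ a ∈ A', H'.Adj u a := by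
    intro u hu a ha
    rw [memBu'] at hu
    rw [adj']
    have hax : a ≠ x := by rintro rfl; exact hxA (hA'A ha)
    rcases hu with hu | hu
    · exact Or.inl ⟨h.adjBu u hu.2 a (hA'A ha), fun h' => hu.1 h'.1, fun h' => hax h'.1⟩
    · refine Or.inl ⟨((memA' a).1 ha).2 u hu, ?_, fun h' => hax h'.1⟩
      rintro ⟨rfl, -⟩
      exact hxY hu
  have hadjBp' : ∀ u ∈ insert x Bp, #(nn H' A' u) ≤ q := by
    intro u hu
    rw [mem_insert] at hu
    by_cases hux : u = x
    · subst hux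
      have h1 : nn H' A' u ⊆ P.image f := by
        intro a ha
        rw [mem_nn] at ha
        by_contra hcon
        apply ha.2.2
        rw [adj']
        refine Or.inl ⟨h.adjBu u hx a (hA'A ha.1), ?_, ?_⟩
        · rintro ⟨-, h2⟩
          rw [memD] at h2
          rcases h2 with h2 | h2
          · exact hTA a h2.1 (hA'A ha.1)
          · exact hcon (by simpa using h2)
        · rintro ⟨h2, -⟩
          exact ha.2.1 h2
      have h2 := (card_le_card h1).trans card_image_le
      have h3 : #P ≤ #T := card_le_card (fun w hw => hTtT ((memP w).1 hw).1)
      omega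
    · have huB : u ∈ Bp := by tauto
      refine le_trans (card_le_card ?_) (h.adjBp u huB)
      intro a ha
      rw [mem_nn] at ha ⊢
      refine ⟨hA'A ha.1, ha.2.1, fun h' => ha.2.2 ?_⟩
      rw [adj']
      refine Or.inl ⟨h', fun h'' => hux h''.1, ?_⟩
      rintro ⟨rfl, -⟩
      exact hxA (hA'A ha.1)
  have hnotB : ∀ u, u ∉ insert x Bp → u ∉ Bu' → u ∉ Bp ∧ u ∉ Bu ∧ u ∉ Y ∧ u ≠ x := by
    intro u h1 h2
    rw [mem_insert] at h1
    rw [memBu'] at h2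
    tauto
  refine ⟨H', Cl \ Y, Bu', A', fun u => if u ∈ Y then ρ x + 1 else ρ u, ?_⟩
  refine ⟨hder, ?_, ?_, ?_, ?_, ?_, ?_, ?_, ?_, ?_, ?_, ?_, ?_, ?_, ?_, hadjBu', hadjBp', ?_, ?_, ?_⟩
  ·
    intro u w huw
    rw [adj'] at huw
    rcases huw with h1 | ⟨h1, -⟩
    · exact h.supp u w h1.1
    · exact h.supp u x (by simpa using (mem_nb.1 (hRx h1)).symm)
  · intro u hu
    rw [mem_insert] at hu
    rw [memBu']
    rintro (h1 | h1)
    · rcases hu with hu | hu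
      · exact h1.1 hu
      · exact h.disj u hu h1.2
    · rcases hu with hu | hu
      · exact hxY (hu ▸ h1)
      · exact ((memT u).1 (hYTT u h1)).2.1 hu
  · intro u hu
    rw [mem_insert] at hu
    rcases hu with rfl | hu
    · exact hxU
    · exact h.hBp hu
  · intro u hu
    rw [memBu'] at hu
    rcases hu with hu | hu
    · exact h.hBu hu.2
    · exact hTU u (hYTT u hu)
  · rw [mem_insert, memBu']
    have := h.hv
    tauto
  · intro u hu
    rw [mem_insert, memBu'] at hu
    rw [mem_sdiff]
    rintro ⟨h1, h2⟩
    have h3 : u ∈ Bp ∨ u ∈ Bu := by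
      rcases hu with (rfl | hu) | (hu | hu)
      · exact Or.inr hx
      · exact Or.inl hu
      · exact Or.inr hu.2
      · exact absurd hu h2
    exact h.dirty u h3 h1
  · intro u huU h1 h2
    obtain ⟨e1, e2, e3, e4⟩ := hnotB u h1 h2
    rw [mem_sdiff]
    exact ⟨h.clean u huU e1 e2, e3⟩
  · intro u huU h1 h2
    obtain ⟨e1, e2, e3, e4⟩ := hnotB u h1 h2
    have hdeg := h.deg u huU e1 e2
    by_cases huR : u ∈ R
    · exact hdeg.trans (msD_deg_R hRx hNM huR)
    by_cases huD : u ∈ D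
    · have huT : u ∈ T := by
        rw [memD] at huD
        rw [memR] at huR
        rcases huD with huD | huD
        · exact huD.1
        · exact absurd (Or.inr huD) huR
      have : #(nb H u) ≠ 60 * q := by
        intro h'
        apply huR
        rw [memR, memP]
        left
        refine ⟨?_, e3⟩
        rw [memTt]
        exact ⟨huT, h'⟩
      have h3 : #(nb H u) ≤ #(nb H' u) + 1 := msD_deg_D hNM e4
      omega
    · exact hdeg.trans (msD_deg_out hNM e4 huD)
  · exact hA'A.trans h.hA
  · intro a ha
    rw [mem_insert]
    rintro (rfl | h1)
    · exact hxA (hA'A ha)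
    · exact h.hAp a (hA'A ha) h1
  · intro a ha
    rw [memBu']
    rintro (h1 | h1)
    · exact h.hAu a (hA'A ha) h1.2
    · exact hTA a (hYTT a h1) (hA'A ha)
  · exact (card_le_card hA'A).trans h.cA
  · omega
  · by_contra hcon
    apply nod H' _ hder
    refine dense_of_miss (insert x Bp ∪ Bu') A' q ?_ ((card_le_card hA'A).trans h.cA) ?_ (by omega)
    · rw [card_union_of_disjoint]
      · omega
      · rw [Finset.disjoint_left]
        intro u hu
        rw [mem_insert] at hu
        rw [memBu']
        rintro (h1 | h1)
        · rcases hu with hu | hu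
          · exact h1.1 hu
          · exact h.disj u hu h1.2
        · rcases hu with hu | hu
          · exact hxY (hu ▸ h1)
          · exact ((memT u).1 (hYTT u h1)).2.1 hu
    · intro s hs
      rw [mem_union] at hs
      rcases hs with hs | hs
      · exact hadjBp' s hs
      · have : nn H' A' s = ∅ := by
          rw [eq_empty_iff_forall_notMem]
          intro a ha
          rw [mem_nn] at ha
          exact ha.2.2 (hadjBu' s hs a ha.1)
        rw [this]
        simp
  · intro a ha
    have h1 := h.nnA a (hA'A ha)
    have h2 := hnn1 a
    have h3 := hnn2 a (hA'P a ha)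
    omega
  · intro u hu w huw hw1 hw2
    obtain ⟨e1, e2, e3, e4⟩ := hnotB w hw1 hw2
    rw [mem_insert] at hu
    by_cases hux : u = x
    · subst hux
      rw [adj'] at huw
      have huw' : H.Adj u w ∧ w ∉ D := by
        rcases huw with h1 | ⟨h1, -⟩
        · tauto
        · exact absurd (hRx h1) (by simp)
      have hwT : w ∉ T := by
        intro h'
        apply huw'.2
        rw [memD]
        exact Or.inl ⟨h', e3⟩
      have hwP : w ∉ P := fun h' => hwT (hTtT ((memP w).1 h').1)
      have h1 : 10 * q ≤ #(nn H A w) := by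
        by_contra hlt
        push Not at hlt
        exact hwT ((memT w).2 ⟨huw'.1, e1, e2, hlt⟩)
      have h2 := hnn1 w
      have h3 := hnn2 w hwP
      omega
    · have huB : u ∈ Bp := by tauto
      have huw' : H.Adj u w := by
        rw [adj'] at huw
        rcases huw with h1 | ⟨h1, -⟩
        · exact h1.1
        · exact absurd huB (hDB u (hRD h1)).1
      have h1 := h.nnB u huB w huw' e1 e2
      have h2 := hnn1 w
      have h3 := hnn3 w
      omega
  · intro u hu huv
    rw [mem_insert, memBu'] at hu
    by_cases huY : u ∈ Y
    · refine ⟨x, mem_insert_self _ _, ?_, ?_⟩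
      · simp [huY, hxY]
      · exact (hkeepB x u (Or.inr hx) (Or.inr (Or.inr huY)) ((memT u).1 (hYTT u huY)).1).symm
    · have huB : u ∈ Bp ∨ u ∈ Bu := by
        rcases hu with (rfl | hu) | (hu | hu)
        · exact Or.inr hx
        · exact Or.inl hu
        · exact Or.inr hu.2
        · exact absurd hu huY
      obtain ⟨p, hp, hρ, hadj⟩ := h.par u huB huv
      have hpY : p ∉ Y := fun h' => ((memT p).1 (hYTT p h')).2.1 hp
      refine ⟨p, mem_insert_of_mem hp, ?_, hkeepB u p huB (Or.inl hp) hadj⟩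
      simpa [huY, hpY] using hρ

lemma St1.finish {G0 : SimpleGraph V} {q : ℕ} {U : Finset V} {v : V} (hq : 2 ≤ q)
    (nod : ∀ H Cl, Der G0 (60 * q) H Cl → ¬ Dense q (60 * q) H) (n : ℕ) :
    ∀ {H : SimpleGraph V} {Cl Bp Bu A : Finset V} {ρ : V → ℕ},
    St1 G0 q U v H Cl Bp Bu A ρ → q ≤ #Bp + n →
    ∃ H' Cl' Bp' A' ρ', St1 G0 q U v H' Cl' Bp' ∅ A' ρ' := by
  induction n with
  | zero =>
    intro H Cl Bp Bu A ρ h hn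
    have := h.cB
    omega
  | succ n ih =>
    intro H Cl Bp Bu A ρ h hn
    by_cases hne : Bu.Nonempty
    · obtain ⟨x, hx⟩ := hne
      obtain ⟨H', Cl', Bu', A', ρ', h'⟩ := h.step hq nod hx
      refine ih h' ?_
      rw [card_insert_of_notMem (fun h' => h.disj x h' hx)]
      omega
    · rw [not_nonempty_iff_eq_empty] at hne
      subst hne
      exact ⟨H, Cl, Bp, A, ρ, h⟩

lemma St1.init {G0 : SimpleGraph V} {q : ℕ} {U : Finset V} {v : V} (hq : 2 ≤ q)
    (nod : ∀ H Cl, Der G0 (60 * q) H Cl → ¬ Dense q (60 * q) H)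
    {H : SimpleGraph V} {Cl : Finset V} (hder : Der G0 (60 * q) H Cl) (hU : U ⊆ Cl)
    (supp : ∀ u w, H.Adj u w → u ∈ U) (hv : v ∈ U) (hv1 : #(nb H v) ≤ 60 * q)
    (hv2 : 60 * q ≤ #(nb H v) + 1) (hdeg : ∀ u ∈ U, u ≠ v → 60 * q ≤ #(nb H u)) :
    ∃ A, St1 G0 q U v H (Cl.erase v) ∅ {v} A (fun _ => 0) := by
  let T := (nb H v).filter (fun w => #(nn H (nb H v) w) < 15 * q)
  have hTc : #T < q := by
    by_contra hcon
    push Not at hcon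
    apply nod H Cl hder
    refine dense_of_miss T (nb H v) (15 * q) hcon hv1 ?_ (by omega)
    intro s hs
    simp only [T, mem_filter] at hs
    omega
  have hc : #(nb H v \ T) = #(nb H v) - #T := card_sdiff_of_subset (filter_subset _ _)
  have hadj : ∀ a ∈ nb H v \ T, H.Adj v a := fun a ha => by simpa using (mem_sdiff.1 ha).1
  refine ⟨nb H v \ T, Der.mark v hder hv1, supp, by simp, by simp, by simpa using hv, by simp,
    by simp, ?_, ?_, ?_, by simp, ?_, ?_, ?_, ?_, ?_, by simp, ?_, by simp, by simp⟩
  · intro u hu _ h2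
    rw [mem_erase]
    exact ⟨by simpa using h2, hU hu⟩
  · intro u hu _ h2
    exact hdeg u hu (by simpa using h2)
  · intro a ha
    exact supp a v (hadj a ha).symm
  · intro a ha h'
    rw [mem_singleton] at h'
    exact (hadj a ha).ne h'.symm
  · exact (card_le_card sdiff_subset).trans hv1
  · rw [hc]
    simp
    omega
  · simp; omega
  · intro x hx a ha
    rw [mem_singleton] at hx
    subst hx
    exact hadj a ha
  · intro a ha
    have h1 : 15 * q ≤ #(nn H (nb H v) a) := by
      by_contra hcon
      rw [mem_sdiff] at ha
      exact ha.2 (by simp only [T, mem_filter]; exact ⟨ha.1, by omega⟩)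
    have h2 : nn H (nb H v) a ⊆ nn H (nb H v \ T) a ∪ T := by
      intro z hz
      simp only [mem_union, mem_nn, mem_sdiff] at hz ⊢
      tauto
    have h3 := (card_le_card h2).trans (card_union_le _ _)
    omega

end
end PPI

namespace PPI
set_option linter.unusedSectionVars false
section
open Finset
open scoped Classical

variable {V : Type*} [Fintype V]

structure St2 (G0 : SimpleGraph V) (q : ℕ) (U : Finset V) (v : V) (B0 A : Finset V) (ρ : V → ℕ)
    (Cl : Finset V) (k : ℕ) (H : SimpleGraph V) (B : Finset V) (z : V) : Prop where
  der : Der G0 (60 * q) H Cl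
  supp : ∀ u w, H.Adj u w → u ∈ U
  hB : B ⊆ B0
  iso : ∀ x ∈ B0, x ∉ B → ∀ w, ¬ H.Adj x w
  deg : ∀ u ∈ U, u ∉ B0 → 60 * q ≤ #(nb H u) + if u = z then 1 else 0
  nnx : ∀ x ∈ B, #(nn H A x) + #B ≤ q + #B0 + k
  nnw : ∀ x ∈ B, ∀ w, H.Adj x w → w ∉ B0 → 8 * q + 2 * #B ≤ #(nn H A w) + 2 * #B0 + k

structure Fix2 (q : ℕ) (U : Finset V) (B0 A Cl : Finset V) : Prop where
  dirty : ∀ x ∈ B0, x ∉ Cl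
  clean : ∀ u ∈ U, u ∉ B0 → u ∈ Cl
  hA : A ⊆ U
  hAB : ∀ a ∈ A, a ∉ B0
  cA : 58 * q ≤ #A
  cB : #B0 < q

lemma St2.core {G0 : SimpleGraph V} {q : ℕ} {U : Finset V} {v : V} {B0 A : Finset V} {ρ : V → ℕ}
    {Cl : Finset V} {H : SimpleGraph V} {B : Finset V} {z : V} (hq : 2 ≤ q)
    (nod : ∀ H Cl, Der G0 (60 * q) H Cl → ¬ Dense q (60 * q) H)
    (fx : Fix2 q U B0 A Cl)
    (h : St2 G0 q U v B0 A ρ Cl 1 H B z) {x : V} (hx : x ∈ B)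
    (hev : Even #((nb H x).filter (fun w => w ∉ B0)))
    (hpar : ∀ u ∈ B, u ≠ x → u ≠ v → ∃ p ∈ B, p ≠ x ∧ ρ p < ρ u ∧ H.Adj u p) :
    ∃ H', St2 G0 q U v B0 A ρ Cl 0 H' (B.erase x) z ∧
      (∀ u ∈ B.erase x, u ≠ v → ∃ p ∈ B.erase x, ρ p < ρ u ∧ H'.Adj u p) := by
  set R := (nb H x).filter (fun w => w ∉ B0) with hR
  have memR : ∀ w, w ∈ R ↔ H.Adj x w ∧ w ∉ B0 := fun w => by simp [hR]
  have hcB := fx.cB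
  have hBc : #B ≤ #B0 := card_le_card h.hB
  have hB1 : 0 < #B := card_pos.2 ⟨x, hx⟩
  have hBe : #(B.erase x) = #B - 1 := card_erase_of_mem hx
  obtain ⟨f, hf⟩ := exists_nonedge_matching hq (by omega : 3 * q ≤ 60 * q) H (nod H Cl h.der) R hev (by
    intro w hw
    have h1 := h.nnw x hx w ((memR w).1 hw).1 ((memR w).1 hw).2
    have h2 := h.nnx x hx
    have h3 : nn H A w ⊆ nn H R w ∪ nn H A x := by
      intro a ha
      simp only [mem_union, mem_nn, memR] at ha ⊢
      have hab := fx.hAB a ha.1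
      have hax : a ≠ x := by rintro rfl; exact hab (h.hB hx)
      tauto
    have h4 := (card_le_card h3).trans (card_union_le _ _)
    omega)
  have hxU : x ∉ Cl := fx.dirty x (h.hB hx)
  have hRx : R ⊆ nb H x := filter_subset _ _
  have hder := h.der.msD hxU hRx hRx hf
  set H' := msD H x (nb H x) R f with hH'
  have adj' : ∀ {a b : V}, H'.Adj a b ↔ (H.Adj a b ∧ ¬ (a = x ∧ b ∈ nb H x) ∧
    ¬ (b = x ∧ a ∈ nb H x)) ∨ (a ∈ R ∧ b = f a) := msD_adj hf
  have adj2 : ∀ a b, a ∈ B0 → H'.Adj a b → H.Adj a b ∧ a ≠ x ∧ b ≠ x := by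
    intro a b ha hab
    rw [adj'] at hab
    rcases hab with ⟨h1, h2, h3⟩ | ⟨h1, -⟩
    · refine ⟨h1, ?_, ?_⟩
      · rintro rfl; exact h2 ⟨rfl, by simpa using h1⟩
      · rintro rfl; exact h3 ⟨rfl, by simpa using h1.symm⟩
    · exact absurd ha ((memR a).1 h1).2
  have adj3 : ∀ a b, a ≠ x → b ≠ x → H.Adj a b → H'.Adj a b := by
    intro a b ha hb hab
    rw [adj']
    exact Or.inl ⟨hab, fun h => ha h.1, fun h => hb h.1⟩
  have hxA : x ∉ A := fun h' => fx.hAB x h' (h.hB hx)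
  refine ⟨H', ⟨hder, ?_, ?_, ?_, ?_, ?_, ?_⟩, ?_⟩
  · intro u w huw
    rw [adj'] at huw
    rcases huw with h1 | ⟨h1, -⟩
    · exact h.supp u w h1.1
    · exact h.supp u x ((memR u).1 h1).1.symm
  · exact (erase_subset _ _).trans h.hB
  · intro u hu huB w huw
    obtain ⟨h1, h2, -⟩ := adj2 u w hu huw
    exact h.iso u hu (fun h' => huB (mem_erase.2 ⟨h2, h'⟩)) w h1
  · intro u hu huB
    have h1 := h.deg u hu huB
    have hux : u ≠ x := by rintro rfl; exact huB (h.hB hx)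
    have h2 : #(nb H u) ≤ #(nb H' u) := by
      by_cases huR : u ∈ R
      · exact msD_deg_R hRx hf huR
      · refine msD_deg_out hf hux ?_
        intro h'
        apply huR
        rw [memR]
        exact ⟨by simpa using h', huB⟩
    omega
  · intro u hu
    rw [mem_erase] at hu
    have h1 := h.nnx u hu.2
    have h2 : nn H' A u ⊆ nn H A u := by
      intro a ha
      rw [mem_nn] at ha ⊢
      refine ⟨ha.1, ha.2.1, fun h' => ha.2.2 (adj3 u a hu.1 ?_ h')⟩
      rintro rfl
      exact hxA ha.1
    have h3 := card_le_card h2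
    omega
  · intro u hu w huw hw
    rw [mem_erase] at hu
    obtain ⟨h1, h2, h3⟩ := adj2 u w (h.hB hu.2) huw
    have h4 := h.nnw u hu.2 w h1 hw
    have h5 : nn H A w ⊆ insert (f w) (nn H' A w) := by
      intro a ha
      rw [mem_insert, mem_nn]
      rw [mem_nn] at ha
      by_cases hag : a = f w
      · exact Or.inl hag
      · refine Or.inr ⟨ha.1, ha.2.1, ?_⟩
        rw [adj']
        tauto
    have h6 := (card_le_card h5).trans (card_insert_le _ _)
    omega
  · intro u hu huv
    rw [mem_erase] at hu
    obtain ⟨p, hp, hpx, hρ, hadj⟩ := hpar u hu.2 hu.1 huv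
    exact ⟨p, mem_erase.2 ⟨hpx, hp⟩, hρ, adj3 u p hu.1 hpx hadj⟩

def rep3 (H : SimpleGraph V) (x p r y : V) : SimpleGraph V :=
  SimpleGraph.fromRel (fun a b => (H.Adj a b ∧ s(a, b) ≠ s(x, r) ∧ s(a, b) ≠ s(x, p) ∧ s(a, b) ≠ s(p, y)) ∨
    s(a, b) = s(r, y))

lemma rep3_adj {H : SimpleGraph V} {x p r y : V} (hry : r ≠ y) {a b : V} :
    (rep3 H x p r y).Adj a b ↔
    (H.Adj a b ∧ s(a, b) ≠ s(x, r) ∧ s(a, b) ≠ s(x, p) ∧ s(a, b) ≠ s(p, y)) ∨ s(a, b) = s(r, y) := by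
  simp only [rep3, fromRel_adj]
  constructor
  · rintro ⟨_, h | h⟩
    · exact h
    · rw [Sym2.eq_swap, H.adj_comm]; exact h
  · intro h
    refine ⟨?_, Or.inl h⟩
    rcases h with h | h
    · exact h.1.ne
    · rintro rfl
      rw [Sym2.eq_iff] at h
      rcases h with ⟨h1, h2⟩ | ⟨h1, h2⟩
      · exact hry (h1 ▸ h2)
      · exact hry (h2 ▸ h1)

lemma Der.rep3 {G0 : SimpleGraph V} {d : ℕ} {H : SimpleGraph V} {U : Finset V}
    (h : Der G0 d H U) {x p r y : V} (hx : x ∉ U) (hp : p ∉ U) (hxr : H.Adj x r) (hxp : H.Adj x p)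
    (hpy : H.Adj p y) (hrp : r ≠ p) (hry : r ≠ y) (hxy : x ≠ y) (hry' : ¬ H.Adj r y) :
    Der G0 d (PPI.rep3 H x p r y) U := by
  by_cases hadj : H.Adj p r
  ·
    let H1 : SimpleGraph V := SimpleGraph.fromRel (fun a b =>
      (H.Adj a b ∧ s(a, b) ≠ s(p, r) ∧ s(a, b) ≠ s(p, y)) ∨ s(a, b) = s(r, y))
    have h1a : ∀ a b, H1.Adj a b ↔
        (H.Adj a b ∧ s(a, b) ≠ s(p, r) ∧ s(a, b) ≠ s(p, y)) ∨ s(a, b) = s(r, y) := by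
      intro a b
      simp only [H1, fromRel_adj]
      constructor
      · rintro ⟨_, h | h⟩
        · exact h
        · rw [Sym2.eq_swap, H.adj_comm]; exact h
      · intro h
        refine ⟨?_, Or.inl h⟩
        rcases h with h | h
        · exact h.1.ne
        · rintro rfl
          rw [Sym2.eq_iff] at h
          rcases h with ⟨h1, h2⟩ | ⟨h1, h2⟩
          · exact hry (h1 ▸ h2)
          · exact hry (h2 ▸ h1)
    have hD : Der G0 d H1 U := Der.split p r y h hp hadj hpy hry (fun a b hab => (h1a a b).1 hab)
    refine Der.split x r p hD hx ?_ ?_ hrp ?_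
    · rw [h1a]
      refine Or.inl ⟨hxr, ?_, ?_⟩
      · rw [Ne, Sym2.eq_iff]; rintro (⟨h1, -⟩ | ⟨h1, -⟩)
        · exact hxp.ne h1
        · exact hxr.ne h1
      · rw [Ne, Sym2.eq_iff]; rintro (⟨h1, -⟩ | ⟨h1, -⟩)
        · exact hxp.ne h1
        · exact hxy h1
    · rw [h1a]
      refine Or.inl ⟨hxp, ?_, ?_⟩
      · rw [Ne, Sym2.eq_iff]; rintro (⟨h1, -⟩ | ⟨h1, -⟩)
        · exact hxp.ne h1
        · exact hxr.ne h1
      · rw [Ne, Sym2.eq_iff]; rintro (⟨h1, -⟩ | ⟨h1, -⟩)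
        · exact hxp.ne h1
        · exact hxy h1
    · intro a b hab
      rw [rep3_adj hry] at hab
      rw [h1a]
      rcases hab with ⟨h1, h2, h3, h4⟩ | h1
      · by_cases h5 : s(a, b) = s(r, p)
        · exact Or.inr h5
        · exact Or.inl ⟨Or.inl ⟨h1, fun h6 => h5 (by rw [h6, Sym2.eq_swap]), h4⟩, h2, h3⟩
      · refine Or.inl ⟨Or.inr h1, ?_, ?_⟩
        · rw [h1, Ne, Sym2.eq_iff]
          rintro (⟨h1, -⟩ | ⟨-, h1⟩)
          · exact hxr.ne h1.symm
          · exact hxy h1.symm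
        · rw [h1, Ne, Sym2.eq_iff]
          rintro (⟨h1, -⟩ | ⟨-, h1⟩)
          · exact hxr.ne h1.symm
          · exact hxy h1.symm
  · let H1 : SimpleGraph V := SimpleGraph.fromRel (fun a b =>
      (H.Adj a b ∧ s(a, b) ≠ s(x, r) ∧ s(a, b) ≠ s(x, p)) ∨ s(a, b) = s(r, p))
    have h1a : ∀ a b, H1.Adj a b ↔
        (H.Adj a b ∧ s(a, b) ≠ s(x, r) ∧ s(a, b) ≠ s(x, p)) ∨ s(a, b) = s(r, p) := by
      intro a b
      simp only [H1, fromRel_adj]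
      constructor
      · rintro ⟨_, h | h⟩
        · exact h
        · rw [Sym2.eq_swap, H.adj_comm]; exact h
      · intro h
        refine ⟨?_, Or.inl h⟩
        rcases h with h | h
        · exact h.1.ne
        · rintro rfl
          rw [Sym2.eq_iff] at h
          rcases h with ⟨h1, h2⟩ | ⟨h1, h2⟩
          · exact hrp (h1 ▸ h2)
          · exact hrp (h2 ▸ h1)
    have hD : Der G0 d H1 U := Der.split x r p h hx hxr hxp hrp (fun a b hab => (h1a a b).1 hab)
    refine Der.split p r y hD hp ?_ ?_ hry ?_
    · rw [h1a]; exact Or.inr Sym2.eq_swap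
    · rw [h1a]
      refine Or.inl ⟨hpy, ?_, ?_⟩
      · rw [Ne, Sym2.eq_iff]; rintro (⟨h1, -⟩ | ⟨h1, -⟩)
        · exact hxp.ne h1.symm
        · exact hrp h1.symm
      · rw [Ne, Sym2.eq_iff]; rintro (⟨h1, -⟩ | ⟨-, h1⟩)
        · exact hxp.ne h1.symm
        · exact hxy h1.symm
    · intro a b hab
      rw [rep3_adj hry] at hab
      rw [h1a]
      rcases hab with ⟨h1, h2, h3, h4⟩ | h1
      · refine Or.inl ⟨Or.inl ⟨h1, h2, h3⟩, ?_, h4⟩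
        intro h5
        have : s(a, b) ∈ H.edgeSet := h1
        rw [h5] at this
        exact hadj this
      · exact Or.inr h1

end
end PPI

namespace PPI
set_option linter.unusedSectionVars false
section
open Finset
open scoped Classical

variable {V : Type*} [Fintype V]

lemma St2.mono {G0 : SimpleGraph V} {q : ℕ} {U : Finset V} {v : V} {B0 A : Finset V} {ρ : V → ℕ}
    {Cl : Finset V} {H : SimpleGraph V} {B : Finset V} {z : V}
    (h : St2 G0 q U v B0 A ρ Cl 0 H B z) : St2 G0 q U v B0 A ρ Cl 1 H B z :=
  ⟨h.der, h.supp, h.hB, h.iso, h.deg, fun x hx => by have := h.nnx x hx; omega,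
    fun x hx w h1 h2 => by have := h.nnw x hx w h1 h2; omega⟩

set_option maxHeartbeats 1000000 in
lemma St2.prep_odd {G0 : SimpleGraph V} {q : ℕ} {U : Finset V} {v : V} {B0 A : Finset V} {ρ : V → ℕ}
    {Cl : Finset V} {H : SimpleGraph V} {B : Finset V} {z : V} (hq : 2 ≤ q)
    (fx : Fix2 q U B0 A Cl)
    (h : St2 G0 q U v B0 A ρ Cl 0 H B z) {x p : V} (hx : x ∈ B) (hp : p ∈ B) (hxp : H.Adj x p)
    (hod : Odd #((nb H x).filter (fun w => w ∉ B0)))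
    (hpar : ∀ u ∈ B, u ≠ x → u ≠ v → ∃ p ∈ B, p ≠ x ∧ ρ p < ρ u ∧ H.Adj u p) :
    ∃ H', St2 G0 q U v B0 A ρ Cl 1 H' B z ∧ Even #((nb H' x).filter (fun w => w ∉ B0)) ∧
      (∀ u ∈ B, u ≠ x → u ≠ v → ∃ p ∈ B, p ≠ x ∧ ρ p < ρ u ∧ H'.Adj u p) := by
  have hcB := fx.cB
  have hBc : #B ≤ #B0 := card_le_card h.hB
  obtain ⟨r, hr⟩ : ((nb H x).filter (fun w => w ∉ B0)).Nonempty := by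
    rw [← card_pos]; exact hod.pos
  have hr' := hr
  rw [mem_filter, mem_nb] at hr
  obtain ⟨hxr, hrB⟩ := hr
  have hxB0 := h.hB hx
  have hpB0 := h.hB hp
  obtain ⟨y, hy1, hy2⟩ : ∃ y ∈ nn H A r, y ∉ nn H A p := by
    by_contra hcon
    push Not at hcon
    have h1 := card_le_card (show nn H A r ⊆ nn H A p from hcon)
    have h2 := h.nnx p hp
    have h3 := h.nnw x hx r hxr hrB
    omega
  rw [mem_nn] at hy1 hy2
  obtain ⟨hyA, hyr, hry⟩ := hy1
  have hyB := fx.hAB y hyA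
  have hyp : y ≠ p := by rintro rfl; exact hyB hpB0
  have hpy : H.Adj p y := by tauto
  have hrp : r ≠ p := by rintro rfl; exact hrB hpB0
  have hxy : x ≠ y := by rintro rfl; exact hyB hxB0
  have adj : ∀ a b, (PPI.rep3 H x p r y).Adj a b ↔ _ := fun a b => rep3_adj hyr.symm
  have hder := h.der.rep3 (fx.dirty x hxB0) (fx.dirty p hpB0) hxr hxp hpy hrp hyr.symm hxy hry
  set H' := PPI.rep3 H x p r y with hH'
  have adj2 : ∀ a b, a ∈ B0 → H'.Adj a b → H.Adj a b ∧ s(a, b) ≠ s(x, r) := by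
    intro a b ha hab
    rw [adj] at hab
    rcases hab with h1 | h1
    · exact ⟨h1.1, h1.2.1⟩
    · rw [Sym2.eq_iff] at h1
      rcases h1 with ⟨rfl, -⟩ | ⟨rfl, -⟩
      · exact absurd ha hrB
      · exact absurd ha hyB
  have adj3 : ∀ a b, H.Adj a b → ¬ (a = x ∧ b = r) → ¬ (a = r ∧ b = x) → ¬ (a = x ∧ b = p) →
      ¬ (a = p ∧ b = x) → ¬ (a = p ∧ b = y) → ¬ (a = y ∧ b = p) → H'.Adj a b := by
    intro a b hab h1 h2 h3 h4 h5 h6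
    rw [adj]
    left
    simp only [Ne, Sym2.eq_iff]
    exact ⟨hab, not_or.2 ⟨h1, h2⟩, not_or.2 ⟨h3, h4⟩, not_or.2 ⟨h5, h6⟩⟩
  have hry1 : H'.Adj r y := by rw [adj]; exact Or.inr rfl
  have hxA : x ∉ A := fun h' => fx.hAB x h' hxB0
  have hpA : p ∉ A := fun h' => fx.hAB p h' hpB0
  refine ⟨H', ⟨hder, ?_, h.hB, ?_, ?_, ?_, ?_⟩, ?_, ?_⟩
  · intro u w huw
    rw [adj] at huw
    rcases huw with h1 | h1
    · exact h.supp u w h1.1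
    · rw [Sym2.eq_iff] at h1
      rcases h1 with ⟨rfl, -⟩ | ⟨rfl, -⟩
      · exact h.supp _ _ hxr.symm
      · exact fx.hA hyA
  · intro u hu huB w huw
    exact h.iso u hu huB w (adj2 u w hu huw).1
  · intro u hu huB
    have h1 := h.deg u hu huB
    have hux : u ≠ x := by rintro rfl; exact huB hxB0
    have hup : u ≠ p := by rintro rfl; exact huB hpB0
    have h2 : #(nb H u) ≤ #(nb H' u) := by
      by_cases hur : u = r
      · have : insert y ((nb H u).erase x) ⊆ nb H' u := by
          intro w hw
          rw [mem_insert, mem_erase, mem_nb] at hw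
          rw [mem_nb]
          rcases hw with rfl | ⟨hw1, hw2⟩
          · rw [hur]; exact hry1
          · apply adj3 u w hw2 <;> try (rintro ⟨e1, e2⟩; first | exact absurd e1 (by assumption) | exact absurd e2 (by assumption))
            rintro ⟨h1, h2⟩; exact hyr (by rw [← h1, hur])
        have h3 := card_le_card this
        rw [card_insert_of_notMem, card_erase_of_mem] at h3
        · omega
        · rw [mem_nb, hur]; exact hxr.symm
        · rw [mem_erase, mem_nb, hur]; tauto
      · by_cases huy : u = y
        · have : insert r ((nb H u).erase p) ⊆ nb H' u := by
            intro w hw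
            rw [mem_insert, mem_erase, mem_nb] at hw
            rw [mem_nb]
            rcases hw with rfl | ⟨hw1, hw2⟩
            · rw [huy]; exact hry1.symm
            · apply adj3 u w hw2 <;> (rintro ⟨e1, e2⟩; first | exact absurd e1 (by assumption) | exact absurd e2 (by assumption))
          have h3 := card_le_card this
          rw [card_insert_of_notMem, card_erase_of_mem] at h3
          · omega
          · rw [mem_nb, huy]; exact hpy.symm
          · rw [mem_erase, mem_nb, huy]
            rintro ⟨-, h4⟩
            exact hry h4.symm
        · apply card_le_card
          intro w hw
          rw [mem_nb] at hw ⊢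
          apply adj3 u w hw <;> (rintro ⟨e1, e2⟩; first | exact absurd e1 (by assumption) | exact absurd e2 (by assumption))
    omega
  · intro u hu
    have h1 := h.nnx u hu
    have h2 : nn H' A u ⊆ insert (if u = p then y else r) (nn H A u) := by
      intro a ha
      rw [mem_insert, mem_nn]
      rw [mem_nn] at ha
      by_contra hcon
      push Not at hcon
      obtain ⟨hc1, hc2⟩ := hcon
      have hau := hc2 ha.1 ha.2.1
      have hax : a ≠ x := by rintro rfl; exact hxA ha.1
      have hap : a ≠ p := by rintro rfl; exact hpA ha.1
      have huB0 := h.hB hu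
      have hur : u ≠ r := by rintro rfl; exact hrB huB0
      have huy : u ≠ y := by rintro rfl; exact hyB huB0
      apply ha.2.2
      have hxp' := hxp.ne
      apply adj3 u a hau <;> try (rintro ⟨e1, e2⟩; first | exact absurd e1 (by assumption) | exact absurd e2 (by assumption))
      · rintro ⟨rfl, rfl⟩; rw [if_neg hxp'] at hc1; exact hc1 rfl
      · rintro ⟨rfl, rfl⟩; rw [if_pos rfl] at hc1; exact hc1 rfl
    have h3 := (card_le_card h2).trans (card_insert_le _ _)
    omega
  · intro u hu w huw hw
    have huB0 := h.hB hu
    have h4 := h.nnw u hu w (adj2 u w huB0 huw).1 hw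
    have h5 : nn H A w ⊆ insert (if w = r then y else r) (nn H' A w) := by
      intro a ha
      rw [mem_insert, mem_nn]
      rw [mem_nn] at ha
      by_cases hag : a = (if w = r then y else r)
      · exact Or.inl hag
      · refine Or.inr ⟨ha.1, ha.2.1, ?_⟩
        rw [adj]
        rintro (h1 | h1)
        · exact ha.2.2 h1.1
        · rw [Sym2.eq_iff] at h1
          rcases h1 with ⟨rfl, rfl⟩ | ⟨rfl, rfl⟩
          · rw [if_pos rfl] at hag; exact hag rfl
          · rw [if_neg hyr] at hag; exact hag rfl
    have h6 := (card_le_card h5).trans (card_insert_le _ _)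
    omega
  · have : (nb H' x).filter (fun w => w ∉ B0) = ((nb H x).filter (fun w => w ∉ B0)).erase r := by
      ext w
      simp only [mem_filter, mem_nb, mem_erase]
      constructor
      · rintro ⟨h1, h2⟩
        obtain ⟨h3, h4⟩ := adj2 x w hxB0 h1
        exact ⟨fun h5 => h4 (by rw [h5]), h3, h2⟩
      · rintro ⟨h1, h2, h3⟩
        refine ⟨?_, h3⟩
        have hwp : w ≠ p := by rintro rfl; exact h3 hpB0
        have hwx : w ≠ x := by rintro rfl; exact h3 hxB0
        have := hxp.ne
        apply adj3 x w h2 <;> (rintro ⟨e1, e2⟩; first | exact absurd e1 (by assumption) | exact absurd e2 (by assumption))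
    rw [this, card_erase_of_mem hr']
    exact Nat.Odd.sub_odd hod odd_one
  · intro u hu hux huv
    obtain ⟨p', hp', hpx, hρ, hadj⟩ := hpar u hu hux huv
    refine ⟨p', hp', hpx, hρ, ?_⟩
    have hp'B := h.hB hp'
    have huB := h.hB hu
    have h1 : p' ≠ y := by rintro rfl; exact hyB hp'B
    have h2 : u ≠ y := by rintro rfl; exact hyB huB
    apply adj3 u p' hadj <;> (rintro ⟨e1, e2⟩; first | exact absurd e1 (by assumption) | exact absurd e2 (by assumption))

lemma St2.prep_last {G0 : SimpleGraph V} {q : ℕ} {U : Finset V} {v : V} {B0 A : Finset V} {ρ : V → ℕ}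
    {Cl : Finset V} {H : SimpleGraph V}
    (h : St2 G0 q U v B0 A ρ Cl 0 H {v} v)
    (hod : Odd #((nb H v).filter (fun w => w ∉ B0))) :
    ∃ H' z, St2 G0 q U v B0 A ρ Cl 1 H' {v} z ∧ Even #((nb H' v).filter (fun w => w ∉ B0)) := by
  obtain ⟨r, hr⟩ : ((nb H v).filter (fun w => w ∉ B0)).Nonempty := by
    rw [← card_pos]; exact hod.pos
  have hr' := hr
  rw [mem_filter, mem_nb] at hr
  obtain ⟨hvr, hrB⟩ := hr
  have hvB : v ∈ B0 := h.hB (mem_singleton_self v)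
  have adj : ∀ a b, (H.deleteEdges {s(v, r)}).Adj a b ↔ H.Adj a b ∧ s(a, b) ≠ s(v, r) := by
    intro a b; simp [deleteEdges_adj]
  refine ⟨H.deleteEdges {s(v, r)}, r, ⟨Der.del h.der (deleteEdges_le _), ?_, h.hB, ?_, ?_, ?_, ?_⟩, ?_⟩
  · intro u w huw; exact h.supp u w ((adj u w).1 huw).1
  · intro u hu huB w huw; exact h.iso u hu huB w ((adj u w).1 huw).1
  · intro u hu huB
    have h1 := h.deg u hu huB
    have huv : u ≠ v := by rintro rfl; exact huB hvB
    rw [if_neg huv] at h1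
    split_ifs with hur
    · have : (nb H u).erase v ⊆ nb (H.deleteEdges {s(v, r)}) u := by
        intro w hw
        rw [mem_erase, mem_nb] at hw
        rw [mem_nb, adj]
        refine ⟨hw.2, ?_⟩
        rw [Ne, Sym2.eq_iff]; tauto
      have h3 := card_le_card this
      have h4 := pred_card_le_card_erase (s := nb H u) (a := v)
      omega
    · have : nb H u ⊆ nb (H.deleteEdges {s(v, r)}) u := by
        intro w hw
        rw [mem_nb] at hw
        rw [mem_nb, adj]
        refine ⟨hw, ?_⟩
        rw [Ne, Sym2.eq_iff]; tauto
      have h3 := card_le_card this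
      omega
  · intro u hu
    have h1 := h.nnx u hu
    have huv := mem_singleton.1 hu
    have h2 : nn (H.deleteEdges {s(v, r)}) A u ⊆ insert r (nn H A u) := by
      intro a ha
      rw [mem_insert, mem_nn]
      rw [mem_nn, adj] at ha
      by_cases har : a = r
      · exact Or.inl har
      · refine Or.inr ⟨ha.1, ha.2.1, fun h' => ha.2.2 ⟨h', ?_⟩⟩
        rw [Ne, Sym2.eq_iff, huv]
        rintro (⟨-, h1⟩ | ⟨-, h1⟩)
        · exact har h1
        · exact ha.2.1 (h1.trans huv.symm)
    have h3 := (card_le_card h2).trans (card_insert_le _ _)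
    omega
  · intro u hu w huw hw
    have h4 := h.nnw u hu w ((adj u w).1 huw).1 hw
    have h5 : nn H A w ⊆ nn (H.deleteEdges {s(v, r)}) A w := by
      intro a ha
      rw [mem_nn] at ha ⊢
      rw [adj]
      tauto
    have := card_le_card h5
    omega
  · have : (nb (H.deleteEdges {s(v, r)}) v).filter (fun w => w ∉ B0) =
        ((nb H v).filter (fun w => w ∉ B0)).erase r := by
      ext w
      simp only [mem_filter, mem_nb, mem_erase, adj, Ne, Sym2.congr_right]
      tauto
    rw [this, card_erase_of_mem hr']
    exact Nat.Odd.sub_odd hod odd_one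

lemma St2.finish {G0 : SimpleGraph V} {q : ℕ} {U : Finset V} {v : V} {B0 A : Finset V} {ρ : V → ℕ}
    {Cl : Finset V} (hq : 2 ≤ q)
    (nod : ∀ H Cl, Der G0 (60 * q) H Cl → ¬ Dense q (60 * q) H)
    (fx : Fix2 q U B0 A Cl) (n : ℕ) :
    ∀ {H : SimpleGraph V} {B : Finset V}, St2 G0 q U v B0 A ρ Cl 0 H B v → v ∈ B → #B = n + 1 →
    (∀ u ∈ B, u ≠ v → ∃ p ∈ B, ρ p < ρ u ∧ H.Adj u p) →
    ∃ H' z, St2 G0 q U v B0 A ρ Cl 0 H' ∅ z := by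
  induction n with
  | zero =>
    intro H B h hv hB _
    obtain rfl : B = {v} := by
      obtain ⟨w, rfl⟩ := card_eq_one.1 hB
      rw [mem_singleton.1 hv]
    by_cases hev : Even #((nb H v).filter (fun w => w ∉ B0))
    · obtain ⟨H', h', -⟩ := St2.core hq nod fx h.mono hv hev (by
        intro u hu h1 _; exact absurd (mem_singleton.1 hu) h1)
      exact ⟨H', v, by simpa using h'⟩
    · rw [Nat.not_even_iff_odd] at hev
      obtain ⟨H1, z, h1, hev1⟩ := h.prep_last hev
      obtain ⟨H', h', -⟩ := St2.core hq nod fx h1 hv hev1 (by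
        intro u hu h1 _; exact absurd (mem_singleton.1 hu) h1)
      exact ⟨H', z, by simpa using h'⟩
  | succ n ih =>
    intro H B h hv hB hpar
    have hne : (B.erase v).Nonempty := by
      rw [← card_pos, card_erase_of_mem hv]; omega
    obtain ⟨x, hx, hmax⟩ := exists_max_image (B.erase v) ρ hne
    rw [mem_erase] at hx
    have hpar' : ∀ u ∈ B, u ≠ x → u ≠ v → ∃ p ∈ B, p ≠ x ∧ ρ p < ρ u ∧ H.Adj u p := by
      intro u hu _ huv
      obtain ⟨p, hp, h1, h2⟩ := hpar u hu huv
      refine ⟨p, hp, ?_, h1, h2⟩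
      rintro rfl
      have := hmax u (mem_erase.2 ⟨huv, hu⟩)
      omega
    obtain ⟨p, hp, -, hxp⟩ := hpar x hx.2 hx.1
    obtain ⟨H1, h1, hev1, hpar1⟩ : ∃ H', St2 G0 q U v B0 A ρ Cl 1 H' B v ∧
        Even #((nb H' x).filter (fun w => w ∉ B0)) ∧
        (∀ u ∈ B, u ≠ x → u ≠ v → ∃ p ∈ B, p ≠ x ∧ ρ p < ρ u ∧ H'.Adj u p) := by
      by_cases hev : Even #((nb H x).filter (fun w => w ∉ B0))
      · exact ⟨H, h.mono, hev, hpar'⟩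
      · rw [Nat.not_even_iff_odd] at hev
        exact h.prep_odd hq fx hx.2 hp hxp hev hpar'
    obtain ⟨H', h', hp'⟩ := St2.core hq nod fx h1 hx.2 hev1 hpar1
    refine ih h' (mem_erase.2 ⟨hx.1.symm, hv⟩) ?_ hp'
    rw [card_erase_of_mem hx.2]; omega

structure Cls (G0 : SimpleGraph V) (q : ℕ) (U : Finset V) (H : SimpleGraph V) (Cl : Finset V)
    (z : V) : Prop where
  der : Der G0 (60 * q) H Cl
  sub : U ⊆ Cl
  ne : U.Nonempty
  supp : ∀ u w, H.Adj u w → u ∈ U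
  deg : ∀ u ∈ U, 60 * q ≤ #(nb H u) + if u = z then 1 else 0

lemma Cls.tight {G0 : SimpleGraph V} {q : ℕ} {U Cl : Finset V} (n : ℕ) :
    ∀ {H : SimpleGraph V} {z : V}, Cls G0 q U H Cl z → #H.edgeFinset ≤ n →
    ∃ H' z' v, Cls G0 q U H' Cl z' ∧ v ∈ U ∧ #(nb H' v) ≤ 60 * q := by
  induction n with
  | zero =>
    intro H z h hn
    obtain ⟨v, hv⟩ := h.ne
    refine ⟨H, z, v, h, hv, ?_⟩
    have := sum_nb H
    have h2 := single_le_sum (f := fun u => #(nb H u)) (fun _ _ => Nat.zero_le _) (mem_univ v)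
    omega
  | succ n ih =>
    intro H z h hn
    by_cases hall : ∃ v ∈ U, #(nb H v) ≤ 60 * q
    · obtain ⟨v, hv, h1⟩ := hall
      exact ⟨H, z, v, h, hv, h1⟩
    push Not at hall
    obtain ⟨v, hv⟩ := h.ne
    have h1 := hall v hv
    obtain ⟨r, hr⟩ : (nb H v).Nonempty := by rw [← card_pos]; omega
    rw [mem_nb] at hr
    refine ih (H := H.deleteEdges {s(v, r)}) (z := z) ⟨Der.del h.der (deleteEdges_le _), h.sub, h.ne, ?_, ?_⟩ ?_
    · intro u w huw; exact h.supp u w (deleteEdges_le _ huw)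
    · intro u hu
      have h2 := hall u hu
      have : (nb H u).erase (if u = v then r else v) ⊆ nb (H.deleteEdges {s(v, r)}) u := by
        intro w hw
        rw [mem_erase, mem_nb] at hw
        rw [mem_nb, deleteEdges_adj]
        refine ⟨hw.2, ?_⟩
        rw [Set.mem_singleton_iff, Sym2.eq_iff]
        rintro (⟨rfl, rfl⟩ | ⟨rfl, rfl⟩)
        · rw [if_pos rfl] at hw; exact hw.1 rfl
        · rw [if_neg hr.ne'] at hw; exact hw.1 rfl
      have h3 := card_le_card this
      have h4 := pred_card_le_card_erase (s := nb H u) (a := if u = v then r else v)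
      omega
    · have : #(H.deleteEdges {s(v, r)}).edgeFinset < #H.edgeFinset := by
        apply card_lt_card
        rw [Finset.ssubset_iff_subset_ne]
        constructor
        · exact edgeFinset_mono (deleteEdges_le _)
        · intro he
          have h5 : s(v, r) ∈ H.edgeFinset := by rw [mem_edgeFinset]; exact hr
          rw [← he, mem_edgeFinset, mem_edgeSet, deleteEdges_adj] at h5
          exact h5.2 rfl
      refine Nat.le_of_lt_succ (lt_of_lt_of_le ?_ hn)
      refine lt_of_le_of_lt (le_of_eq ?_) this
      congr!

lemma Cls.absurd {G0 : SimpleGraph V} {q : ℕ} (hq : 2 ≤ q)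
    (nod : ∀ H Cl, Der G0 (60 * q) H Cl → ¬ Dense q (60 * q) H) (n : ℕ) :
    ∀ {U : Finset V} {H : SimpleGraph V} {Cl : Finset V} {z : V}, #U ≤ n → ¬ Cls G0 q U H Cl z := by
  induction n with
  | zero =>
    intro U H Cl z hU h
    have := h.ne.card_pos
    omega
  | succ n ih =>
    intro U H Cl z hU h
    obtain ⟨H, z, v, h, hvU, hv⟩ := h.tight _ le_rfl
    obtain ⟨v, hvU, hv1, hv2, hdeg⟩ : ∃ v ∈ U, #(nb H v) ≤ 60 * q ∧ 60 * q ≤ #(nb H v) + 1 ∧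
        ∀ u ∈ U, u ≠ v → 60 * q ≤ #(nb H u) := by
      by_cases hz : z ∈ U ∧ #(nb H z) ≤ 60 * q
      · refine ⟨z, hz.1, hz.2, ?_, ?_⟩
        · have := h.deg z hz.1; rwa [if_pos rfl] at this
        · intro u hu huz; have := h.deg u hu; rwa [if_neg huz] at this
      · have h1 : ∀ u ∈ U, 60 * q ≤ #(nb H u) := by
          intro u hu
          have := h.deg u hu
          by_cases huz : u = z
          · subst huz
            by_contra hcon
            exact hz ⟨hu, by omega⟩
          · rwa [if_neg huz] at this
        exact ⟨v, hvU, hv, by have := h1 v hvU; omega, fun u hu _ => h1 u hu⟩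
    obtain ⟨A, hst⟩ := St1.init hq nod h.der h.sub h.supp hvU hv1 hv2 hdeg
    obtain ⟨H1, Cl1, B0, A, ρ, h1⟩ := hst.finish hq nod q (by omega)
    have hcA := h1.cA'
    have hcB := h1.cB
    simp only [card_empty, add_zero] at hcA hcB
    have hvB : v ∈ B0 := by simpa using h1.hv
    have fx : Fix2 q U B0 A Cl1 := ⟨fun x hx => h1.dirty x (Or.inl hx),
      fun u hu hub => h1.clean u hu hub (by simp), h1.hA, h1.hAp, by omega, hcB⟩
    have h2 : St2 G0 q U v B0 A ρ Cl1 0 H1 B0 v := by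
      refine ⟨h1.der, h1.supp, Subset.rfl, fun x h h' => (h' h).elim, ?_, ?_, ?_⟩
      · intro u hu hub
        have := h1.deg u hu hub (by simp)
        omega
      · intro x hx; have := h1.adjBp x hx; omega
      · intro x hx w hw hwB
        have := h1.nnB x hx w hw hwB (by simp)
        simp only [card_empty, add_zero] at this
        omega
    have hpos : 0 < #B0 := card_pos.2 ⟨v, hvB⟩
    obtain ⟨H2, z2, h3⟩ := St2.finish hq nod fx (#B0 - 1) h2 hvB (by omega)
      (fun u hu huv => h1.par u (Or.inl hu) huv)
    refine ih (U := U \ B0) (H := H2) (Cl := Cl1) (z := z2) ?_ ⟨h3.der, ?_, ?_, ?_, ?_⟩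
    · have : U \ B0 ⊂ U := by
        rw [Finset.ssubset_iff_subset_ne]
        refine ⟨sdiff_subset, fun he => ?_⟩
        have : v ∈ U \ B0 := by rw [he]; exact hvU
        exact (mem_sdiff.1 this).2 hvB
      have := card_lt_card this
      omega
    · intro u hu
      rw [mem_sdiff] at hu
      exact fx.clean u hu.1 hu.2
    · have : 0 < #A := by omega
      obtain ⟨a, ha⟩ := card_pos.1 this
      exact ⟨a, mem_sdiff.2 ⟨fx.hA ha, fx.hAB a ha⟩⟩
    · intro u w huw
      rw [mem_sdiff]
      exact ⟨h3.supp u w huw, fun hu => h3.iso u hu (by simp) w huw⟩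
    · intro u hu
      rw [mem_sdiff] at hu
      exact h3.deg u hu.1 hu.2

theorem exists_dense {G0 : SimpleGraph V} {q : ℕ} (hq : 2 ≤ q) (U : Finset V)
    (supp : ∀ u w, G0.Adj u w → u ∈ U) (ne : U.Nonempty) (deg : ∀ u ∈ U, 60 * q ≤ #(nb G0 u)) :
    ∃ H Cl, Der G0 (60 * q) H Cl ∧ Dense q (60 * q) H := by
  by_contra hcon
  push Not at hcon
  obtain ⟨v, hv⟩ := ne
  refine Cls.absurd hq hcon (#U) (U := U) (H := G0) (Cl := univ) (z := v) le_rfl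
    ⟨Der.base, subset_univ _, ⟨v, hv⟩, supp, fun u hu => ?_⟩
  have := deg u hu
  omega

end
end PPI

namespace PPI
set_option linter.unusedSectionVars false
section
open Finset
open scoped Classical

lemma tutte_labels {N : Type*} [Fintype N] (Γ : SimpleGraph N) (hev : Even (Fintype.card N)) :
    (∃ m : N → N, (∀ u, Γ.Adj u (m u)) ∧ ∀ u, m (m u) = u) ∨
    ∃ (W : Finset N) (κ : N → N) (O : Finset N), #W + 2 ≤ #O ∧
      (∀ u v, u ∉ W → v ∉ W → Γ.Adj u v → κ u = κ v) ∧
      ∀ o ∈ O, Odd #(univ.filter (fun u => u ∉ W ∧ κ u = o)) := by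
  by_cases hM : ∃ M : Subgraph Γ, M.IsPerfectMatching
  · left
    obtain ⟨M, hM, hS⟩ := hM
    choose m hm hm' using fun v => hM (hS v)
    refine ⟨m, fun u => M.adj_sub (hm u), fun u => ?_⟩
    exact (hm' (m u) u (hm u).symm).symm
  · right
    rw [tutte] at hM
    push Not at hM
    obtain ⟨u, hu⟩ := hM
    unfold IsTutteViolator at hu
    set D := ((⊤ : Γ.Subgraph).deleteVerts u) with hD
    have hv : ∀ x, x ∈ D.verts ↔ x ∉ u := by intro x; simp [hD]
    let f : D.coe.ConnectedComponent → N := fun c => (Quot.out c : D.verts).1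
    have hf : ∀ c, D.coe.connectedComponentMk (Quot.out c) = c := fun c => Quot.out_eq c
    have finj : Function.Injective f := by
      intro c c' h
      rw [← hf c, ← hf c']
      exact congrArg _ (Subtype.ext h)
    let W : Finset N := univ.filter (fun x => x ∈ u)
    have hW : ∀ x, x ∈ W ↔ x ∈ u := fun x => by simp [W]
    let κ : N → N := fun x => if h : x ∈ D.verts then f (D.coe.connectedComponentMk ⟨x, h⟩) else x
    have hκ : ∀ x (h : x ∈ D.verts), κ x = f (D.coe.connectedComponentMk ⟨x, h⟩) := by
      intro x h; simp only [κ, dif_pos h]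
    have huW : u.ncard = #W := by
      rw [← Set.ncard_coe_finset]
      congr 1
      ext x; simp [hW]
    let O : Finset N := (f '' D.coe.oddComponents).toFinset
    have hO : #O = D.coe.oddComponents.ncard := by
      rw [← Set.ncard_image_of_injective _ finj, Set.ncard_eq_toFinset_card']
    refine ⟨W, κ, O, ?_, ?_, ?_⟩
    · have h1 := odd_ncard_oddComponents D.coe
      have h2 : Nat.card D.verts + #W = Fintype.card N := by
        have h3 : D.verts = uᶜ := by ext x; simp [hv]
        rw [h3, ← huW]
        have := Set.ncard_add_ncard_compl u
        rw [Nat.card_eq_fintype_card] at this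
        rw [Nat.card_coe_set_eq]
        omega
      rw [← hO] at h1 hu
      rw [huW] at hu
      rcases Nat.even_or_odd (#O) with h | h
      · have h4 : Even (Nat.card D.verts) := by
          rw [← Nat.not_odd_iff_even, ← h1, Nat.not_odd_iff_even]; exact h
        rw [Nat.even_iff] at *
        omega
      · have h4 := h1.1 h
        rw [Nat.even_iff] at *
        rw [Nat.odd_iff] at *
        omega
    · intro x y hx hy hxy
      rw [hW, ← hv] at hx hy
      rw [hκ x hx, hκ y hy]
      congr 1
      apply ConnectedComponent.connectedComponentMk_eq_of_adj
      rw [Subgraph.coe_adj]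
      exact Subgraph.deleteVerts_adj.2 ⟨trivial, (hv x).1 hx, trivial, (hv y).1 hy, hxy⟩
    · intro o ho
      simp only [O, Set.mem_toFinset] at ho
      obtain ⟨c, hc, rfl⟩ := ho
      have h1 : Odd c.supp.ncard := hc
      convert h1 using 1
      rw [← Set.ncard_image_of_injective c.supp Subtype.val_injective, ← Set.ncard_coe_finset]
      congr 1
      ext x
      simp only [coe_filter, mem_univ, true_and, Set.mem_ofPred_eq, Set.mem_image, Subtype.exists,
        exists_and_right, exists_eq_right, ConnectedComponent.mem_supp_iff, hW]
      constructor
      · rintro ⟨h1, h2⟩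
        rw [← hv] at h1
        refine ⟨h1, ?_⟩
        rw [hκ x h1] at h2
        exact finj h2
      · rintro ⟨h1, h2⟩
        exact ⟨(hv x).1 h1, by rw [hκ x h1, h2]⟩

end

section
open Finset
open scoped Classical
variable {V : Type*}

structure Seg {N : Type*} (G : SimpleGraph V) (loc : N → V) (idx : N → ZMod 2) (mate : N → N)
    (X : Finset N) (m : N → N) (E : N → Finset (Sym2 V)) : Prop where
  mX : ∀ u ∈ X, m u ∈ X
  mm : ∀ u ∈ X, m (m u) = u
  mne : ∀ u ∈ X, m u ≠ u
  mate : ∀ u ∈ X, mate u ∈ X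
  walk : ∀ u ∈ X, ∃ p : G.Walk (loc u) (loc (m u)), p.IsTrail ∧ (∀ e ∈ p.edges, e ∈ E u) ∧
    (p.length : ZMod 2) = idx u + idx (m u) + 1
  Em : ∀ u ∈ X, E (m u) = E u
  disj : ∀ u ∈ X, ∀ w ∈ X, w ≠ u → w ≠ m u → Disjoint (E u) (E w)

lemma isTrail_append {G : SimpleGraph V} {a b c : V} {p : G.Walk a b} {p' : G.Walk b c}
    (h : p.IsTrail) (h' : p'.IsTrail) (hd : List.Disjoint p.edges p'.edges) :
    (p.append p').IsTrail := by
  rw [Walk.isTrail_def, Walk.edges_append, List.nodup_append']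
  exact ⟨h.edges_nodup, h'.edges_nodup, hd⟩

lemma Seg.merge {N : Type*} {G : SimpleGraph V} {loc : N → V} {idx : N → ZMod 2} {mate : N → N}
    (hloc : ∀ u, loc (mate u) = loc u) (hmm : ∀ u, mate (mate u) = u)
    (hidx : ∀ u, mate u ≠ u → idx u + idx (mate u) = 1)
    {X : Finset N} {m : N → N} {E : N → Finset (Sym2 V)} (h : Seg G loc idx mate X m E)
    {u : N} (hu : u ∈ X) (hmu : mate u ≠ u) :
    ∃ m' E', Seg G loc idx mate ((X.erase u).erase (mate u)) m' E' := by
  set u' := mate u with hu'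
  have huX' : u' ∈ X := h.mate u hu
  have mem : ∀ w, w ∈ (X.erase u).erase u' ↔ w ≠ u' ∧ w ≠ u ∧ w ∈ X := by
    intro w; simp only [mem_erase]
  have hmate : ∀ w ∈ (X.erase u).erase u', mate w ∈ (X.erase u).erase u' := by
    intro w hw
    rw [mem] at hw ⊢
    refine ⟨?_, ?_, h.mate w hw.2.2⟩
    · intro h1
      apply hw.2.1
      rw [← hmm w, h1, hu', hmm]
    · intro h1
      apply hw.1
      rw [← hmm w, h1]
  by_cases hcase : m u = u'
  · refine ⟨m, E, ?_, ?_, ?_, hmate, ?_, ?_, ?_⟩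
    · intro w hw
      rw [mem] at hw ⊢
      refine ⟨?_, ?_, h.mX w hw.2.2⟩
      · intro h1
        apply hw.2.1
        rw [← h.mm w hw.2.2, h1, ← hcase, h.mm u hu]
      · intro h1
        apply hw.1
        rw [← h.mm w hw.2.2, h1, hcase]
    · intro w hw; exact h.mm w ((mem w).1 hw).2.2
    · intro w hw; exact h.mne w ((mem w).1 hw).2.2
    · intro w hw; exact h.walk w ((mem w).1 hw).2.2
    · intro w hw; exact h.Em w ((mem w).1 hw).2.2
    · intro w hw w' hw'; exact h.disj w ((mem w).1 hw).2.2 w' ((mem w').1 hw').2.2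
  · set a := m u with ha
    set b := m u' with hb
    have haX : a ∈ X := h.mX u hu
    have hbX : b ∈ X := h.mX u' huX'
    have hma : m a = u := h.mm u hu
    have hmb : m b = u' := h.mm u' huX'
    have hau : a ≠ u := h.mne u hu
    have hbu' : b ≠ u' := h.mne u' huX'
    have hbu : b ≠ u := by
      intro h1; apply hcase; rw [ha, ← h1, hmb]
    have hab : a ≠ b := by
      intro h1; apply hmu; rw [← hmb, ← h1, hma]
    let m' : N → N := fun w => if w = a then b else if w = b then a else m w
    let E' : N → Finset (Sym2 V) := fun w => if w = a ∨ w = b then E a ∪ E b else E w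
    have m'a : m' a = b := by simp [m']
    have m'b : m' b = a := by simp [m', hab.symm]
    have m'o : ∀ w, w ≠ a → w ≠ b → m' w = m w := by intro w h1 h2; simp [m', h1, h2]
    have E'a : E' a = E a ∪ E b := by simp [E']
    have E'b : E' b = E a ∪ E b := by simp [E']
    have E'o : ∀ w, w ≠ a → w ≠ b → E' w = E w := by intro w h1 h2; simp [E', h1, h2]
    clear_value m' E'
    have hmw : ∀ w, w ≠ u' → w ≠ u → w ∈ X → w ≠ a → w ≠ b → m w ≠ a ∧ m w ≠ b ∧ m w ≠ u ∧ m w ≠ u' := by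
      intro w h1 h2 hw h3 h4
      have := h.mm w hw
      refine ⟨?_, ?_, ?_, ?_⟩
      · intro h5; apply h2; rw [← this, h5, hma]
      · intro h5; apply h1; rw [← this, h5, hmb]
      · intro h5; apply h3; rw [← this, h5]
      · intro h5; apply h4; rw [← this, h5]
    have hEa : E a = E u := h.Em u hu
    have hEb : E b = E u' := h.Em u' huX'
    have dab : Disjoint (E a) (E b) := h.disj a haX b hbX hab.symm (by rw [hma]; exact hbu)
    have key : ∃ p : G.Walk (loc a) (loc b), p.IsTrail ∧ (∀ e ∈ p.edges, e ∈ E a ∪ E b) ∧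
        (p.length : ZMod 2) = idx a + idx b + 1 := by
      have w1 := h.walk a haX
      have w2 := h.walk u' huX'
      rw [hma] at w1
      rw [← hb] at w2
      obtain ⟨p1, t1, e1, l1⟩ := w1
      obtain ⟨p2, t2, e2, l2⟩ := w2
      · refine ⟨p1.append (p2.copy (hloc u) rfl), ?_, ?_, ?_⟩
        · refine isTrail_append t1 (by simpa using t2) ?_
          intro e he he'
          rw [Walk.edges_copy] at he'
          have h1 := e1 e he
          have h2 := e2 e he'
          rw [← hEb] at h2
          exact disjoint_left.1 dab h1 h2
        · intro e he
          rw [Walk.edges_append, Walk.edges_copy, List.mem_append] at he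
          rw [mem_union]
          rcases he with he | he
          · exact Or.inl (e1 e he)
          · right; rw [hEb]; exact e2 e he
        · rw [Walk.length_append, Walk.length_copy]
          push_cast
          rw [l1, l2]
          have := hidx u hmu
          rw [← hu'] at this
          linear_combination this + (1 : ZMod 2) * (by decide : (2 : ZMod 2) = 0)
    refine ⟨m', E', ?_, ?_, ?_, hmate, ?_, ?_, ?_⟩
    · intro w hw
      rw [mem] at hw ⊢
      by_cases h1 : w = a
      · rw [h1, m'a]; exact ⟨hbu', hbu, hbX⟩
      by_cases h2 : w = b
      · rw [h2, m'b]; exact ⟨hcase, hau, haX⟩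
      rw [m'o w h1 h2]
      have := hmw w hw.1 hw.2.1 hw.2.2 h1 h2
      exact ⟨this.2.2.2, this.2.2.1, h.mX w hw.2.2⟩
    · intro w hw
      rw [mem] at hw
      by_cases h1 : w = a
      · rw [h1, m'a, m'b]
      by_cases h2 : w = b
      · rw [h2, m'b, m'a]
      have := hmw w hw.1 hw.2.1 hw.2.2 h1 h2
      rw [m'o w h1 h2, m'o _ this.1 this.2.1, h.mm w hw.2.2]
    · intro w hw
      rw [mem] at hw
      by_cases h1 : w = a
      · rw [h1, m'a]; exact hab.symm
      by_cases h2 : w = b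
      · rw [h2, m'b]; exact hab
      rw [m'o w h1 h2]; exact h.mne w hw.2.2
    · intro w hw
      rw [mem] at hw
      by_cases h1 : w = a
      · rw [h1, m'a, E'a]; exact key
      by_cases h2 : w = b
      · rw [h2, m'b, E'b]
        obtain ⟨p, t, e, l⟩ := key
        refine ⟨p.reverse, t.reverse, ?_, ?_⟩
        · intro f hf; rw [Walk.edges_reverse, List.mem_reverse] at hf; exact e f hf
        · rw [Walk.length_reverse, l]; ring
      rw [m'o w h1 h2, E'o w h1 h2]; exact h.walk w hw.2.2
    · intro w hw
      rw [mem] at hw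
      by_cases h1 : w = a
      · rw [h1, m'a, E'a, E'b]
      by_cases h2 : w = b
      · rw [h2, m'b, E'a, E'b]
      have := hmw w hw.1 hw.2.1 hw.2.2 h1 h2
      rw [m'o w h1 h2, E'o _ this.1 this.2.1, E'o w h1 h2, h.Em w hw.2.2]
    · have dis : ∀ w, w ≠ u' → w ≠ u → w ∈ X → w ≠ a → w ≠ b → Disjoint (E a ∪ E b) (E w) := by
        intro w h1 h2 h3 h4 h5
        rw [disjoint_union_left]
        refine ⟨h.disj a haX w h3 h4 (by rw [hma]; exact h2), h.disj b hbX w h3 h5 (by rw [hmb]; exact h1)⟩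
      intro w hw w' hw' hne hne'
      rw [mem] at hw hw'
      by_cases h1 : w = a
      · rw [h1, m'a] at hne'; rw [h1] at hne
        rw [h1, E'a, E'o w' hne hne']
        exact dis w' hw'.1 hw'.2.1 hw'.2.2 hne hne'
      by_cases h2 : w = b
      · rw [h2, m'b] at hne'; rw [h2] at hne
        rw [h2, E'b, E'o w' hne' hne]
        exact dis w' hw'.1 hw'.2.1 hw'.2.2 hne' hne
      rw [m'o w h1 h2] at hne'
      rw [E'o w h1 h2]
      by_cases h3 : w' = a
      · rw [h3, E'a]; exact (dis w hw.1 hw.2.1 hw.2.2 h1 h2).symm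
      by_cases h4 : w' = b
      · rw [h4, E'b]; exact (dis w hw.1 hw.2.1 hw.2.2 h1 h2).symm
      rw [E'o w' h3 h4]
      exact h.disj w hw.2.2 w' hw'.2.2 hne hne'

lemma Seg.finish {N : Type*} {G : SimpleGraph V} {loc : N → V} {idx : N → ZMod 2} {mate : N → N}
    (hloc : ∀ u, loc (mate u) = loc u) (hmm : ∀ u, mate (mate u) = u)
    (hidx : ∀ u, mate u ≠ u → idx u + idx (mate u) = 1) (n : ℕ) :
    ∀ {X : Finset N} {m : N → N} {E : N → Finset (Sym2 V)}, Seg G loc idx mate X m E → #X ≤ n →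
    ∃ m' E', Seg G loc idx mate (X.filter (fun u => mate u = u)) m' E' := by
  induction n with
  | zero =>
    intro X m E h hX
    obtain rfl : X = ∅ := card_eq_zero.1 (by omega)
    exact ⟨m, E, by simpa using h⟩
  | succ n ih =>
    intro X m E h hX
    by_cases hne : ∃ u ∈ X, mate u ≠ u
    · obtain ⟨u, hu, hmu⟩ := hne
      obtain ⟨m1, E1, h1⟩ := h.merge hloc hmm hidx hu hmu
      have hc : #((X.erase u).erase (mate u)) ≤ n := by
        have := card_erase_of_mem hu
        have := card_erase_le (s := X.erase u) (a := mate u)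
        omega
      obtain ⟨m', E', h'⟩ := ih h1 hc
      refine ⟨m', E', ?_⟩
      convert h' using 1
      ext w
      simp only [mem_filter, mem_erase]
      constructor
      · rintro ⟨h2, h3⟩
        refine ⟨⟨?_, ?_, h2⟩, h3⟩
        · rintro rfl; rw [hmm] at h3; exact hmu h3.symm
        · rintro rfl; exact hmu h3
      · rintro ⟨⟨-, -, h2⟩, h3⟩
        exact ⟨h2, h3⟩
    · push Not at hne
      refine ⟨m, E, ?_⟩
      rw [filter_true_of_mem hne]
      exact h

lemma transversal {N : Type*} (n : ℕ) : ∀ {X : Finset N} {m : N → N},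
    (∀ u ∈ X, m u ∈ X) → (∀ u ∈ X, m (m u) = u) → (∀ u ∈ X, m u ≠ u) → #X = 2 * n →
    ∃ a : Fin n → N, (∀ i, a i ∈ X) ∧ Function.Injective a ∧ ∀ i j, a i ≠ m (a j) := by
  induction n with
  | zero => intro X m _ _ _ _; exact ⟨fun i => i.elim0, fun i => i.elim0, fun i => i.elim0, fun i => i.elim0⟩
  | succ n ih =>
    intro X m h1 h2 h3 hX
    obtain ⟨u, hu⟩ : X.Nonempty := by rw [← card_pos]; omega
    have mem : ∀ w, w ∈ (X.erase u).erase (m u) ↔ w ≠ m u ∧ w ≠ u ∧ w ∈ X := by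
      intro w; simp only [mem_erase]
    have hc : #((X.erase u).erase (m u)) = 2 * n := by
      rw [card_erase_of_mem (mem_erase.2 ⟨h3 u hu, h1 u hu⟩), card_erase_of_mem hu]; omega
    obtain ⟨a, ha, hinj, hne⟩ := ih (X := (X.erase u).erase (m u)) (m := m) (by
      intro w hw
      rw [mem] at hw ⊢
      refine ⟨?_, ?_, h1 w hw.2.2⟩
      · intro h; apply hw.2.1; rw [← h2 w hw.2.2, h, h2 u hu]
      · intro h; apply hw.1; rw [← h2 w hw.2.2, h]) (fun w hw => h2 w ((mem w).1 hw).2.2)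
      (fun w hw => h3 w ((mem w).1 hw).2.2) hc
    refine ⟨Fin.cons u a, ?_, ?_, ?_⟩
    · intro i
      refine Fin.cases ?_ (fun i => ?_) i
      · simpa using hu
      · simpa using ((mem _).1 (ha i)).2.2
    · rw [Fin.cons_injective_iff]
      refine ⟨?_, hinj⟩
      rintro ⟨i, hi⟩
      exact ((mem _).1 (ha i)).2.1 hi
    · intro i j
      refine Fin.cases ?_ (fun i => ?_) i <;> refine Fin.cases ?_ (fun j => ?_) j
      · simpa using (h3 u hu).symm
      · simp only [Fin.cons_zero, Fin.cons_succ]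
        intro h
        have := (mem _).1 (ha j)
        apply this.1
        rw [h, h2 _ this.2.2]
      · simp only [Fin.cons_zero, Fin.cons_succ]
        exact ((mem _).1 (ha i)).1
      · simp only [Fin.cons_succ]
        exact hne i j

end
end PPI

namespace PPI
set_option linter.unusedSectionVars false
section
open Finset
open scoped Classical

variable {V : Type*} [Fintype V]

abbrev AN (G : SimpleGraph V) (T : Finset V) (c E : ℕ) : Type _ :=
  (G.Dart × Bool) ⊕ (({x // x ∈ T} × Fin c) ⊕ Fin E)

def auxAdj (G : SimpleGraph V) (T : Finset V) (c E : ℕ) : AN G T c E → AN G T c E → Prop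
  | .inl p, .inl p' => (p.1.fst = p'.1.fst ∧ p.2 ≠ p'.2) ∨ (p'.1 = p.1.symm ∧ p.2 = p'.2)
  | .inl p, .inr (.inl s) => p.2 = true ∧ p.1.fst = s.1.1
  | .inr (.inl s), .inl p => p.2 = true ∧ p.1.fst = s.1.1
  | .inr (.inl _), .inr (.inr _) => True
  | .inr (.inr _), .inr (.inl _) => True
  | _, _ => False

def auxG (G : SimpleGraph V) (T : Finset V) (c E : ℕ) : SimpleGraph (AN G T c E) where
  Adj := auxAdj G T c E
  symm := ⟨by
    rintro (⟨δ, i⟩ | s | e) (⟨δ', i'⟩ | s' | e') h <;> simp only [auxAdj] at h ⊢ <;> try exact h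
    rcases h with ⟨h1, h2⟩ | ⟨h1, h2⟩
    · exact Or.inl ⟨h1.symm, h2.symm⟩
    · exact Or.inr ⟨by rw [h1, Dart.symm_symm], h2.symm⟩⟩
  loopless := ⟨by
    rintro (⟨δ, i⟩ | s | e) h <;> simp only [auxAdj] at h
    rcases h with ⟨h1, h2⟩ | ⟨h1, h2⟩
    · exact h2 rfl
    · exact δ.symm_ne h1.symm⟩

lemma auxG_adj {G : SimpleGraph V} {T : Finset V} {c E : ℕ} {u w : AN G T c E} :
    (auxG G T c E).Adj u w ↔ auxAdj G T c E u w := Iff.rfl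

noncomputable def aLoc [Nonempty V] {G : SimpleGraph V} {T : Finset V} {c E : ℕ} : AN G T c E → V
  | .inl p => p.1.fst
  | .inr (.inl s) => s.1.1
  | .inr (.inr _) => Classical.arbitrary V

def aIdx {G : SimpleGraph V} {T : Finset V} {c E : ℕ} : AN G T c E → ZMod 2
  | .inl p => if p.2 then 1 else 0
  | .inr _ => 0

def aMate {G : SimpleGraph V} {T : Finset V} {c E : ℕ} : AN G T c E → AN G T c E
  | .inl p => .inl (p.1, !p.2)
  | .inr x => .inr x

noncomputable def aE {G : SimpleGraph V} {T : Finset V} {c E : ℕ} :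
    AN G T c E → AN G T c E → Finset (Sym2 V)
  | .inl p, .inl p' => if p'.1 = p.1.symm then {p.1.edge} else ∅
  | _, _ => ∅

def isX {G : SimpleGraph V} {T : Finset V} {c E : ℕ} : AN G T c E → Prop
  | .inr (.inr _) => True
  | _ => False

lemma nil_walk {G : SimpleGraph V} {x y : V} (h : x = y) (F : Finset (Sym2 V)) {z : ZMod 2}
    (hz : z = 0) : ∃ p : G.Walk x y, p.IsTrail ∧ (∀ e ∈ p.edges, e ∈ F) ∧ (p.length : ZMod 2) = z := by
  subst h
  exact ⟨Walk.nil, by simp, by simp, by simp [hz]⟩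

lemma edge_walk {G : SimpleGraph V} {x y : V} (h : G.Adj x y) (F : Finset (Sym2 V)) {z : ZMod 2}
    (hF : s(x, y) ∈ F) (hz : z = 1) :
    ∃ p : G.Walk x y, p.IsTrail ∧ (∀ e ∈ p.edges, e ∈ F) ∧ (p.length : ZMod 2) = z :=
  ⟨Walk.cons h Walk.nil, by simp, by simpa using hF, by simp [hz]⟩

lemma aux_walk [Nonempty V] {G : SimpleGraph V} {T : Finset V} {c E : ℕ} {u w : AN G T c E}
    (h : auxAdj G T c E u w) (hu : ¬ isX u) (hw : ¬ isX w) :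
    ∃ p : G.Walk (aLoc u) (aLoc w), p.IsTrail ∧ (∀ e ∈ p.edges, e ∈ aE u w) ∧
      (p.length : ZMod 2) = aIdx u + aIdx w + 1 := by
  rcases u with (⟨δ, i⟩ | s | e) <;> rcases w with (⟨δ', i'⟩ | s' | e') <;>
    simp only [auxAdj, isX, not_true_eq_false] at h hu hw
  · rcases h with ⟨h1, h2⟩ | ⟨h1, h2⟩
    · refine nil_walk h1 _ ?_
      simp only [aIdx]
      cases i <;> cases i' <;> simp at h2 ⊢ <;> decide
    · subst h1 h2
      refine edge_walk δ.adj _ ?_ ?_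
      · simp only [aE, if_true]
        exact mem_singleton_self _
      · simp only [aIdx]
        cases i <;> simp <;> decide
  · obtain ⟨h1, h2⟩ := h
    refine nil_walk h2 _ ?_
    simp only [aIdx, h1]
    decide
  · obtain ⟨h1, h2⟩ := h
    refine nil_walk h2.symm _ ?_
    simp only [aIdx, h1]
    decide

lemma aE_symm {G : SimpleGraph V} {T : Finset V} {c E : ℕ} (u w : AN G T c E) : aE u w = aE w u := by
  rcases u with (⟨δ, i⟩ | s | e) <;> rcases w with (⟨δ', i'⟩ | s' | e') <;> simp only [aE]
  by_cases h : δ' = δ.symm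
  · subst h; simp
  · rw [if_neg h, if_neg]
    rintro rfl
    simp at h

set_option maxHeartbeats 1000000 in
lemma aux_seg [Nonempty V] {G : SimpleGraph V} {T : Finset V} {c E : ℕ}
    (m : AN G T c E → AN G T c E)
    (hm : ∀ u, auxAdj G T c E u (m u)) (hmm : ∀ u, m (m u) = u) :
    ∃ X : Finset (AN G T c E), Seg G aLoc aIdx aMate X m (fun u => aE u (m u)) ∧
      (∀ u ∈ X, ¬ isX u) ∧ (∀ s, Sum.inr (Sum.inl s) ∈ X ↔ ¬ isX (m (Sum.inr (Sum.inl s)))) := by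
  let dr : AN G T c E → Prop
    | .inl p => m (.inl p) = .inl (p.1.symm, p.2) ∧ m (.inl (p.1, !p.2)) = .inl (p.1.symm, !p.2)
    | .inr (.inl s) => isX (m (.inr (.inl s)))
    | .inr (.inr _) => True
  have hdl : ∀ p, dr (.inl p) ↔ m (.inl p) = .inl (p.1.symm, p.2) ∧
    m (.inl (p.1, !p.2)) = .inl (p.1.symm, !p.2) := fun p => Iff.rfl
  have hds : ∀ s, dr (.inr (.inl s)) ↔ isX (m (.inr (.inl s))) := fun p => Iff.rfl
  have hde : ∀ e, dr (.inr (.inr e)) := fun _ => trivial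
  clear_value dr
  have hx : ∀ u, ¬ dr u → ¬ isX u := by
    rintro (p | s | e) h <;> simp only [isX, not_false_eq_true, not_true_eq_false]
    exact h (hde e)
  have hdm : ∀ u, ¬ dr u → ¬ dr (m u) := by
    intro u hu
    have ha := hm u
    have h1 := hmm u
    rcases u with (⟨δ, i⟩ | s | e)
    · cases hw : m (Sum.inl (δ, i)) with
      | inl p =>
        obtain ⟨δ', j⟩ := p
        rw [hdl]
        rintro ⟨h2, h3⟩
        rw [hw] at h1
        rw [h1] at h2
        simp only [Sum.inl.injEq, Prod.mk.injEq] at h2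
        obtain ⟨rfl, rfl⟩ := h2
        apply hu
        rw [hdl]
        refine ⟨by simpa using hw, ?_⟩
        have h4 := hmm (Sum.inl (δ', !i))
        simp only at h3
        rw [h3] at h4
        simpa using h4
      | inr x =>
        rcases x with s | e
        · rw [hds, ← hw, h1]; simp [isX]
        · rw [hw] at ha; exact ha.elim
    · rw [hds] at hu
      cases hw : m (Sum.inr (Sum.inl s)) with
      | inl p =>
        rw [hdl]
        rintro ⟨h2, -⟩
        rw [hw] at h1
        rw [h1] at h2
        cases h2
      | inr x =>
        rcases x with s | e
        · rw [hw] at ha; exact ha.elim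
        · rw [hw] at hu; exact (hu trivial).elim
    · exact (hu (hde e)).elim
  have mem : ∀ u, u ∈ univ.filter (fun u => ¬ dr u) ↔ ¬ dr u := fun u => by simp
  refine ⟨univ.filter (fun u => ¬ dr u), ⟨?_, ?_, ?_, ?_, ?_, ?_, ?_⟩, ?_, ?_⟩
  · intro u hu
    rw [mem] at hu ⊢
    exact hdm u hu
  · intro u _; exact hmm u
  · intro u _ h
    have : (auxG G T c E).Adj u (m u) := hm u
    exact this.ne h.symm
  · intro u hu
    rw [mem] at hu ⊢
    rcases u with (⟨δ, i⟩ | s)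
    · simp only [aMate]
      rw [hdl] at hu ⊢
      simp only [Bool.not_not] at hu ⊢
      tauto
    · exact hu
  · intro u hu
    rw [mem] at hu
    exact aux_walk (hm u) (hx u hu) (hx _ (hdm u hu))
  · intro u _
    simp only [hmm]
    exact aE_symm _ _
  · intro u hu w hw hwu hwm
    rw [mem] at hu hw
    rw [Finset.disjoint_left]
    intro e he he'
    have key : ∀ u e, e ∈ aE u (m u) → ∃ p : G.Dart × Bool, u = .inl p ∧
        m u = .inl (p.1.symm, p.2) ∧ e = p.1.edge := by
      intro u e he
      have ha := hm u
      generalize m u = w at he ha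
      rcases u with (⟨δ, i⟩ | s | x) <;> rcases w with (⟨δ', i'⟩ | s' | e') <;>
        simp only [aE, notMem_empty] at he
      refine ⟨(δ, i), rfl, ?_⟩
      split_ifs at he with h
      · rw [mem_singleton] at he
        rcases ha with ⟨h1, h2⟩ | ⟨h1, h2⟩
        · simp only at h1
          rw [h] at h1
          exact (δ.adj.ne h1).elim
        · simp only at h1 h2
          rw [h1, h2]
          exact ⟨rfl, he⟩
      · simp at he
    obtain ⟨p, rfl, h1, h2⟩ := key u e he
    obtain ⟨p', rfl, h3, h4⟩ := key w e he'
    obtain ⟨δ, i⟩ := p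
    obtain ⟨δ', j⟩ := p'
    simp only at h1 h2 h3 h4
    rw [h2, dart_edge_eq_iff] at h4
    apply hu
    rw [hdl]
    refine ⟨h1, ?_⟩
    simp only
    rcases h4 with rfl | rfl
    · have : j = !i := by
        cases i <;> cases j <;> simp at hwu ⊢
      rw [← this, h3]
    · have : j = !i := by
        rw [h1] at hwm
        cases i <;> cases j <;> simp at hwm ⊢
      rw [← this]
      have h5 := hmm (Sum.inl (δ', j))
      rw [h3] at h5
      simpa using h5
  · intro u hu; rw [mem] at hu; exact hx u hu
  · intro s
    rw [mem, hds]

lemma aux_good [Nonempty V] {G : SimpleGraph V} {T : Finset V} {c E n : ℕ} (hE : E + 2 * n = #T * c)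
    (m : AN G T c E → AN G T c E)
    (hm : ∀ u, auxAdj G T c E u (m u)) (hmm : ∀ u, m (m u) = u) :
    ∃ (a b : Fin n → V) (P : ∀ i, G.Walk (a i) (b i)), (∀ i, (P i).IsTrail) ∧
      (∀ i, Odd (P i).length) ∧ (∀ i j, i ≠ j → List.Disjoint (P i).edges (P j).edges) ∧
      (∀ i, a i ∈ T) ∧ (∀ i, b i ∈ T) ∧
      ∀ s, #(univ.filter (fun i => a i = s)) + #(univ.filter (fun i => b i = s)) ≤ c := by
  obtain ⟨X, hX, hX1, hX2⟩ := aux_seg m hm hmm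
  obtain ⟨m', E', h⟩ := hX.finish (by rintro (p | s | e) <;> rfl)
    (by rintro (⟨δ, i⟩ | s | e) <;> simp [aMate])
    (by rintro (⟨δ, i⟩ | s | e) h
        · cases i <;> simp [aMate, aIdx]
        · exact (h rfl).elim
        · exact (h rfl).elim) (#X) le_rfl
  obtain ⟨Y, hY, h⟩ : ∃ Y : Finset (AN G T c E), (∀ u, u ∈ Y ↔ u ∈ X ∧ aMate u = u) ∧
      Seg G aLoc aIdx aMate Y m' E' := ⟨_, fun u => by simp only [mem_filter], h⟩
  have memY : ∀ u, u ∈ Y ↔ ∃ s, u = Sum.inr (Sum.inl s) ∧ ¬ isX (m u) := by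
    intro u
    rw [hY]
    rcases u with (⟨δ, i⟩ | s | e)
    · simp [aMate]
    · rw [hX2]; simp [aMate]
    · constructor
      · rintro ⟨h1, -⟩; exact (hX1 _ h1 trivial).elim
      · rintro ⟨s, h1, -⟩; cases h1
  have cY : #Y = 2 * n := by
    have h1 : Y = (univ.image (fun s => (Sum.inr (Sum.inl s) : AN G T c E))) \
        (univ.image (fun e => m (Sum.inr (Sum.inr e)))) := by
      ext u
      rw [memY]
      simp only [mem_sdiff, mem_image, mem_univ, true_and]
      constructor
      · rintro ⟨s, rfl, h1⟩
        refine ⟨⟨s, rfl⟩, ?_⟩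
        rintro ⟨e, he⟩
        rw [← he, hmm] at h1
        exact h1 trivial
      · rintro ⟨⟨s, rfl⟩, h1⟩
        refine ⟨s, rfl, ?_⟩
        intro h2
        cases hw : m (Sum.inr (Sum.inl s)) with
        | inl p => rw [hw] at h2; exact h2
        | inr x =>
          rcases x with s | e
          · rw [hw] at h2; exact h2
          · exact h1 ⟨e, by rw [← hw, hmm]⟩
    have hinj : Function.Injective m := fun a b h => by rw [← hmm a, h, hmm]
    rw [h1, card_sdiff_of_subset, card_image_of_injective, card_image_of_injective]
    · simp only [card_univ, Fintype.card_prod, Fintype.card_coe, Fintype.card_fin]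
      omega
    · intro a b h; simpa using hinj h
    · intro a b h; simpa using h
    · intro u hu
      simp only [mem_image, mem_univ, true_and] at hu ⊢
      obtain ⟨e, rfl⟩ := hu
      have ha := hm (Sum.inr (Sum.inr e))
      cases hw : m (Sum.inr (Sum.inr e)) with
      | inl p => rw [hw] at ha; exact ha.elim
      | inr x =>
        rcases x with s | e
        · exact ⟨s, rfl⟩
        · rw [hw] at ha; exact ha.elim
  have hidx : ∀ u ∈ Y, aIdx u = 0 := by
    intro u hu
    obtain ⟨s, rfl, -⟩ := (memY u).1 hu
    rfl
  have hloc : ∀ u ∈ Y, ∃ k, ∃ hT : aLoc u ∈ T, u = Sum.inr (Sum.inl (⟨aLoc u, hT⟩, k)) := by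
    intro u hu
    obtain ⟨⟨⟨s, hs⟩, k⟩, rfl, -⟩ := (memY u).1 hu
    exact ⟨k, hs, rfl⟩
  obtain ⟨a, ha, hinj, hne⟩ := transversal n h.mX h.mm h.mne cY
  choose P hP1 hP2 hP3 using fun i => h.walk (a i) (ha i)
  refine ⟨fun i => aLoc (a i), fun i => aLoc (m' (a i)), P, hP1, ?_, ?_, ?_, ?_, ?_⟩
  · intro i
    have := hP3 i
    rw [hidx _ (ha i), hidx _ (h.mX _ (ha i))] at this
    rw [← ZMod.natCast_eq_one_iff_odd, this]
    decide
  · intro i j hij e he he'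
    refine Finset.disjoint_left.1 (h.disj (a i) (ha i) (a j) (ha j) (fun h => hij (hinj h).symm) (hne j i))
      (hP2 i e he) (hP2 j e he')
  · intro i; exact (hloc _ (ha i)).choose_spec.choose
  · intro i; exact (hloc _ (h.mX _ (ha i))).choose_spec.choose
  · intro s
    by_cases hs : s ∈ T
    · have h1 : (univ.filter (fun i => aLoc (a i) = s)).image a ∪
        (univ.filter (fun i => aLoc (m' (a i)) = s)).image (fun i => m' (a i)) ⊆
        univ.image (fun k => (Sum.inr (Sum.inl (⟨s, hs⟩, k)) : AN G T c E)) := by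
        have : ∀ u ∈ Y, aLoc u = s → u ∈
            univ.image (fun k => (Sum.inr (Sum.inl (⟨s, hs⟩, k)) : AN G T c E)) := by
          intro u hu hus
          obtain ⟨k, hT, hk⟩ := hloc u hu
          simp only [mem_image, mem_univ, true_and]
          refine ⟨k, ?_⟩
          rw [hk]
          simp only [hus]
        intro u hu
        rw [mem_union, mem_image, mem_image] at hu
        rcases hu with ⟨i, hi, rfl⟩ | ⟨i, hi, rfl⟩
        · exact this _ (ha i) (by simpa using hi)
        · exact this _ (h.mX _ (ha i)) (by simpa using hi)
      have h2 := (card_le_card h1).trans card_image_le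
      rw [card_union_of_disjoint, card_image_of_injective _ hinj, card_image_of_injective] at h2
      · simpa using h2
      · intro i j hij
        apply hinj
        simp only at hij
        rw [← h.mm _ (ha i), hij, h.mm _ (ha j)]
      · rw [Finset.disjoint_left]
        intro u hu hu'
        rw [mem_image] at hu hu'
        obtain ⟨i, -, rfl⟩ := hu
        obtain ⟨j, -, hj⟩ := hu'
        exact hne i j hj.symm
    · have h1 : univ.filter (fun i => aLoc (a i) = s) = ∅ := by
        apply filter_false_of_mem
        rintro i - rfl
        exact hs (hloc _ (ha i)).choose_spec.choose
      have h2 : univ.filter (fun i => aLoc (m' (a i)) = s) = ∅ := by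
        apply filter_false_of_mem
        rintro i - rfl
        exact hs (hloc _ (h.mX _ (ha i))).choose_spec.choose
      rw [h1, h2]
      simp

end
end PPI

namespace PPI
set_option linter.unusedSectionVars false
section
open Finset
open scoped Classical

variable {V : Type*} [Fintype V]

lemma ex_finset {α : Type*} [Fintype α] (P : α → Prop) : ∃ A : Finset α, ∀ x, x ∈ A ↔ P x :=
  ⟨univ.filter P, fun x => by simp⟩

def exn {G : SimpleGraph V} {T : Finset V} {c E : ℕ} (W : Finset (AN G T c E)) (u : AN G T c E) : Prop :=
  u ∉ W ∧ (aMate u = u ∨ aMate u ∈ W)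

def isT {G : SimpleGraph V} {T : Finset V} {c E : ℕ} : AN G T c E → Prop
  | .inr (.inl _) => True
  | _ => False

set_option maxHeartbeats 1000000 in
lemma aux_bad2 [Nonempty V] {G : SimpleGraph V} (hcut : CutOK G) {T : Finset V} {c E n : ℕ}
    (W : Finset (AN G T c E)) (κ : AN G T c E → AN G T c E)
    (hκ : ∀ u w, u ∉ W → w ∉ W → auxAdj G T c E u w → κ u = κ w)
    (X : Finset (AN G T c E)) (D2 : Finset G.Dart)
    (hD2 : ∀ δ, δ ∈ D2 ↔ ∀ i, Sum.inl (δ, i) ∈ W)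
    (uniq : ∀ u w, exn W u → exn W w → u ∉ X → w ∉ X → κ u = κ w → u = w)
    (hcard : #X + 2 * #(W.filter isT) + 2 * #D2 ≤ 2 * n) :
    ∃ (A B : Finset V) (F : Finset (Sym2 V)), Disjoint A B ∧ #F ≤ 6 * n ∧
      (∀ x ∈ A, ∀ y, G.Adj x y → y ∈ B ∨ s(x, y) ∈ F) ∧
      (∀ x ∈ B, ∀ y, G.Adj x y → y ∈ A ∨ s(x, y) ∈ F) ∧ #(T \ A) * (c - 1) ≤ 2 * n := by
  let fr : V → Prop := fun x => ∀ i, ∃ δ : G.Dart, δ.fst = x ∧ Sum.inl (δ, i) ∉ W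
  have hfr : ∀ x, fr x ↔ ∀ i, ∃ δ : G.Dart, δ.fst = x ∧ Sum.inl (δ, i) ∉ W := fun x => Iff.rfl
  clear_value fr
  have hl : ∀ x, ∃ l : Option (AN G T c E), fr x → ∀ (δ : G.Dart) i, δ.fst = x →
      Sum.inl (δ, i) ∉ W → some (κ (Sum.inl (δ, i))) = l := by
    intro x
    by_cases hx : fr x
    · have hx' := (hfr x).1 hx
      obtain ⟨δ1, h1, h1'⟩ := hx' true
      obtain ⟨δ0, h0, h0'⟩ := hx' false
      refine ⟨some (κ (Sum.inl (δ1, true))), fun _ δ i hδ hW => ?_⟩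
      congr 1
      cases i
      · exact hκ _ _ hW h1' (Or.inl ⟨hδ.trans h1.symm, by simp⟩)
      · rw [hκ _ _ hW h0' (Or.inl ⟨hδ.trans h0.symm, by simp⟩)]
        exact hκ _ _ h0' h1' (Or.inl ⟨h0.trans h1.symm, by simp⟩)
    · exact ⟨none, fun h => (hx h).elim⟩
  choose lam hlam using hl
  obtain ⟨A, hA⟩ : ∃ A : Finset V, ∀ x, x ∈ A ↔ ∀ δ : G.Dart, δ.fst = x → Sum.inl (δ, true) ∈ W :=
    ex_finset _
  obtain ⟨B, hB⟩ : ∃ B : Finset V, ∀ x, x ∈ B ↔ x ∉ A ∧ ∀ δ : G.Dart, δ.fst = x → Sum.inl (δ, false) ∈ W :=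
    ex_finset _
  have hAB : ∀ x, ¬ fr x → x ∈ A ∨ x ∈ B := by
    intro x hx
    by_cases h : x ∈ A
    · exact Or.inl h
    · refine Or.inr ((hB x).2 ⟨h, fun δ hδ => ?_⟩)
      by_contra hc
      refine hx ((hfr x).2 fun i => ?_)
      cases i
      · exact ⟨δ, hδ, hc⟩
      · rw [hA] at h
        push Not at h
        exact h
  have hAf : ∀ x, x ∈ A → ¬ fr x := by
    intro x hx h
    obtain ⟨δ, h1, h2⟩ := (hfr x).1 h true
    exact h2 ((hA x).1 hx δ h1)
  have hBf : ∀ x, x ∈ B → ¬ fr x := by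
    intro x hx h
    obtain ⟨δ, h1, h2⟩ := (hfr x).1 h false
    exact h2 (((hB x).1 hx).2 δ h1)
  obtain ⟨Z, hZ⟩ : ∃ Z : Finset (Sym2 V), Z = ((X.filter (fun u => u.isLeft)).image
      (fun u => Sum.elim (fun p => p.1.edge) (fun _ => s(Classical.arbitrary V, Classical.arbitrary V)) u))
      ∪ D2.image (fun δ => δ.edge) := ⟨_, rfl⟩
  have hZc : #Z ≤ 2 * n := by
    rw [hZ]
    refine (card_union_le _ _).trans ?_
    refine (Nat.add_le_add (card_image_le.trans (card_filter_le _ _)) card_image_le).trans ?_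
    omega
  have hZX : ∀ p : G.Dart × Bool, Sum.inl p ∈ X → p.1.edge ∈ Z := by
    intro p hp
    rw [hZ]
    exact mem_union_left _ (mem_image.2 ⟨Sum.inl p, mem_filter.2 ⟨hp, rfl⟩, rfl⟩)
  have hZD : ∀ δ : G.Dart, δ ∈ D2 → δ.edge ∈ Z := by
    intro p hp
    rw [hZ]
    exact mem_union_right _ (mem_image.2 ⟨p, hp, rfl⟩)
  clear hZ
  have hex : ∀ (δ : G.Dart) i, Sum.inl (δ, i) ∉ W → Sum.inl (δ, !i) ∈ W → exn W (Sum.inl (δ, i)) :=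
    fun δ i h1 h2 => ⟨h1, Or.inr h2⟩
  have L : ∀ δ : G.Dart, fr δ.snd → ¬ (fr δ.fst ∧ lam δ.fst = lam δ.snd) → δ.edge ∉ Z →
      ∃ p : G.Dart × Bool, p.1.edge = δ.edge ∧ exn W (Sum.inl p) ∧ Sum.inl p ∉ X ∧
        some (κ (Sum.inl p)) = lam δ.snd := by
    intro δ h1 h2 h3
    by_contra hno
    have hsymm : ∀ i, Sum.inl (δ.symm, i) ∉ W := by
      by_contra hc
      push Not at hc
      obtain ⟨i, hi⟩ := hc
      have hn : Sum.inl (δ.symm, !i) ∉ W := by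
        intro hn
        apply h3
        rw [← Dart.edge_symm]
        refine hZD _ ((hD2 _).2 fun j => ?_)
        rcases Bool.eq_or_eq_not j i with rfl | rfl
        · exact hi
        · exact hn
      refine hno ⟨(δ.symm, !i), Dart.edge_symm _, hex _ _ hn (by simpa using hi), fun hX => h3 ?_,
        hlam _ h1 _ _ rfl hn⟩
      rw [← Dart.edge_symm]
      exact hZX _ hX
    have hlab : ∀ i, Sum.inl (δ, i) ∉ W → some (κ (Sum.inl (δ, i))) = lam δ.snd := by
      intro i hi
      rw [hκ _ _ hi (hsymm i) (Or.inr ⟨rfl, rfl⟩)]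
      exact hlam _ h1 _ _ rfl (hsymm i)
    have hall : ∀ i, Sum.inl (δ, i) ∉ W := by
      by_contra hc
      push Not at hc
      obtain ⟨i, hi⟩ := hc
      have hn : Sum.inl (δ, !i) ∉ W := by
        intro hn
        refine h3 (hZD _ ((hD2 _).2 fun j => ?_))
        rcases Bool.eq_or_eq_not j i with rfl | rfl
        · exact hi
        · exact hn
      exact hno ⟨(δ, !i), rfl, hex _ _ hn (by simpa using hi), fun hX => h3 (hZX _ hX), hlab _ hn⟩
    have hf : fr δ.fst := (hfr _).2 fun i => ⟨δ, rfl, hall i⟩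
    exact h2 ⟨hf, by rw [← hlab true (hall true), hlam _ hf _ _ rfl (hall true)]⟩
  have hAA : ∀ (δ : G.Dart) i, Sum.inl (δ, i) ∈ W → Sum.inl (δ.symm, i) ∈ W → δ.edge ∈ Z := by
    intro δ i h1 h2
    by_contra h3
    have hn : Sum.inl (δ, !i) ∉ W := by
      intro hn
      refine h3 (hZD _ ((hD2 _).2 fun j => ?_))
      rcases Bool.eq_or_eq_not j i with rfl | rfl
      · exact h1
      · exact hn
    have hn' : Sum.inl (δ.symm, !i) ∉ W := by
      intro hn
      apply h3
      rw [← Dart.edge_symm]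
      refine hZD _ ((hD2 _).2 fun j => ?_)
      rcases Bool.eq_or_eq_not j i with rfl | rfl
      · exact h2
      · exact hn
    have := uniq _ _ (hex _ _ hn (by simpa using h1)) (hex _ _ hn' (by simpa using h2))
      (fun hX => h3 (hZX _ hX)) (fun hX => h3 (by rw [← Dart.edge_symm]; exact hZX _ hX))
      (hκ _ _ hn hn' (Or.inr ⟨rfl, rfl⟩))
    simp only [Sum.inl.injEq, Prod.mk.injEq] at this
    exact δ.symm_ne this.1.symm
  obtain ⟨F1, hF1⟩ : ∃ F1 : Finset (Sym2 V), ∀ e, e ∈ F1 ↔ e ∉ Z ∧ ∃ δ : G.Dart, δ.edge = e ∧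
      ¬ fr δ.fst ∧ fr δ.snd :=
    ex_finset _
  have key : ∀ e ∈ F1, ∃ (p : G.Dart × Bool) (δ : G.Dart), p.1.edge = e ∧ exn W (Sum.inl p) ∧
      Sum.inl p ∉ X ∧ some (κ (Sum.inl p)) = lam δ.fst ∧ δ.edge ∈ Z := by
    intro e he
    obtain ⟨heZ, δ, rfl, hf1, hf2⟩ := (hF1 e).1 he
    obtain ⟨p, hp1, hp2, hp3, hp4⟩ := L δ hf2 (fun h => hf1 h.1) heZ
    obtain ⟨Q, hQ⟩ : ∃ Q : Finset V, ∀ y, y ∈ Q ↔ fr y ∧ lam y = lam δ.snd :=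
      ex_finset _
    obtain ⟨x, hx, y, hy, hxy, hne⟩ := hcut Q ⟨δ.snd, (hQ _).2 ⟨hf2, rfl⟩⟩ (fun h => hf1
      ((hQ δ.fst).1 (h ▸ mem_univ _)).1) δ.edge
    have hx' := (hQ x).1 hx
    have hy' := fun h => hy ((hQ y).2 h)
    refine ⟨p, ⟨(x, y), hxy⟩, hp1, hp2, hp3, hp4.trans hx'.2.symm, ?_⟩
    by_contra hc
    obtain ⟨p', hp1', hp2', hp3', hp4'⟩ := L ⟨(y, x), hxy.symm⟩ hx'.1
      (fun h => hy' ⟨h.1, h.2.trans hx'.2⟩) (by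
        intro h
        apply hc
        have : (⟨(x, y), hxy⟩ : G.Dart).edge = (⟨(y, x), hxy.symm⟩ : G.Dart).edge := Sym2.eq_swap
        rw [this]; exact h)
    have hpp : p = p' := by
      have := uniq _ _ hp2 hp2' hp3 hp3' (Option.some_injective _
        (hp4.trans (hx'.2.symm.trans hp4'.symm)))
      exact Sum.inl_injective this
    apply hne
    rw [← hp1, hpp, hp1']
    exact Sym2.eq_swap
  have hF1c : #F1 ≤ 2 * #Z := by
    rcases F1.eq_empty_or_nonempty with h0 | ⟨e0, he0⟩
    · rw [h0]; simp
    haveI : Nonempty G.Dart := ⟨(key e0 he0).choose_spec.choose⟩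
    choose! p δ hk1 hk2 hk3 hk4 hk5 using key
    have hinj : Set.InjOn δ (F1 : Set (Sym2 V)) := by
      intro e he e' he' h
      have := uniq _ _ (hk2 e he) (hk2 e' he') (hk3 e he) (hk3 e' he') (Option.some_injective _
        ((hk4 e he).trans ((congrArg (fun d => lam d.fst) h).trans (hk4 e' he').symm)))
      rw [← hk1 e he, ← hk1 e' he', Sum.inl_injective this]
    rw [← card_image_of_injOn hinj]
    refine card_le_mul_card_image_of_maps_to (f := fun d : G.Dart => d.edge) (t := Z) ?_ 2 ?_
    · intro d hd
      obtain ⟨e, he, rfl⟩ := mem_image.1 hd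
      exact hk5 e he
    · intro z hz
      by_cases h0 : ∃ d0 : G.Dart, d0.edge = z
      · obtain ⟨d0, rfl⟩ := h0
        refine (card_le_card (t := {d0, d0.symm}) ?_).trans card_le_two
        intro d hd
        have := (mem_filter.1 hd).2
        rw [dart_edge_eq_iff] at this
        simpa using this
      · rw [filter_eq_empty_iff.2]
        · simp
        · intro d _ h
          exact h0 ⟨d, h⟩
  refine ⟨A, B, Z ∪ F1, ?_, ?_, ?_, ?_, ?_⟩
  · rw [Finset.disjoint_left]
    intro x hx hx'
    exact ((hB x).1 hx').1 hx
  · have := card_union_le Z F1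
    omega
  · intro x hx y hxy
    by_contra hc
    push Not at hc
    obtain ⟨hc1, hc2⟩ := hc
    rw [mem_union, not_or] at hc2
    by_cases hfy : fr y
    · exact hc2.2 ((hF1 _).2 ⟨hc2.1, ⟨(x, y), hxy⟩, rfl, hAf x hx, hfy⟩)
    · rcases hAB y hfy with h | h
      · exact hc2.1 (hAA ⟨(x, y), hxy⟩ true ((hA x).1 hx _ rfl) ((hA y).1 h _ rfl))
      · exact hc1 h
  · intro x hx y hxy
    by_contra hc
    push Not at hc
    obtain ⟨hc1, hc2⟩ := hc
    rw [mem_union, not_or] at hc2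
    by_cases hfy : fr y
    · exact hc2.2 ((hF1 _).2 ⟨hc2.1, ⟨(x, y), hxy⟩, rfl, hBf x hx, hfy⟩)
    · rcases hAB y hfy with h | h
      · exact hc1 h
      · exact hc2.1 (hAA ⟨(x, y), hxy⟩ false (((hB x).1 hx).2 _ rfl) (((hB y).1 h).2 _ rfl))
  ·
    have h1 : ∀ s ∈ (T \ A).attach, ∃ bad : Fin c → Prop, (∀ k k', ¬ bad k → ¬ bad k' → k = k') ∧
        ∀ k, bad k → Sum.inr (Sum.inl (⟨s.1, (mem_sdiff.1 s.2).1⟩, k)) ∈ X ∪ W.filter isT := by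
      intro s _
      obtain ⟨δ, hδ, hδW⟩ : ∃ δ : G.Dart, δ.fst = s.1 ∧ Sum.inl (δ, true) ∉ W := by
        have := (mem_sdiff.1 s.2).2
        rw [hA] at this
        push Not at this
        exact this
      refine ⟨fun k => Sum.inr (Sum.inl (⟨s.1, (mem_sdiff.1 s.2).1⟩, k)) ∈ X ∪ W.filter isT, ?_,
        fun k h => h⟩
      intro k k' hk hk'
      have hh : ∀ k, Sum.inr (Sum.inl (⟨s.1, (mem_sdiff.1 s.2).1⟩, k)) ∉ X ∪ W.filter isT →
          Sum.inr (Sum.inl (⟨s.1, (mem_sdiff.1 s.2).1⟩, k)) ∉ X ∧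
          Sum.inr (Sum.inl (⟨s.1, (mem_sdiff.1 s.2).1⟩, k)) ∉ W := by
        intro k hk
        rw [mem_union, not_or] at hk
        exact ⟨hk.1, fun h => hk.2 (mem_filter.2 ⟨h, trivial⟩)⟩
      have e1 := hh k hk
      have e2 := hh k' hk'
      have := uniq _ _ ⟨e1.2, Or.inl rfl⟩ ⟨e2.2, Or.inl rfl⟩ e1.1 e2.1
        ((hκ _ _ e1.2 hδW ⟨rfl, hδ⟩).trans (hκ _ _ e2.2 hδW ⟨rfl, hδ⟩).symm)
      simpa using this
    have h2 : #(T \ A) * (c - 1) ≤ #(X ∪ W.filter isT) := by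
      let Y : Finset (AN G T c E) := (T \ A).attach.biUnion (fun s =>
        (univ.image (fun k => Sum.inr (Sum.inl (⟨s.1, (mem_sdiff.1 s.2).1⟩, k)))) ∩ (X ∪ W.filter isT))
      have hY : Y ⊆ X ∪ W.filter isT := by
        intro y hy
        obtain ⟨s, _, hs⟩ := mem_biUnion.1 hy
        exact (mem_inter.1 hs).2
      refine le_trans ?_ (card_le_card hY)
      rw [card_biUnion]
      · rw [← card_attach (s := T \ A), ← smul_eq_mul]
        refine card_nsmul_le_sum _ _ _ ?_
        intro s hs
        obtain ⟨bad, hb1, hb2⟩ := h1 s hs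
        have h3 : c - 1 ≤ #(univ.filter bad) := by
          have h4 : #(univ.filter (fun k => ¬ bad k)) ≤ 1 := by
            rw [card_le_one]
            intro a ha b hb
            exact hb1 a b (mem_filter.1 ha).2 (mem_filter.1 hb).2
          have h5 := card_filter_add_card_filter_not (s := (univ : Finset (Fin c))) bad
          rw [card_univ, Fintype.card_fin] at h5
          omega
        refine h3.trans ?_
        refine card_le_card_of_injOn (fun k => Sum.inr (Sum.inl (⟨s.1, (mem_sdiff.1 s.2).1⟩, k))) ?_ ?_
        · intro k hk
          exact mem_inter.2 ⟨mem_image_of_mem _ (mem_univ _), hb2 k (mem_filter.1 hk).2⟩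
        · intro k _ k' _ h
          simpa using h
      · intro s _ s' _ hne
        rw [Function.onFun, Finset.disjoint_left]
        intro u hu hu'
        obtain ⟨k, _, rfl⟩ := mem_image.1 (mem_inter.1 hu).1
        obtain ⟨k', _, h⟩ := mem_image.1 (mem_inter.1 hu').1
        simp only [Sum.inr.injEq, Sum.inl.injEq, Prod.mk.injEq, Subtype.mk.injEq] at h
        exact hne (Subtype.ext h.1.symm)
    have h3 := card_union_le X (W.filter isT)
    have : #(T \ A) * (c - 1) ≤ #X + #(W.filter isT) := h2.trans h3
    omega

end
end PPI

namespace PPI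
set_option linter.unusedSectionVars false
section
open Finset
open scoped Classical

variable {V : Type*} [Fintype V]

lemma even_of_involution {α : Type*} (S : Finset α) (f : α → α) (h1 : ∀ a ∈ S, f a ≠ a)
    (h2 : ∀ a ∈ S, f a ∈ S) (h3 : ∀ a ∈ S, f (f a) = a) : Even #S := by
  have h : ∑ _a ∈ S, (1 : ZMod 2) = 0 :=
    sum_involution (fun a _ => f a) (fun a _ => by decide) (fun a ha _ => h1 a ha)
      (fun a ha => h2 a ha) (fun a ha => h3 a ha)
  rw [sum_const, nsmul_eq_mul, mul_one] at h
  exact (ZMod.natCast_eq_zero_iff_even).1 h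

lemma aMate_aMate {G : SimpleGraph V} {T : Finset V} {c E : ℕ} (u : AN G T c E) :
    aMate (aMate u) = u := by
  rcases u with (⟨δ, i⟩ | s)
  · simp [aMate]
  · rfl

lemma aMate_adj {G : SimpleGraph V} {T : Finset V} {c E : ℕ} (u : AN G T c E) (h : aMate u ≠ u) :
    auxAdj G T c E u (aMate u) := by
  rcases u with (⟨δ, i⟩ | s)
  · exact Or.inl ⟨rfl, by simp⟩
  · exact (h rfl).elim

lemma aMate_isLeft {G : SimpleGraph V} {T : Finset V} {c E : ℕ} (u : AN G T c E) :
    (aMate u).isLeft = u.isLeft := by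
  rcases u with (⟨δ, i⟩ | s) <;> rfl

lemma aMate_ne {G : SimpleGraph V} {T : Finset V} {c E : ℕ} (u : AN G T c E) (h : u.isLeft) :
    aMate u ≠ u := by
  rcases u with (⟨δ, i⟩ | s)
  · simp [aMate]
  · simp at h

set_option maxHeartbeats 1000000 in
lemma aux_bad1 [Nonempty V] {G : SimpleGraph V} (hcut : CutOK G) {T : Finset V} {c E n : ℕ}
    (hE : E + 2 * n = #T * c)
    (W : Finset (AN G T c E)) (κ : AN G T c E → AN G T c E) (O : Finset (AN G T c E))
    (hO : #W + 2 ≤ #O)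
    (hκ : ∀ u w, u ∉ W → w ∉ W → auxAdj G T c E u w → κ u = κ w)
    (hodd : ∀ o ∈ O, Odd #(univ.filter (fun u => u ∉ W ∧ κ u = o))) :
    ∃ (A B : Finset V) (F : Finset (Sym2 V)), Disjoint A B ∧ #F ≤ 6 * n ∧
      (∀ x ∈ A, ∀ y, G.Adj x y → y ∈ B ∨ s(x, y) ∈ F) ∧
      (∀ x ∈ B, ∀ y, G.Adj x y → y ∈ A ∨ s(x, y) ∈ F) ∧ #(T \ A) * (c - 1) ≤ 2 * n := by
  have hrep : ∀ o ∈ O, ∃ u, exn W u ∧ κ u = o := by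
    intro o ho
    by_contra hno
    push Not at hno
    have hS : ∀ u ∈ univ.filter (fun u => u ∉ W ∧ κ u = o), u ∉ W ∧ κ u = o ∧ aMate u ≠ u ∧ aMate u ∉ W := by
      intro u hu
      obtain ⟨h1, h2⟩ := (mem_filter.1 hu).2
      refine ⟨h1, h2, fun h => hno u ⟨h1, Or.inl h⟩ h2, fun h => hno u ⟨h1, Or.inr h⟩ h2⟩
    have := even_of_involution _ aMate (fun a ha => (hS a ha).2.2.1) (fun a ha => by
      obtain ⟨h1, h2, h3, h4⟩ := hS a ha
      refine mem_filter.2 ⟨mem_univ _, h4, ?_⟩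
      rw [← h2]
      exact (hκ _ _ h1 h4 (aMate_adj _ h3)).symm) (fun a _ => aMate_aMate a)
    exact (Nat.not_even_iff_odd.2 (hodd o ho)) this
  choose! rep hr1 hr2 using hrep
  have hrinj : Set.InjOn rep (O : Set (AN G T c E)) := by
    intro a ha b hb h
    rw [← hr2 a ha, ← hr2 b hb, h]
  obtain ⟨Ex, hEx⟩ := ex_finset (fun u => exn W u)
  have hR : #(O.image rep) = #O := card_image_of_injOn hrinj
  have hRE : O.image rep ⊆ Ex := by
    intro u hu
    obtain ⟨o, ho, rfl⟩ := mem_image.1 hu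
    exact (hEx _).2 (hr1 o ho)
  obtain ⟨D2, hD2⟩ := ex_finset (fun δ : G.Dart => ∀ i, (Sum.inl (δ, i) : AN G T c E) ∈ W)
  obtain ⟨WD1, hWD1⟩ := ex_finset (fun u : AN G T c E => u ∈ W ∧ u.isLeft ∧ aMate u ∉ W)
  obtain ⟨WD2, hWD2⟩ := ex_finset (fun u : AN G T c E => u ∈ W ∧ u.isLeft ∧ aMate u ∈ W)
  obtain ⟨TT, hTT⟩ := ex_finset (fun u : AN G T c E => isT u)
  obtain ⟨XX, hXX⟩ := ex_finset (fun u : AN G T c E => isX u)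
  have cTT : #TT = #T * c := by
    have : TT = (univ : Finset ({x // x ∈ T} × Fin c)).image (fun s => Sum.inr (Sum.inl s)) := by
      ext u
      rw [hTT]
      rcases u with (⟨δ, i⟩ | s | e) <;> simp [isT]
    rw [this, card_image_of_injective _ (fun a b h => by simpa using h), card_univ]
    simp
  have cXX : #XX = E := by
    have : XX = (univ : Finset (Fin E)).image (fun s => Sum.inr (Sum.inr s)) := by
      ext u
      rw [hXX]
      rcases u with (⟨δ, i⟩ | s | e) <;> simp [isX]
    rw [this, card_image_of_injective _ (fun a b h => by simpa using h), card_univ]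
    simp
  have cD2 : #WD2 = 2 * #D2 := by
    have : WD2 = (D2 ×ˢ (univ : Finset Bool)).image (fun s => Sum.inl s) := by
      ext u
      rw [hWD2]
      rcases u with (⟨δ, i⟩ | s)
      · simp only [mem_image, mem_product, mem_univ, and_true, hD2, Sum.inl.injEq, exists_eq_right, aMate,
          Sum.isLeft_inl, true_and]
        constructor
        · rintro ⟨h1, h2⟩ j
          rcases Bool.eq_or_eq_not j i with rfl | rfl
          · exact h1
          · exact h2
        · intro h
          exact ⟨h _, h _⟩
      · simp
    rw [this, card_image_of_injective _ (fun a b h => by simpa using h), card_product]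
    simp [mul_comm]
  have cExD : #(Ex.filter (fun u => u.isLeft)) = #WD1 := by
    refine card_bij (fun u _ => aMate u) ?_ ?_ ?_
    · intro u hu
      obtain ⟨h1, h2⟩ := mem_filter.1 hu
      obtain ⟨h3, h4⟩ := (hEx u).1 h1
      refine (hWD1 _).2 ⟨h4.resolve_left (aMate_ne u h2), by rw [aMate_isLeft]; exact h2, ?_⟩
      rw [aMate_aMate]; exact h3
    · intro u _ w _ h
      rw [← aMate_aMate u, h, aMate_aMate]
    · intro u hu
      obtain ⟨h1, h2, h3⟩ := (hWD1 u).1 hu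
      refine ⟨aMate u, mem_filter.2 ⟨(hEx _).2 ⟨h3, Or.inr ?_⟩, by rw [aMate_isLeft]; exact h2⟩, aMate_aMate u⟩
      rw [aMate_aMate]; exact h1
  have cEx : #Ex = #(Ex.filter (fun u => u.isLeft)) + #(TT \ W) + #(XX \ W) := by
    have : Ex = (Ex.filter (fun u => u.isLeft)) ∪ (TT \ W) ∪ (XX \ W) := by
      ext u
      simp only [mem_union, mem_filter, mem_sdiff, hEx, hTT, hXX]
      rcases u with (⟨δ, i⟩ | s | e) <;> simp [isT, isX, exn, aMate]
    conv_lhs => rw [this]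
    rw [card_union_of_disjoint, card_union_of_disjoint]
    · rw [Finset.disjoint_left]
      intro u
      simp only [mem_filter, mem_sdiff, hTT]
      rcases u with (⟨δ, i⟩ | s | e) <;> simp [isT]
    · rw [Finset.disjoint_left]
      intro u
      simp only [mem_union, mem_filter, mem_sdiff, hTT, hXX]
      rcases u with (⟨δ, i⟩ | s | e) <;> simp [isT, isX]
  have cW : #W = #WD1 + #WD2 + #(TT ∩ W) + #(XX ∩ W) := by
    have : W = WD1 ∪ WD2 ∪ (TT ∩ W) ∪ (XX ∩ W) := by
      ext u
      simp only [mem_union, mem_inter, hWD1, hWD2, hTT, hXX]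
      rcases u with (⟨δ, i⟩ | s | e) <;> simp [isT, isX]
      by_cases h : aMate (Sum.inl (δ, i) : AN G T c E) ∈ W <;> simp [h]
    conv_lhs => rw [this]
    rw [card_union_of_disjoint, card_union_of_disjoint, card_union_of_disjoint]
    · rw [Finset.disjoint_left]
      intro u h h'
      exact ((hWD1 u).1 h).2.2 ((hWD2 u).1 h').2.2
    · rw [Finset.disjoint_left]
      intro u
      simp only [mem_union, mem_inter, hTT, hWD1, hWD2]
      rcases u with (⟨δ, i⟩ | s | e) <;> simp [isT]
    · rw [Finset.disjoint_left]
      intro u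
      simp only [mem_union, mem_inter, hTT, hXX, hWD1, hWD2]
      rcases u with (⟨δ, i⟩ | s | e) <;> simp [isT, isX]
  have hTW := card_sdiff_add_card_inter TT W
  have hXW := card_sdiff_add_card_inter XX W
  have hREc := card_le_card hRE
  have hX0 : XX \ W = ∅ := by
    by_contra hne
    obtain ⟨e, he⟩ := nonempty_iff_ne_empty.2 hne
    obtain ⟨he1, he2⟩ := mem_sdiff.1 he
    by_cases hT0 : TT \ W = ∅
    · rw [hT0, card_empty] at hTW cEx
      omega
    · obtain ⟨s, hs⟩ := nonempty_iff_ne_empty.2 hT0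
      obtain ⟨hs1, hs2⟩ := mem_sdiff.1 hs
      have hadj : ∀ s e : AN G T c E, isT s → isX e → auxAdj G T c E s e := by
        rintro (⟨δ, i⟩ | s | e) (⟨δ', i'⟩ | s' | e') h1 h2 <;> simp [isT, isX, auxAdj] at h1 h2 ⊢
      have hlab : ∀ u, u ∉ W → u.isLeft = false → κ u = κ s := by
        intro u huW hu
        rcases u with (⟨δ, i⟩ | s' | e')
        · simp at hu
        · rw [hκ _ _ huW he2 (hadj _ _ trivial ((hXX _).1 he1)),
            hκ _ _ hs2 he2 (hadj _ _ ((hTT _).1 hs1) ((hXX _).1 he1))]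
        · rw [hκ _ _ hs2 huW (hadj _ _ ((hTT _).1 hs1) trivial)]
      have h1 : #((O.image rep).filter (fun u => ¬ u.isLeft)) ≤ 1 := by
        rw [card_le_one]
        intro a ha b hb
        obtain ⟨ha1, ha2⟩ := mem_filter.1 ha
        obtain ⟨hb1, hb2⟩ := mem_filter.1 hb
        obtain ⟨o, ho, rfl⟩ := mem_image.1 ha1
        obtain ⟨o', ho', rfl⟩ := mem_image.1 hb1
        have e1 := hlab _ (hr1 o ho).1 (by simpa using ha2)
        have e2 := hlab _ (hr1 o' ho').1 (by simpa using hb2)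
        rw [hr2 o ho] at e1
        rw [hr2 o' ho'] at e2
        rw [e1, e2]
      have h2 : #((O.image rep).filter (fun u => u.isLeft)) ≤ #(Ex.filter (fun u => u.isLeft)) :=
        card_le_card (filter_subset_filter _ hRE)
      have h3 := card_filter_add_card_filter_not (s := O.image rep) (fun u => u.isLeft)
      omega
  rw [hX0, card_empty] at hXW cEx
  have cX : #(Ex \ O.image rep) + #O = #Ex := by
    rw [← hR]
    exact card_sdiff_add_card_eq_card hRE
  have hwt : W.filter isT = TT ∩ W := by
    ext u
    rw [mem_filter, mem_inter, hTT, and_comm]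
  refine aux_bad2 hcut W κ hκ (Ex \ O.image rep) D2 hD2 ?_ ?_
  · intro u w hu hw huX hwX h
    have hh : ∀ u, exn W u → u ∉ Ex \ O.image rep → u = rep (κ u) := by
      intro u hu huX
      have : u ∈ O.image rep := by
        by_contra hc
        exact huX (mem_sdiff.2 ⟨(hEx u).2 hu, hc⟩)
      obtain ⟨o, ho, rfl⟩ := mem_image.1 this
      rw [hr2 o ho]
    rw [hh u hu huX, hh w hw hwX, h]
  · rw [hwt]
    omega

theorem odd_trails [Nonempty V] {G : SimpleGraph V} (hcut : CutOK G) (T : Finset V) (c n : ℕ)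
    (hn : 2 * n ≤ #T * c) :
    (∃ (a b : Fin n → V) (P : ∀ i, G.Walk (a i) (b i)), (∀ i, (P i).IsTrail) ∧
      (∀ i, Odd (P i).length) ∧ (∀ i j, i ≠ j → List.Disjoint (P i).edges (P j).edges) ∧
      (∀ i, a i ∈ T) ∧ (∀ i, b i ∈ T) ∧
      ∀ s, #(univ.filter (fun i => a i = s)) + #(univ.filter (fun i => b i = s)) ≤ c) ∨
    ∃ (A B : Finset V) (F : Finset (Sym2 V)), Disjoint A B ∧ #F ≤ 6 * n ∧
      (∀ x ∈ A, ∀ y, G.Adj x y → y ∈ B ∨ s(x, y) ∈ F) ∧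
      (∀ x ∈ B, ∀ y, G.Adj x y → y ∈ A ∨ s(x, y) ∈ F) ∧ #(T \ A) * (c - 1) ≤ 2 * n := by
  obtain ⟨E, hE⟩ : ∃ E, E + 2 * n = #T * c := ⟨#T * c - 2 * n, by omega⟩
  have hev : Even (Fintype.card (AN G T c E)) := by
    simp only [Fintype.card_sum, Fintype.card_prod, Fintype.card_bool, Fintype.card_coe, Fintype.card_fin]
    rw [← hE]
    exact ⟨Fintype.card G.Dart + E + n, by ring⟩
  rcases tutte_labels (auxG G T c E) hev with ⟨m, hm, hmm⟩ | ⟨W, κ, O, hO, hκ, hodd⟩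
  · exact Or.inl (aux_good hE m hm hmm)
  · exact Or.inr (aux_bad1 hcut hE W κ O hO hκ (fun o ho => by convert hodd o ho))

end
end PPI

namespace PPI
set_option linter.unusedSectionVars false
section
open Finset
open scoped Classical

variable {V : Type*} [Fintype V]

lemma imm_of {G : SimpleGraph V} {t : ℕ} {σ : Sym2 (Fin t) → ZMod 2} (r : Fin t ↪ V)
    (R : Fin t × Fin t → Finset (Sym2 V)) (hR : ∀ k k', k ≠ k' → Disjoint (R k) (R k'))
    (h : ∀ i j, i < j → ∃ p : G.Walk (r i) (r j), p.IsTrail ∧ (∀ e ∈ p.edges, e ∈ R (i, j)) ∧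
      (p.length : ZMod 2) = σ s(i, j)) : HasParityPatternImmersion G t σ := by
  choose p hp1 hp2 hp3 using h
  let tr : ∀ ⦃u v : Fin t⦄, (⊤ : SimpleGraph (Fin t)).Adj u v → G.Walk (r u) (r v) := fun u v huv =>
    if h : u < v then p u v h else (p v u (lt_of_le_of_ne (not_lt.1 h) huv.symm)).reverse
  have htr1 : ∀ u v (huv : (⊤ : SimpleGraph (Fin t)).Adj u v) (h : u < v), tr huv = p u v h := by
    intro u v huv h
    simp only [tr, dif_pos h]
  have htr2 : ∀ u v (huv : (⊤ : SimpleGraph (Fin t)).Adj u v) (h : v < u),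
      tr huv = (p v u h).reverse := by
    intro u v huv h
    simp only [tr, dif_neg (not_lt.2 h.le)]
  clear_value tr
  have hed : ∀ u v (huv : (⊤ : SimpleGraph (Fin t)).Adj u v), ∃ i j, s(u, v) = s(i, j) ∧
      ∀ e ∈ (tr huv).edges, e ∈ R (i, j) := by
    intro u v huv
    rcases lt_or_gt_of_ne huv.ne with h | h
    · refine ⟨u, v, rfl, ?_⟩
      rw [htr1 u v huv h]
      exact hp2 u v h
    · refine ⟨v, u, Sym2.eq_swap, ?_⟩
      rw [htr2 u v huv h]
      intro e he
      rw [Walk.edges_reverse, List.mem_reverse] at he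
      exact hp2 v u h e he
  refine ⟨⟨r, tr, ?_, ?_, ?_⟩, ?_⟩
  · intro u v huv
    rcases lt_or_gt_of_ne huv.ne with h | h
    · rw [htr1 u v huv h]
      exact hp1 u v h
    · rw [htr2 u v huv h]
      exact (hp1 v u h).reverse
  · intro u v huv
    rcases lt_or_gt_of_ne huv.ne with h | h
    · rw [htr1 u v huv h, htr2 v u huv.symm h]
    · rw [htr2 u v huv h, htr1 v u huv.symm h, Walk.reverse_reverse]
  · intro u v a b h1 h2 hne e he he'
    obtain ⟨i, j, hij, hi⟩ := hed u v h1
    obtain ⟨i', j', hij', hi'⟩ := hed a b h2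
    have : (i, j) ≠ (i', j') := by
      intro h
      apply hne
      rw [hij, hij', (Prod.mk.inj h).1, (Prod.mk.inj h).2]
    exact Finset.disjoint_left.1 (hR _ _ this) (hi e he) (hi' e he')
  · intro u v huv
    show ((tr huv).length : ZMod 2) = _
    rcases lt_or_gt_of_ne huv.ne with h | h
    · rw [htr1 u v huv h]
      exact hp3 u v h
    · rw [htr2 u v huv h, Walk.length_reverse, hp3 v u h, Sym2.eq_swap]

lemma greedy {ι : Type*} [Fintype ι] (H : SimpleGraph V) (M : Finset V) (x y : ι → V) (Δ : ℕ)
    (hΔ : ∀ s, #(univ.filter (fun i => x i = s)) + #(univ.filter (fun i => y i = s)) ≤ Δ)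
    (hco : ∀ i, x i ≠ y i → 2 * Δ < #(M.filter (fun m => H.Adj (x i) m ∧ H.Adj (y i) m))) :
    ∃ m : ι → V, (∀ i, x i ≠ y i → m i ∈ M ∧ H.Adj (x i) (m i) ∧ H.Adj (y i) (m i)) ∧
      ∀ i j, i ≠ j → x i ≠ y i → x j ≠ y j → m i = m j →
        x i ≠ x j ∧ x i ≠ y j ∧ y i ≠ x j ∧ y i ≠ y j := by
  suffices hs : ∀ J : Finset ι, ∃ m : ι → V,
      (∀ i ∈ J, x i ≠ y i → m i ∈ M ∧ H.Adj (x i) (m i) ∧ H.Adj (y i) (m i)) ∧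
      ∀ i ∈ J, ∀ j ∈ J, i ≠ j → x i ≠ y i → x j ≠ y j → m i = m j →
        x i ≠ x j ∧ x i ≠ y j ∧ y i ≠ x j ∧ y i ≠ y j by
    obtain ⟨m, h1, h2⟩ := hs univ
    exact ⟨m, fun i => h1 i (mem_univ _), fun i j => h2 i (mem_univ _) j (mem_univ _)⟩
  intro J
  induction J using Finset.induction_on with
  | empty => exact ⟨x, by simp, by simp⟩
  | insert i J hi ih =>
    obtain ⟨m, h1, h2⟩ := ih
    by_cases hxy : x i = y i
    · refine ⟨m, ?_, ?_⟩
      · intro j hj hne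
        rcases mem_insert.1 hj with rfl | hj
        · exact (hne hxy).elim
        · exact h1 j hj hne
      · intro j hj k hk hjk hj' hk'
        rcases mem_insert.1 hj with rfl | hj
        · exact (hj' hxy).elim
        rcases mem_insert.1 hk with rfl | hk
        · exact (hk' hxy).elim
        exact h2 j hj k hk hjk hj' hk'
    · obtain ⟨C, hC⟩ := Classical.skolem (p := fun (_ : Unit) (C : Finset ι) =>
        ∀ j, j ∈ C ↔ x i = x j ∨ x i = y j ∨ y i = x j ∨ y i = y j) |>.1 (fun _ => ex_finset _)
      have hCc : #(C ()) ≤ 2 * Δ := by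
        have hsub : C () ⊆ ((univ.filter (fun j => x j = x i)) ∪ (univ.filter (fun j => y j = x i))) ∪
            ((univ.filter (fun j => x j = y i)) ∪ (univ.filter (fun j => y j = y i))) := by
          intro j hj
          simp only [mem_union, mem_filter, mem_univ, true_and]
          rcases (hC () j).1 hj with h | h | h | h
          · exact Or.inl (Or.inl h.symm)
          · exact Or.inl (Or.inr h.symm)
          · exact Or.inr (Or.inl h.symm)
          · exact Or.inr (Or.inr h.symm)
        have h3 := (card_le_card hsub).trans ((card_union_le _ _).trans
          (Nat.add_le_add (card_union_le _ _) (card_union_le _ _)))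
        have h4 := hΔ (x i)
        have h5 := hΔ (y i)
        omega
      have hlt : #((C ()).image m) < #(M.filter (fun m => H.Adj (x i) m ∧ H.Adj (y i) m)) :=
        lt_of_le_of_lt (card_image_le.trans hCc) (hco i hxy)
      obtain ⟨w, hw, hw'⟩ := exists_mem_notMem_of_card_lt_card hlt
      rw [mem_filter] at hw
      have hnj : ∀ j ∈ J, j ≠ i := fun j hj h => hi (h ▸ hj)
      refine ⟨Function.update m i w, ?_, ?_⟩
      · intro j hj hne
        rcases mem_insert.1 hj with rfl | hj
        · rw [Function.update_self]; exact hw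
        · rw [Function.update_of_ne (hnj j hj)]; exact h1 j hj hne
      · intro j hj k hk hjk hj' hk' hm
        have hfin : ∀ k ∈ J, w = m k → ¬ (x i = x k ∨ x i = y k ∨ y i = x k ∨ y i = y k) := by
          intro k _ hwk hc
          exact hw' (mem_image.2 ⟨k, (hC () k).2 hc, hwk.symm⟩)
        rcases mem_insert.1 hj with rfl | hj2
        · rcases mem_insert.1 hk with rfl | hk
          · exact (hjk rfl).elim
          · rw [Function.update_self, Function.update_of_ne (hnj k hk)] at hm
            have := hfin k hk hm
            push Not at this
            exact this
        · rcases mem_insert.1 hk with rfl | hk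
          · rw [Function.update_self, Function.update_of_ne (hnj j hj2)] at hm
            have := hfin j hj2 hm.symm
            push Not at this
            exact ⟨this.1.symm, this.2.2.1.symm, this.2.1.symm, this.2.2.2.symm⟩
          · rw [Function.update_of_ne (hnj j hj2), Function.update_of_ne (hnj k hk)] at hm
            exact h2 j hj2 k hk hjk hj' hk' hm

set_option maxHeartbeats 1000000 in
lemma links {ι : Type*} [Fintype ι] {G : SimpleGraph V} (H : SimpleGraph V) (T M : Finset V)
    (hTM : Disjoint T M)
    (τ : Sym2 V → Finset (Sym2 V)) (g : V → ZMod 2) (N : Finset (Sym2 V))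
    (hw : ∀ s ∈ T, ∀ m ∈ M, H.Adj s m → ∃ p : G.Walk s m, p.IsTrail ∧ (∀ e ∈ p.edges, e ∈ τ s(s, m)) ∧
      (p.length : ZMod 2) = g m)
    (hτ : ∀ e ∈ H.edgeSet, ∀ e' ∈ H.edgeSet, e ≠ e' → Disjoint (τ e) (τ e'))
    (hN : ∀ s ∈ T, ∀ m ∈ M, H.Adj s m → τ s(s, m) ⊆ N)
    (x y : ι → V) (hx : ∀ i, x i ∈ T) (hy : ∀ i, y i ∈ T) (Δ : ℕ)
    (hΔ : ∀ s, #(univ.filter (fun i => x i = s)) + #(univ.filter (fun i => y i = s)) ≤ Δ)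
    (hco : ∀ s ∈ T, ∀ s' ∈ T, s ≠ s' → 2 * Δ < #(M.filter (fun m => H.Adj s m ∧ H.Adj s' m))) :
    ∃ L : ι → Finset (Sym2 V), (∀ i, L i ⊆ N) ∧ (∀ i j, i ≠ j → Disjoint (L i) (L j)) ∧
      ∀ i, ∃ p : G.Walk (x i) (y i), p.IsTrail ∧ (∀ e ∈ p.edges, e ∈ L i) ∧ (p.length : ZMod 2) = 0 := by
  obtain ⟨m, hm1, hm2⟩ := greedy H M x y Δ hΔ
    (fun i h => hco _ (hx i) _ (hy i) h)
  have hne : ∀ s ∈ T, ∀ s' ∈ T, ∀ w ∈ M, ∀ w' ∈ M, s(s, w) = s(s', w') → s = s' ∧ w = w' := by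
    intro s hs s' hs' w hw w' hw' h
    rcases Sym2.eq_iff.1 h with h | h
    · exact h
    · exact (Finset.disjoint_left.1 hTM hs (h.1 ▸ hw')).elim
  refine ⟨fun i => if x i = y i then ∅ else τ s(x i, m i) ∪ τ s(y i, m i), ?_, ?_, ?_⟩
  · intro i
    by_cases h : x i = y i
    · simp [h]
    · simp only [if_neg h]
      obtain ⟨h1, h2, h3⟩ := hm1 i h
      exact union_subset (hN _ (hx i) _ h1 h2) (hN _ (hy i) _ h1 h3)
  · intro i j hij
    by_cases h : x i = y i
    · simp [h]
    by_cases h' : x j = y j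
    · simp [h']
    simp only [if_neg h, if_neg h']
    obtain ⟨h1, h2, h3⟩ := hm1 i h
    obtain ⟨h1', h2', h3'⟩ := hm1 j h'
    have hh := hm2 i j hij h h'
    rw [disjoint_union_left, disjoint_union_right, disjoint_union_right]
    refine ⟨⟨hτ _ h2 _ h2' ?_, hτ _ h2 _ h3' ?_⟩, hτ _ h3 _ h2' ?_, hτ _ h3 _ h3' ?_⟩
    · intro e
      have := hne _ (hx i) _ (hx j) _ h1 _ h1' e
      exact (hh this.2).1 this.1
    · intro e
      have := hne _ (hx i) _ (hy j) _ h1 _ h1' e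
      exact (hh this.2).2.1 this.1
    · intro e
      have := hne _ (hy i) _ (hx j) _ h1 _ h1' e
      exact (hh this.2).2.2.1 this.1
    · intro e
      have := hne _ (hy i) _ (hy j) _ h1 _ h1' e
      exact (hh this.2).2.2.2 this.1
  · intro i
    by_cases h : x i = y i
    · exact nil_walk h _ rfl
    · obtain ⟨h1, h2, h3⟩ := hm1 i h
      obtain ⟨p, hp1, hp2, hp3⟩ := hw _ (hx i) _ h1 h2
      obtain ⟨p', hp1', hp2', hp3'⟩ := hw _ (hy i) _ h1 h3
      refine ⟨p.append p'.reverse, isTrail_append hp1 hp1'.reverse ?_, ?_, ?_⟩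
      · intro e he he'
        rw [Walk.edges_reverse, List.mem_reverse] at he'
        refine Finset.disjoint_left.1 (hτ _ h2 _ h3 ?_) (hp2 e he) (hp2' e he')
        intro e
        exact h (hne _ (hx i) _ (hy i) _ h1 _ h1 e).1
      · intro e he
        rw [Walk.edges_append, List.mem_append, Walk.edges_reverse, List.mem_reverse] at he
        simp only [if_neg h]
        rcases he with he | he
        · exact mem_union_left _ (hp2 e he)
        · exact mem_union_right _ (hp2' e he)
      · rw [Walk.length_append, Walk.length_reverse, Nat.cast_add, hp3, hp3']
        generalize g (m i) = z
        revert z; decide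

end
end PPI

namespace PPI
set_option linter.unusedSectionVars false
section
open Finset
open scoped Classical

variable {V : Type*} [Fintype V]

lemma card_filter_sum {α β : Type*} [Fintype α] [Fintype β] (f : α → V) (g : β → V) (s : V) :
    #(univ.filter (fun i => Sum.elim f g i = s)) =
      #(univ.filter (fun i => f i = s)) + #(univ.filter (fun i => g i = s)) := by
  rw [card_filter, card_filter, card_filter, Fintype.sum_sum_type]
  rfl

set_option maxHeartbeats 1000000 in
lemma assemble {G : SimpleGraph V} {t : ℕ} (σ : Sym2 (Fin t) → ZMod 2) (H : SimpleGraph V)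
    (T M : Finset V) (hTM : Disjoint T M)
    (τ : Sym2 V → Finset (Sym2 V)) (g : V → ZMod 2) (N : Finset (Sym2 V))
    (hw : ∀ s ∈ T, ∀ m ∈ M, H.Adj s m → ∃ p : G.Walk s m, p.IsTrail ∧ (∀ e ∈ p.edges, e ∈ τ s(s, m)) ∧
      (p.length : ZMod 2) = g m)
    (hτ : ∀ e ∈ H.edgeSet, ∀ e' ∈ H.edgeSet, e ≠ e' → Disjoint (τ e) (τ e'))
    (hN : ∀ s ∈ T, ∀ m ∈ M, H.Adj s m → τ s(s, m) ⊆ N)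
    (hco : ∀ s ∈ T, ∀ s' ∈ T, s ≠ s' → 2 * (6 * t) < #(M.filter (fun m => H.Adj s m ∧ H.Adj s' m)))
    (hT : t ≤ #T) (a b : Fin t × Fin t → V) (P : ∀ k, G.Walk (a k) (b k))
    (hP1 : ∀ k, (P k).IsTrail) (hP2 : ∀ k, Odd (P k).length)
    (hP3 : ∀ k k', k ≠ k' → List.Disjoint (P k).edges (P k').edges)
    (hP4 : ∀ k, ∀ e ∈ (P k).edges, e ∉ N)
    (ha : ∀ k, a k ∈ T) (hb : ∀ k, b k ∈ T)
    (hab : ∀ s, #(univ.filter (fun i => a i = s)) + #(univ.filter (fun i => b i = s)) ≤ 2 * t) :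
    HasParityPatternImmersion G t σ := by
  obtain ⟨r, hr⟩ : ∃ r : Fin t ↪ V, ∀ i, r i ∈ T := by
    have : Fintype.card (Fin t) ≤ Fintype.card {x // x ∈ T} := by
      rw [Fintype.card_coe, Fintype.card_fin]; exact hT
    obtain ⟨f⟩ := Function.Embedding.nonempty_of_card_le this
    exact ⟨f.trans (Function.Embedding.subtype _), fun i => (f i).2⟩
  let a' : Fin t × Fin t → V := fun k => if σ s(k.1, k.2) = 1 then a k else r k.2
  let b' : Fin t × Fin t → V := fun k => if σ s(k.1, k.2) = 1 then b k else r k.2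
  have ha' : ∀ k, a' k = if σ s(k.1, k.2) = 1 then a k else r k.2 := fun _ => rfl
  have hb' : ∀ k, b' k = if σ s(k.1, k.2) = 1 then b k else r k.2 := fun _ => rfl
  clear_value a' b'
  have c1 : ∀ s, #(univ.filter (fun k : Fin t × Fin t => r k.1 = s)) ≤ t := by
    intro s
    have := card_le_card_of_injOn (s := univ.filter (fun k : Fin t × Fin t => r k.1 = s))
      (t := (univ : Finset (Fin t))) (fun k => k.2) (fun _ _ => mem_univ _) (by
        intro k hk k' hk' h
        have e1 := (mem_filter.1 hk).2
        have e2 := (mem_filter.1 hk').2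
        exact Prod.ext (r.injective (e1.trans e2.symm)) h)
    simpa using this
  have c2 : ∀ s, #(univ.filter (fun k : Fin t × Fin t => r k.2 = s)) ≤ t := by
    intro s
    have := card_le_card_of_injOn (s := univ.filter (fun k : Fin t × Fin t => r k.2 = s))
      (t := (univ : Finset (Fin t))) (fun k => k.1) (fun _ _ => mem_univ _) (by
        intro k hk k' hk' h
        have e1 := (mem_filter.1 hk).2
        have e2 := (mem_filter.1 hk').2
        exact Prod.ext h (r.injective (e1.trans e2.symm)))
    simpa using this
  have c3 : ∀ (f f' : Fin t × Fin t → V) s, (∀ k, f' k = if σ s(k.1, k.2) = 1 then f k else r k.2) →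
      #(univ.filter (fun k => f' k = s)) ≤ #(univ.filter (fun k => f k = s)) + t := by
    intro f f' s hf
    refine (card_le_card (t := (univ.filter (fun k => f k = s)) ∪
      (univ.filter (fun k : Fin t × Fin t => r k.2 = s))) ?_).trans
      ((card_union_le _ _).trans (Nat.add_le_add_left (c2 s) _))
    intro k hk
    have := (mem_filter.1 hk).2
    rw [hf] at this
    simp only [mem_union, mem_filter, mem_univ, true_and]
    split_ifs at this
    · exact Or.inl this
    · exact Or.inr this
  obtain ⟨L, hL1, hL2, hL3⟩ := links (G := G) H T M hTM τ g N hw hτ hN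
    (Sum.elim (fun k : Fin t × Fin t => r k.1) b') (Sum.elim a' (fun k : Fin t × Fin t => r k.2))
    (by
      rintro (k | k)
      · exact hr _
      · show b' k ∈ T
        rw [hb']
        split_ifs
        · exact hb k
        · exact hr _)
    (by
      rintro (k | k)
      · show a' k ∈ T
        rw [ha']
        split_ifs
        · exact ha k
        · exact hr _
      · exact hr _) (6 * t)
    (by
      intro s
      rw [card_filter_sum, card_filter_sum]
      have h1 := c1 s
      have h2 := c2 s
      have h3 := c3 a a' s ha'
      have h4 := c3 b b' s hb'
      have h5 := hab s
      omega) hco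
  refine imm_of r (fun k => L (Sum.inl k) ∪ (P k).edges.toFinset ∪ L (Sum.inr k)) ?_ ?_
  · intro k k' hk
    have hPL : ∀ k q, Disjoint (P k).edges.toFinset (L q) := by
      intro k q
      rw [Finset.disjoint_left]
      intro e he hL
      exact hP4 k e (List.mem_toFinset.1 he) (hL1 q hL)
    simp only [disjoint_union_left, disjoint_union_right]
    refine ⟨⟨⟨⟨hL2 _ _ ?_, hPL _ _⟩, hL2 _ _ ?_⟩, ⟨(hPL _ _).symm, ?_⟩, (hPL _ _).symm⟩,
      ⟨hL2 _ _ ?_, hPL _ _⟩, hL2 _ _ ?_⟩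
    · simpa using hk
    · simp
    · rw [Finset.disjoint_left]
      intro e he he'
      exact hP3 k k' hk (List.mem_toFinset.1 he) (List.mem_toFinset.1 he')
    · simp
    · simpa using hk
  · intro i j _
    have hq : ∃ p : G.Walk (r i) (a' (i, j)), p.IsTrail ∧ (∀ e ∈ p.edges, e ∈ L (Sum.inl (i, j))) ∧
      (p.length : ZMod 2) = 0 := hL3 (Sum.inl (i, j))
    have hq' : ∃ p : G.Walk (b' (i, j)) (r j), p.IsTrail ∧ (∀ e ∈ p.edges, e ∈ L (Sum.inr (i, j))) ∧
      (p.length : ZMod 2) = 0 := hL3 (Sum.inr (i, j))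
    obtain ⟨p, hp1, hp2, hp3⟩ := hq
    obtain ⟨p', hp1', hp2', hp3'⟩ := hq'
    have hmid : ∃ w : G.Walk (a' (i, j)) (b' (i, j)), w.IsTrail ∧
        (∀ e ∈ w.edges, e ∈ (P (i, j)).edges.toFinset) ∧ (w.length : ZMod 2) = σ s(i, j) := by
      by_cases h1 : σ s(i, j) = 1
      · have e1 : a' (i, j) = a (i, j) := by rw [ha']; exact if_pos h1
        have e2 : b' (i, j) = b (i, j) := by rw [hb']; exact if_pos h1
        rw [e1, e2, h1]
        refine ⟨P (i, j), hP1 _, fun e he => List.mem_toFinset.2 he, ?_⟩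
        exact ZMod.natCast_eq_one_iff_odd.2 (hP2 _)
      · have e1 : a' (i, j) = r j := by rw [ha']; exact if_neg h1
        have e2 : b' (i, j) = r j := by rw [hb']; exact if_neg h1
        rw [e1, e2]
        refine nil_walk rfl _ ?_
        generalize σ s(i, j) = z at h1
        revert z; decide
    obtain ⟨w, hw1, hw2, hw3⟩ := hmid
    have hwN : ∀ e ∈ w.edges, e ∉ N := fun e he => hP4 _ e (List.mem_toFinset.1 (hw2 e he))
    refine ⟨(p.append w).append p', isTrail_append (isTrail_append hp1 hw1 ?_) hp1' ?_, ?_, ?_⟩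
    · intro e he he'
      exact hwN e he' (hL1 _ (hp2 e he))
    · intro e he he'
      rw [Walk.edges_append, List.mem_append] at he
      rcases he with he | he
      · exact Finset.disjoint_left.1 (hL2 (Sum.inl (i, j)) (Sum.inr (i, j)) (by simp)) (hp2 e he) (hp2' e he')
      · exact hwN e he (hL1 _ (hp2' e he'))
    · intro e he
      rw [Walk.edges_append, List.mem_append, Walk.edges_append, List.mem_append] at he
      rcases he with (he | he) | he
      · exact mem_union_left _ (mem_union_left _ (hp2 e he))
      · exact mem_union_left _ (mem_union_right _ (hw2 e he))
      · exact mem_union_right _ (hp2' e he)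
    · rw [Walk.length_append, Walk.length_append, Nat.cast_add, Nat.cast_add, hp3, hp3', hw3]
      simp

end
end PPI

namespace PPI
set_option linter.unusedSectionVars false
section
open Finset
open scoped Classical

variable {V : Type*} [Fintype V]

lemma side_parity {G0 : SimpleGraph V} {side : V → Bool} (hs : ∀ u v, G0.Adj u v → side u ≠ side v)
    {u v : V} (p : G0.Walk u v) : (p.length : ZMod 2) = if side u = side v then 0 else 1 := by
  induction p with
  | nil => simp
  | cons h p ih =>
    rename_i a b c
    rw [Walk.length_cons, Nat.cast_add, ih]
    have := hs _ _ h
    cases ha : side a <;> cases hb : side b <;> cases hc : side c <;> simp [ha, hb] at this ⊢ <;> decide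

lemma card_bad (F : Finset (Sym2 V)) (d : ℕ) :
    #(univ.filter (fun v => d < #(F.filter (fun e => v ∈ e)))) * d ≤ 2 * #F := by
  have h1 : ∑ v, #(F.filter (fun e => v ∈ e)) ≤ 2 * #F := by
    have : ∑ v, #(F.filter (fun e => v ∈ e)) = ∑ e ∈ F, #(univ.filter (fun v => v ∈ e)) := by
      simp only [card_filter]
      exact sum_comm
    rw [this, mul_comm, ← smul_eq_mul]
    refine sum_le_card_nsmul _ _ _ ?_
    intro e _
    induction e with | _ a b
    refine (card_le_card (t := {a, b}) ?_).trans card_le_two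
    intro v hv
    simpa using hv
  refine le_trans ?_ h1
  rw [← smul_eq_mul]
  refine (card_nsmul_le_sum _ (fun v => #(F.filter (fun e => v ∈ e))) _ ?_).trans
    (sum_le_sum_of_subset (subset_univ _))
  intro v hv
  exact (mem_filter.1 hv).2.le

lemma nb_in (F : Finset (Sym2 V)) (x : V) (Y : Finset V) (h : ∀ y ∈ Y, s(x, y) ∈ F) :
    #Y ≤ #(F.filter (fun e => x ∈ e)) := by
  refine card_le_card_of_injOn (fun y => s(x, y)) ?_ ?_
  · intro y hy
    exact mem_filter.2 ⟨h y hy, Sym2.mem_mk_left _ _⟩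
  · intro y _ y' _ h
    exact Sym2.congr_right.1 h

lemma F0_deg {G0 H : SimpleGraph V} {d : ℕ} {U : Finset V} {τ : Sym2 V → Finset (Sym2 V)}
    (hv : Valid G0 d H U τ) (S M : Finset V) (hSM : Disjoint S M) (hM : #M ≤ d)
    (F0 : Finset (Sym2 V)) (hF0 : ∀ f, f ∈ F0 ↔ ∃ s ∈ S, ∃ m ∈ M, H.Adj s m ∧ f ∈ τ s(s, m))
    (z : V) (hz : z ∉ M) : #(F0.filter (fun f => z ∈ f)) ≤ d := by
  by_cases hU : z ∈ U
  · have hsub : F0.filter (fun f => z ∈ f) ⊆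
        (M.filter (fun m => H.Adj z m)).biUnion (fun m => (τ s(z, m)).filter (fun f => z ∈ f)) := by
      intro f hf
      obtain ⟨h1, h2⟩ := mem_filter.1 hf
      obtain ⟨s, hs, m, hm, hsm, hfτ⟩ := (hF0 f).1 h1
      have h3 := hv.clean z hU s(s, m) hsm
      have h4 : 0 < #((τ s(s, m)).filter (fun f => z ∈ f)) :=
        card_pos.2 ⟨f, mem_filter.2 ⟨hfτ, h2⟩⟩
      have h5 : z ∈ s(s, m) := by
        by_contra hc
        rw [if_neg hc] at h3
        omega
      have h6 : z = s := by
        rcases Sym2.mem_iff.1 h5 with h | h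
        · exact h
        · exact (hz (h ▸ hm)).elim
      subst h6
      exact mem_biUnion.2 ⟨m, mem_filter.2 ⟨hm, hsm⟩, mem_filter.2 ⟨hfτ, h2⟩⟩
    refine (card_le_card hsub).trans (card_biUnion_le.trans ?_)
    refine (sum_le_card_nsmul _ _ 1 ?_).trans ?_
    · intro m hm
      have := hv.clean z hU s(z, m) (mem_filter.1 hm).2
      rw [if_pos (Sym2.mem_mk_left _ _)] at this
      exact this
    · rw [smul_eq_mul, mul_one]
      exact (card_filter_le _ _).trans hM
  · refine (card_le_card ?_).trans (hv.dirty z hU)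
    intro f hf
    obtain ⟨h1, h2⟩ := mem_filter.1 hf
    obtain ⟨s, hs, m, hm, hsm, hfτ⟩ := (hF0 f).1 h1
    exact mem_filter.2 ⟨mem_biUnion.2 ⟨s(s, m), mem_filter.2 ⟨mem_univ _, hsm⟩, hfτ⟩, h2⟩

set_option maxHeartbeats 1000000 in
theorem critical_main {G : SimpleGraph V} {t : ℕ} (ht : 1 ≤ t) (σ : Sym2 (Fin t) → ZMod 2)
    (hG : Critical G (700000 * t + 32000000)) : HasParityPatternImmersion G t σ := by
  have hne : Nonempty V := by
    by_contra hcon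
    rw [not_nonempty_iff] at hcon
    exact hG.1 ⟨fun v => hcon.elim v, fun v => hcon.elim v⟩
  obtain ⟨G0, C, side, U, hG0, hC, hG0C, hcut, hside, hsupp, hU, hdeg⟩ :=
    exists_base G _ (60 * (1600 * t)) (by omega) (by omega) hG
  obtain ⟨H, Cl, hder, S, M, hSM, hS, hM, hco⟩ := exists_dense (q := 1600 * t) (by omega) U hsupp hU hdeg
  obtain ⟨τ, hv⟩ := hder.valid
  obtain ⟨F0, hF0⟩ := ex_finset (fun f => ∃ s ∈ S, ∃ m ∈ M, H.Adj s m ∧ f ∈ τ s(s, m))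
  have hF0d := F0_deg hv S M hSM hM F0 hF0
  obtain ⟨T, hTS, hTc, β, hTβ⟩ : ∃ T ⊆ S, 800 * t ≤ #T ∧ ∃ β, ∀ s ∈ T, side s = β := by
    have h := card_filter_add_card_filter_not (s := S) (fun s => side s = true)
    by_cases h1 : 800 * t ≤ #(S.filter (fun s => side s = true))
    · exact ⟨_, filter_subset _ _, h1, true, fun s hs => (mem_filter.1 hs).2⟩
    · exact ⟨S.filter (fun s => ¬ side s = true), filter_subset _ _, by omega, false,
        fun s hs => by simpa using (mem_filter.1 hs).2⟩
  have hTM : Disjoint T M := disjoint_of_subset_left hTS hSM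
  obtain ⟨G2, hG2⟩ : ∃ G2 : SimpleGraph V, ∀ u v, G2.Adj u v ↔ G.Adj u v ∧ s(u, v) ∉ F0 :=
    ⟨G.deleteEdges (F0 : Set (Sym2 V)), fun u v => by simp [deleteEdges_adj]⟩
  have hG2le : G2 ≤ G := fun u v h => ((hG2 u v).1 h).1
  have hcut2 : CutOK G2 := by
    refine hcut.mono fun u v huv => (hG2 u v).2 ⟨hC huv, fun hf => ?_⟩
    obtain ⟨s, _, m, _, hsm, hfτ⟩ := (hF0 _).1 hf
    exact hG0C u v (hv.sub _ hsm _ hfτ) huv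
  have h2n : 2 * (t * t) ≤ #T * (2 * t) := by nlinarith
  rcases odd_trails hcut2 T (2 * t) (t * t) h2n with
    ⟨a, b, P, hP1, hP2, hP3, ha, hb, hab⟩ | ⟨A, B, F, hAB, hF, hA, hB, hTA⟩
  · have hequiv : ∀ (f : Fin (t * t) → V) s, #(univ.filter (fun k : Fin t × Fin t => f (finProdFinEquiv k) = s))
        = #(univ.filter (fun i => f i = s)) := by
      intro f s
      refine card_bij (fun k _ => finProdFinEquiv k) ?_ ?_ ?_
      · intro k hk
        exact mem_filter.2 ⟨mem_univ _, (mem_filter.1 hk).2⟩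
      · intro k _ k' _ h
        exact finProdFinEquiv.injective h
      · intro i hi
        refine ⟨finProdFinEquiv.symm i, mem_filter.2 ⟨mem_univ _, ?_⟩, Equiv.apply_symm_apply _ _⟩
        rw [Equiv.apply_symm_apply]
        exact (mem_filter.1 hi).2
    refine assemble σ H T M hTM τ (fun m => if β = side m then 0 else 1) F0 ?_ hv.disj ?_ ?_ (by omega)
      (fun k => a (finProdFinEquiv k)) (fun k => b (finProdFinEquiv k))
      (fun k => (P (finProdFinEquiv k)).mapLe hG2le) ?_ ?_ ?_ ?_ (fun k => ha _) (fun k => hb _) ?_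
    · intro s hs m hm hsm
      obtain ⟨p, hp1, hp2⟩ := hv.walk s m hsm
      refine ⟨p.mapLe hG0, hp1.mapLe hG0, ?_, ?_⟩
      · intro e he
        rw [Walk.edges_mapLe_eq_edges] at he
        exact hp2 e he
      · rw [Walk.length_mapLe, side_parity hside p, hTβ s hs]
    · intro s hs m hm hsm f hf
      exact (hF0 f).2 ⟨s, hTS hs, m, hm, hsm, hf⟩
    · intro s hs s' hs' hss
      have := hco s (hTS hs) s' (hTS hs') hss
      refine lt_of_lt_of_le ?_ this
      omega
    · intro k
      exact (hP1 _).mapLe hG2le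
    · intro k
      rw [Walk.length_mapLe]
      exact hP2 _
    · intro k k' hk
      rw [Walk.edges_mapLe_eq_edges, Walk.edges_mapLe_eq_edges]
      exact hP3 _ _ (fun h => hk (finProdFinEquiv.injective h))
    · intro k e he
      rw [Walk.edges_mapLe_eq_edges] at he
      have := Walk.edges_subset_edgeSet _ he
      induction e with | _ u v
      exact ((hG2 u v).1 this).2
    · intro s
      rw [hequiv a s, hequiv b s]
      exact hab s
  · exfalso
    obtain ⟨bad, hbad⟩ : ∃ bad, bad = univ.filter (fun v => 96000 * t < #(F.filter (fun e => v ∈ e))) :=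
      ⟨_, rfl⟩
    have hbc : #bad ≤ t := by
      have := card_bad F (96000 * t)
      rw [← hbad] at this
      have h3 : #bad * (96000 * t) ≤ 12 * t * t := by nlinarith
      by_contra hc
      push Not at hc
      nlinarith
    have hnb : ∀ v, v ∉ bad → #(F.filter (fun e => v ∈ e)) ≤ 96000 * t := by
      intro v hvb
      by_contra hc
      exact hvb (by rw [hbad]; exact mem_filter.2 ⟨mem_univ _, not_le.1 hc⟩)
    have hZc : #(M ∪ bad) ≤ 96000 * t + t := (card_union_le _ _).trans (by omega)
    have hgen : ∀ A B : Finset V, (∀ x ∈ A, ∀ y, G2.Adj x y → y ∈ B ∨ s(x, y) ∈ F) →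
        ∀ x ∈ A, x ∉ M ∪ bad → #((nb G x).filter (fun y => y ∉ B ∧ y ∉ M ∪ bad)) ≤ 192000 * t := by
      intro A B hA x hx hxZ
      rw [mem_union, not_or] at hxZ
      have h1 := card_filter_add_card_filter_not
        (s := (nb G x).filter (fun y => y ∉ B ∧ y ∉ M ∪ bad)) (fun y => s(x, y) ∈ F0)
      have h2 := (nb_in F0 x (((nb G x).filter (fun y => y ∉ B ∧ y ∉ M ∪ bad)).filter
        (fun y => s(x, y) ∈ F0)) (fun y hy => (mem_filter.1 hy).2)).trans (hF0d x hxZ.1)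
      have h3 := (nb_in F x (((nb G x).filter (fun y => y ∉ B ∧ y ∉ M ∪ bad)).filter
        (fun y => ¬ s(x, y) ∈ F0)) (fun y hy => by
          obtain ⟨hy1, hy2⟩ := mem_filter.1 hy
          obtain ⟨hy3, hy4⟩ := mem_filter.1 hy1
          exact (hA x hx y ((hG2 x y).2 ⟨mem_nb.1 hy3, hy2⟩)).resolve_left hy4.1)).trans (hnb x hxZ.2)
      omega
    have hTAc : #(T \ A) ≤ 2 * t := by
      have h3 : t ≤ 2 * t - 1 := by omega
      have h4 : #(T \ A) * t ≤ 2 * t * t := by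
        calc #(T \ A) * t ≤ #(T \ A) * (2 * t - 1) := Nat.mul_le_mul_left _ h3
          _ ≤ 2 * (t * t) := hTA
          _ = 2 * t * t := by ring
      exact Nat.le_of_mul_le_mul_right h4 ht
    refine hG.extension (D := 192000 * t) A B (M ∪ bad) hAB (by omega) (hgen A B hA) (hgen B A hB) ?_
    have : #(T \ A ∪ bad) < #T := by
      have := card_union_le (T \ A) bad
      omega
    obtain ⟨s, hs, hs'⟩ := exists_mem_notMem_of_card_lt_card this
    rw [mem_union, not_or, mem_sdiff, not_and, not_not] at hs'
    refine ⟨s, mem_union_left _ (hs'.1 hs), ?_⟩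
    rw [mem_union, not_or]
    exact ⟨Finset.disjoint_left.1 hTM hs, hs'.2⟩

theorem transfer {G : SimpleGraph V} {t : ℕ} {σ : Sym2 (Fin t) → ZMod 2} (W : Finset V)
    (h : HasParityPatternImmersion (G.comap (Subtype.val : {x // x ∈ W} → V)) t σ) :
    HasParityPatternImmersion G t σ := by
  obtain ⟨I, hI⟩ := h
  let f : G.comap (Subtype.val : {x // x ∈ W} → V) →g G := ⟨Subtype.val, fun h => h⟩
  have hf : Function.Injective f := Subtype.val_injective
  refine ⟨⟨I.φ.trans (Function.Embedding.subtype _), fun u v h => (I.trail h).map f, ?_, ?_, ?_⟩, ?_⟩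
  · intro u v h
    exact Walk.map_isTrail_of_injective hf (I.isTrail h)
  · intro u v h
    rw [I.symm h]
    exact (Walk.reverse_map f (I.trail h)).symm
  · intro u v a b h1 h2 hne e he he'
    have e1 : e ∈ ((I.trail h1).map f).edges := he
    have e2 : e ∈ ((I.trail h2).map f).edges := he'
    rw [Walk.edges_map, List.mem_map] at e1 e2
    obtain ⟨x, hx, rfl⟩ := e1
    obtain ⟨y, hy, hxy⟩ := e2
    have := Sym2.map.injective hf hxy
    subst this
    exact I.disjoint h1 h2 hne hx hy
  · intro u v h
    have : (((I.trail h).map f).length : ZMod 2) = σ s(u, v) := by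
      rw [Walk.length_map]; exact hI h
    exact this

theorem main_thm (t : ℕ) (ht : 1 ≤ t) (σ : Sym2 (Fin t) → ZMod 2) (G : SimpleGraph V)
    (h : ¬ HasParityPatternImmersion G t σ) : G.chromaticNumber ≤ 700000 * t + 32000000 := by
  have hc : G.Colorable (700000 * t + 32000000) := by
    by_contra hc
    obtain ⟨W, hW⟩ := exists_critical G (700000 * t + 32000000) (by omega) (by
      rintro ⟨c, hcol⟩
      exact hc ⟨Coloring.mk c (fun {u v} huv => hcol u (mem_univ _) v (mem_univ _) huv)⟩)
    exact h (transfer W (critical_main ht σ hW))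
  have := hc.chromaticNumber_le
  exact_mod_cast this

end
end PPI

/-- For any fixed parity pattern σ on the edges of K_t, every finite simple
graph with no K_t-immersion of parity pattern σ has chromatic number at most
700000·t + 32000000. -/
theorem parity_pattern_immersion_free_coloring {V : Type*} [Fintype V] (t : ℕ) (ht : 1 ≤ t)
    (σ : Sym2 (Fin t) → ZMod 2) (G : SimpleGraph V)
    (h : ¬ HasParityPatternImmersion G t σ) :
    G.chromaticNumber ≤ 700000 * t + 32000000 := by
  exact PPI.main_thm t ht σ G h
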